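/- arXiv:2403.15201 — 2 statements merged into one kernel-verified Lean document; each statement's English description precedes it below -/
import Mathlib

section
/- Every hereditary graph class that is monadically independent interprets the class of all graphs: there exist first-order formulas δ(x) and φ(x,y) over the language of graphs, with φ symmetric and irreflexive, such that every finite graph is isomorphic to I_{δ,φ}(G) for some graph G in the class. -/
set_option autoImplicit false

/-- A class of finite graphs, given as a predicate singling out, for each `n`,
the graphs on vertex set `Fin n` that belong to the class. -/
abbrev GraphClass : Type := ∀ n : ℕ, SimpleGraph (Fin n) → Prop

open FirstOrder

/-- The first-order language of graphs expanded by `k` unary color predicates: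
one binary relation symbol (adjacency) and `k` unary relation symbols (the colors). -/
def colLang (k : ℕ) : FirstOrder.Language where
  Functions := fun _ => Empty
  Relations := fun n =>
    match n with
    | 1 => Fin k
    | 2 => Unit
    | _ => Empty

/-- Interpretation of the relation symbols of `colLang k` in a graph `G`
whose vertices are colored by `c`. -/
def colRelMap {k : ℕ} {V : Type} (G : SimpleGraph V) (c : V → Fin k) :
    ∀ n : ℕ, (colLang k).Relations n → (Fin n → V) → Prop
  | 0, r, _ => Empty.elim r
  | 1, i, x => c (x 0) = i
  | 2, _, x => G.Adj (x 0) (x 1)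
  | _ + 3, r, _ => Empty.elim r

/-- The `colLang k`-structure determined by a graph `G` with coloring `c`. -/
def colStruct {k : ℕ} {V : Type} (G : SimpleGraph V) (c : V → Fin k) :
    (colLang k).Structure V where
  funMap := fun f _ => Empty.elim f
  RelMap := fun {n} => colRelMap G c n

/-- Satisfaction of a formula `φ(x, y)` at a pair of vertices of the colored graph `(G, c)`. -/
def colSat {k : ℕ} {V : Type} (G : SimpleGraph V) (c : V → Fin k)
    (φ : (colLang k).Formula (Fin 2)) (u v : V) : Prop :=
  letI := colStruct G c
  φ.Realize ![u, v]

/-- The class `C` transduces the class of all graphs: for some number `k` of colors and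
some first-order formula `φ(x,y)` over the language of graphs with `k` unary predicates,
every finite graph `H` is obtained by coloring some `G ∈ C`, taking the graph with edges
`{uv : u ≠ v and φ(u,v) ∨ φ(v,u)}`, and passing to an induced subgraph isomorphic to `H`. -/
def TransducesAllGraphs (C : GraphClass) : Prop :=
  ∃ (k : ℕ) (φ : (colLang k).Formula (Fin 2)),
    ∀ (n : ℕ) (H : SimpleGraph (Fin n)),
      ∃ (N : ℕ) (G : SimpleGraph (Fin N)), C N G ∧
        ∃ (c : Fin N → Fin k) (e : Fin n → Fin N), Function.Injective e ∧
          ∀ u v : Fin n, H.Adj u v ↔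
            (e u ≠ e v ∧ (colSat G c φ (e u) (e v) ∨ colSat G c φ (e v) (e u)))

/-- A graph class is monadically dependent if it does not transduce the class of all graphs. -/
def MonadicallyDependent (C : GraphClass) : Prop := ¬ TransducesAllGraphs C

/-- `C` is a hereditary graph class: it is closed under induced subgraphs. -/
def Hereditary (C : GraphClass) : Prop :=
  ∀ (n : ℕ) (G : SimpleGraph (Fin n)) (m : ℕ) (f : Fin m → Fin n),
    Function.Injective f → C n G → C m (G.comap f)

/-- Interpretation of the relation symbols of the plain graph language `colLang 0` in a graph. -/
def graphRelMap {V : Type} (G : SimpleGraph V) :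
    ∀ n : ℕ, (colLang 0).Relations n → (Fin n → V) → Prop
  | 0, r, _ => Empty.elim r
  | 1, i, _ => Fin.elim0 i
  | 2, _, x => G.Adj (x 0) (x 1)
  | _ + 3, r, _ => Empty.elim r

/-- The plain graph structure on the vertices of `G`, for the language `colLang 0`
of graphs (with no color predicates). -/
def graphStruct {V : Type} (G : SimpleGraph V) : (colLang 0).Structure V where
  funMap := fun f _ => Empty.elim f
  RelMap := fun {n} => graphRelMap G n

/-- Satisfaction of a one-variable graph formula `δ(x)` at a vertex of `G`. -/
def gSat1 {V : Type} (G : SimpleGraph V) (δ : (colLang 0).Formula (Fin 1)) (u : V) : Prop :=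
  letI := graphStruct G
  δ.Realize ![u]

/-- Satisfaction of a two-variable graph formula `φ(x, y)` at a pair of vertices of `G`. -/
def gSat2 {V : Type} (G : SimpleGraph V) (φ : (colLang 0).Formula (Fin 2)) (u v : V) : Prop :=
  letI := graphStruct G
  φ.Realize ![u, v]

set_option autoImplicit false
open FirstOrder
namespace MInd

/-! ### Definability of graph predicates -/

/-- A predicate on graphs with an assignment of variables `v : ℕ → V`, given by a formula. -/
def Def (P : ∀ V : Type, SimpleGraph V → (ℕ → V) → Prop) : Prop :=
  ∃ ψ : (colLang 0).Formula ℕ, ∀ (V : Type) (G : SimpleGraph V) (v : ℕ → V),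
    (@Language.Formula.Realize (colLang 0) V (graphStruct G) ℕ ψ v) ↔ P V G v

theorem Def.not {P : ∀ V : Type, SimpleGraph V → (ℕ → V) → Prop} (h : Def P) :
    Def (fun V G v => ¬ P V G v) := by
  obtain ⟨ψ, hψ⟩ := h
  refine ⟨ψ.not, fun V G v => ?_⟩
  let _ := graphStruct G
  exact Language.Formula.realize_not.trans (not_congr (hψ V G v))

theorem Def.imp {P Q : ∀ V : Type, SimpleGraph V → (ℕ → V) → Prop} (h : Def P) (h' : Def Q) :
    Def (fun V G v => P V G v → Q V G v) := by
  obtain ⟨ψ, hψ⟩ := h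
  obtain ⟨χ, hχ⟩ := h'
  refine ⟨ψ.imp χ, fun V G v => ?_⟩
  let _ := graphStruct G
  exact Language.Formula.realize_imp.trans (imp_congr (hψ V G v) (hχ V G v))

theorem Def.congr {P Q : ∀ V : Type, SimpleGraph V → (ℕ → V) → Prop} (h : Def P)
    (e : ∀ V G v, P V G v ↔ Q V G v) : Def Q := by
  obtain ⟨ψ, hψ⟩ := h
  exact ⟨ψ, fun V G v => (hψ V G v).trans (e V G v)⟩

theorem Def.and {P Q : ∀ V : Type, SimpleGraph V → (ℕ → V) → Prop} (h : Def P) (h' : Def Q) :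
    Def (fun V G v => P V G v ∧ Q V G v) :=
  (h.imp h'.not).not.congr (fun V G v => by tauto)

theorem Def.or {P Q : ∀ V : Type, SimpleGraph V → (ℕ → V) → Prop} (h : Def P) (h' : Def Q) :
    Def (fun V G v => P V G v ∨ Q V G v) :=
  (h.not.imp h').congr (fun V G v => by tauto)

theorem Def.iff {P Q : ∀ V : Type, SimpleGraph V → (ℕ → V) → Prop} (h : Def P) (h' : Def Q) :
    Def (fun V G v => (P V G v ↔ Q V G v)) :=
  ((h.imp h').and (h'.imp h)).congr (fun V G v => by tauto)

theorem Def.const (p : Prop) : Def (fun _ _ _ => p) := by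
  by_cases hp : p
  · refine ⟨⊤, fun V G v => ?_⟩
    let _ := graphStruct G
    simp [hp, Language.Formula.Realize]
  · refine ⟨⊥, fun V G v => ?_⟩
    let _ := graphStruct G
    simp [hp, Language.Formula.Realize]

theorem Def.eq (m n : ℕ) : Def (fun _ _ v => v m = v n) := by
  refine ⟨(Language.Term.var m).equal (Language.Term.var n), fun V G v => ?_⟩
  let _ := graphStruct G
  simp [Language.Formula.realize_equal]

theorem Def.adj (m n : ℕ) : Def (fun _ G v => G.Adj (v m) (v n)) := by
  let R : (colLang 0).Relations 2 := ()
  refine ⟨Language.Relations.formula R ![Language.Term.var m, Language.Term.var n],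
    fun V G v => ?_⟩
  let _ := graphStruct G
  rw [Language.Formula.realize_rel]
  rfl

theorem Def.sub {P : ∀ V : Type, SimpleGraph V → (ℕ → V) → Prop} (h : Def P) (g : ℕ → ℕ) :
    Def (fun V G v => P V G (fun n => v (g n))) := by
  obtain ⟨ψ, hψ⟩ := h
  refine ⟨ψ.relabel g, fun V G v => ?_⟩
  let _ := graphStruct G
  exact Language.Formula.realize_relabel.trans (hψ V G _)

theorem Def.ex {P : ∀ V : Type, SimpleGraph V → (ℕ → V) → V → Prop}
    (h : Def (fun V G v => P V G (fun n => v (n + 1)) (v 0))) :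
    Def (fun V G v => ∃ a, P V G v a) := by
  obtain ⟨ψ, hψ⟩ := h
  let g : ℕ → ℕ ⊕ Fin 1 := fun n => match n with
    | 0 => Sum.inr 0
    | k + 1 => Sum.inl k
  refine ⟨Language.BoundedFormula.ex (n := 0)
    (Language.BoundedFormula.relabel (n := 1) (k := 0) g ψ), fun V G v => ?_⟩
  let _ := graphStruct G
  rw [Language.Formula.Realize, Language.BoundedFormula.realize_ex]
  refine exists_congr fun a => ?_
  have h1 := hψ V G (fun n => match n with
    | 0 => a
    | k + 1 => v k)
  simp only at h1
  rw [← h1]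
  rw [Language.BoundedFormula.realize_relabel, Language.Formula.Realize]
  apply iff_of_eq
  congr 1
  · funext n
    cases n with
    | zero => rfl
    | succ k => rfl
  · exact Subsingleton.elim _ _

theorem Def.all {P : ∀ V : Type, SimpleGraph V → (ℕ → V) → V → Prop}
    (h : Def (fun V G v => P V G (fun n => v (n + 1)) (v 0))) :
    Def (fun V G v => ∀ a, P V G v a) :=
  (Def.ex (P := fun V G v a => ¬ P V G v a) h.not).not.congr (fun V G v => by simp)

theorem Def.allFin {k : ℕ} {P : Fin k → ∀ V : Type, SimpleGraph V → (ℕ → V) → Prop}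
    (h : ∀ i, Def (P i)) : Def (fun V G v => ∀ i, P i V G v) := by
  induction k with
  | zero => exact (Def.const True).congr (fun V G v => by simp)
  | succ k ih =>
    exact ((h 0).and (ih (fun i => h i.succ))).congr (fun V G v => by
      rw [Fin.forall_fin_succ])

/-- Quantification over tuples; the tuple occupies the variables `0, …, k-1`. -/
theorem Def.exFin {k : ℕ} {P : ∀ V : Type, SimpleGraph V → (ℕ → V) → (Fin k → V) → Prop}
    (h : Def (fun V G v => P V G (fun n => v (n + k)) (fun i => v i))) :
    Def (fun V G v => ∃ w, P V G v w) := by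
  induction k with
  | zero =>
    refine h.congr (fun V G v => ?_)
    constructor
    · intro hh
      exact ⟨_, hh⟩
    · rintro ⟨w, hw⟩
      have e : w = fun i : Fin 0 => v i := Subsingleton.elim _ _
      rw [e] at hw
      exact hw
  | succ k ih =>
    have h2 := Def.ex (P := fun V G v a => P V G (fun n => v (n + k)) (Fin.cons a (fun i => v i)))
      (h.congr (fun V G v => by
        apply iff_of_eq
        congr 1
        funext i
        refine Fin.cases ?_ (fun i => ?_) i
        · rfl
        · simp))
    have h3 := ih (P := fun V G v w => ∃ a, P V G v (Fin.cons a w)) h2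
    refine h3.congr (fun V G v => ?_)
    constructor
    · rintro ⟨w, a, hh⟩
      exact ⟨_, hh⟩
    · rintro ⟨w, hw⟩
      refine ⟨Fin.tail w, w 0, ?_⟩
      rwa [Fin.cons_self_tail]

/-- Definable unary and binary predicates. -/
def Def1 (P : ∀ V : Type, SimpleGraph V → V → Prop) : Prop :=
  Def (fun V G v => P V G (v 0))
def Def2 (P : ∀ V : Type, SimpleGraph V → V → V → Prop) : Prop :=
  Def (fun V G v => P V G (v 0) (v 1))

theorem Def1.at {P : ∀ V : Type, SimpleGraph V → V → Prop} (h : Def1 P) (n : ℕ) :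
    Def (fun V G v => P V G (v n)) :=
  Def.sub h (fun _ => n)
theorem Def2.at {P : ∀ V : Type, SimpleGraph V → V → V → Prop} (h : Def2 P) (m n : ℕ) :
    Def (fun V G v => P V G (v m) (v n)) :=
  Def.sub h (fun k => if k = 0 then m else n)

theorem Def1.formula {P : ∀ V : Type, SimpleGraph V → V → Prop} (h : Def1 P) :
    ∃ δ : (colLang 0).Formula (Fin 1), ∀ (V : Type) (G : SimpleGraph V) (u : V),
      gSat1 G δ u ↔ P V G u := by
  obtain ⟨ψ, hψ⟩ := h
  refine ⟨ψ.relabel (fun _ => 0), fun V G u => ?_⟩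
  let _ := graphStruct G
  have := hψ V G (fun _ => u)
  rw [gSat1, Language.Formula.realize_relabel]
  exact this

theorem Def2.formula {P : ∀ V : Type, SimpleGraph V → V → V → Prop} (h : Def2 P) :
    ∃ φ : (colLang 0).Formula (Fin 2), ∀ (V : Type) (G : SimpleGraph V) (u w : V),
      gSat2 G φ u w ↔ P V G u w := by
  obtain ⟨ψ, hψ⟩ := h
  refine ⟨ψ.relabel (fun n => if n = 0 then 0 else 1), fun V G u w => ?_⟩
  let _ := graphStruct G
  have := hψ V G (fun n => if n = 0 then u else w)
  rw [gSat2, Language.Formula.realize_relabel]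
  simp only [if_true, one_ne_zero, if_false] at this
  rw [← this]
  apply iff_of_eq
  congr 1
  funext n
  by_cases hn : n = 0 <;> simp [hn]

end MInd

set_option autoImplicit false
open FirstOrder
namespace MInd

/-! ### Iterated ultrapowers along a linear order -/

section Iter
open Filter

/-- The fixed nonprincipal ultrafilter. -/
noncomputable abbrev UU : Ultrafilter ℕ := Filter.hyperfilter ℕ

/-- Iterated ultrafilter quantifier along a list of coordinates. -/
def QQ {I : Type} [DecidableEq I] : List I → ((I → ℕ) → ℕ → Prop) → (I → ℕ) → Prop
  | [], P, x => ∀ᶠ n in (UU : Filter ℕ), P x n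
  | q :: l, P, x => ∀ᶠ i in (UU : Filter ℕ), QQ l P (Function.update x q i)

variable {I : Type} [LinearOrder I]

theorem QQ_mono (l : List I) {P Q : (I → ℕ) → ℕ → Prop} (h : ∀ x n, P x n → Q x n) (x : I → ℕ) :
    QQ l P x → QQ l Q x := by
  induction l generalizing x with
  | nil => exact fun hh => Filter.Eventually.mono hh (fun n => h x n)
  | cons q l ih => exact fun hh => Filter.Eventually.mono hh (fun n => ih _)

theorem QQ_and (l : List I) {P Q : (I → ℕ) → ℕ → Prop} (x : I → ℕ) :
    QQ l (fun x n => P x n ∧ Q x n) x ↔ QQ l P x ∧ QQ l Q x := by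
  induction l generalizing x with
  | nil => exact Filter.eventually_and
  | cons q l ih =>
    simp only [QQ, ih]
    exact Filter.eventually_and

theorem QQ_not (l : List I) {P : (I → ℕ) → ℕ → Prop} (x : I → ℕ) :
    QQ l (fun x n => ¬ P x n) x ↔ ¬ QQ l P x := by
  induction l generalizing x with
  | nil => exact Ultrafilter.eventually_not
  | cons q l ih =>
    simp only [QQ, ih]
    exact Ultrafilter.eventually_not

theorem QQ_of (l : List I) {P : (I → ℕ) → ℕ → Prop}
    (h : ∀ x, ∀ᶠ n in (UU : Filter ℕ), P x n) (x : I → ℕ) : QQ l P x := by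
  induction l generalizing x with
  | nil => exact h x
  | cons q l ih => exact Filter.Eventually.of_forall (fun n => ih _)

/-- `P` depends only on the coordinates in `F`. -/
def Dep {β : Type} (F : Finset I) (P : (I → ℕ) → β) : Prop :=
  ∀ x y, (∀ i ∈ F, x i = y i) → P x = P y

theorem Dep.mono {β : Type} {F F' : Finset I} {P : (I → ℕ) → β} (h : Dep F P) (hF : F ⊆ F') :
    Dep F' P := fun x y hxy => h x y (fun i hi => hxy i (hF hi))

theorem QQ_agree (l : List I) {P : (I → ℕ) → ℕ → Prop} {F : Finset I} (hP : Dep F P)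
    (x y : I → ℕ) (h : ∀ i ∈ F, i ∉ l → x i = y i) : QQ l P x ↔ QQ l P y := by
  induction l generalizing x y with
  | nil =>
    have := hP x y (fun i hi => h i hi (by simp))
    simp [QQ, this]
  | cons q l ih =>
    simp only [QQ]
    refine Filter.eventually_congr (Filter.Eventually.of_forall fun n => ih _ _ ?_)
    intro i hi hil
    by_cases hq : i = q
    · subst hq; simp
    · simp only [Function.update_of_ne hq]
      exact h i hi (by simp [hq, hil])

theorem QQ_filter (l : List I) {P : (I → ℕ) → ℕ → Prop} {F : Finset I} (hP : Dep F P)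
    (x : I → ℕ) : QQ l P x ↔ QQ (l.filter (fun i => decide (i ∈ F))) P x := by
  induction l generalizing x with
  | nil => rfl
  | cons q l ih =>
    by_cases hq : q ∈ F
    · simp only [hq, decide_true, List.filter_cons_of_pos, QQ, ih]
    · rw [List.filter_cons_of_neg (by simpa using hq), ← ih]
      simp only [QQ]
      have : ∀ n, QQ l P (Function.update x q n) ↔ QQ l P x := by
        intro n
        apply QQ_agree l hP
        intro i hi _
        rw [Function.update_of_ne]
        rintro rfl; exact hq hi
      simp [this]

theorem QQ_sorted {P : (I → ℕ) → ℕ → Prop} {F : Finset I} (hP : Dep F P)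
    {l l' : List I} (hl : l.Pairwise (· < ·)) (hl' : l'.Pairwise (· < ·))
    (hF : ∀ i ∈ F, i ∈ l) (hF' : ∀ i ∈ F, i ∈ l') (x y : I → ℕ) : QQ l P x ↔ QQ l' P y := by
  rw [QQ_agree l hP x y (fun i hi hn => absurd (hF i hi) hn), QQ_filter l hP, QQ_filter l' hP]
  have : l.filter (fun i => decide (i ∈ F)) = l'.filter (fun i => decide (i ∈ F)) := by
    have h1 := hl.filter (fun i => decide (i ∈ F))
    have h2 := hl'.filter (fun i => decide (i ∈ F))
    refine List.Perm.eq_of_pairwise (le := (· < ·)) ?_ h1 h2 ?_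
    · intro a b _ _ hab hba
      exact absurd hab (not_lt_of_gt hba)
    · rw [List.perm_ext_iff_of_nodup (h1.imp ne_of_lt) (h2.imp ne_of_lt)]
      intro a
      simp only [List.mem_filter, decide_eq_true_eq]
      exact ⟨fun h => ⟨hF' a h.2, h.2⟩, fun h => ⟨hF a h.2, h.2⟩⟩
  rw [this]

/-- The filter of the iterated ultrapower. -/
def WW (I : Type) [LinearOrder I] : Filter ((I → ℕ) × ℕ) where
  sets := {S | ∃ F : Finset I, ∀ l : List I, l.Pairwise (· < ·) → (∀ i ∈ F, i ∈ l) →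
    QQ l (fun x n => (x, n) ∈ S) (fun _ => 0)}
  univ_sets := ⟨∅, fun l _ _ => QQ_of l (by simp) _⟩
  sets_of_superset := by
    rintro S T ⟨F, hF⟩ hST
    exact ⟨F, fun l h1 h2 => QQ_mono l (fun x n h => hST h) _ (hF l h1 h2)⟩
  inter_sets := by
    rintro S T ⟨F, hF⟩ ⟨F', hF'⟩
    refine ⟨F ∪ F', fun l h1 h2 => ?_⟩
    exact (QQ_and l _).2 ⟨hF l h1 (fun i hi => h2 i (by simp [hi])),
      hF' l h1 (fun i hi => h2 i (by simp [hi]))⟩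

theorem WW_iff {P : (I → ℕ) → ℕ → Prop} {F : Finset I} (hP : Dep F P)
    {l : List I} (hl : l.Pairwise (· < ·)) (hF : ∀ i ∈ F, i ∈ l) (x : I → ℕ) :
    (∀ᶠ p in WW I, P p.1 p.2) ↔ QQ l P x := by
  constructor
  · rintro ⟨F0, h0⟩
    have hs : ((F ∪ F0).sort (· ≤ ·)).Pairwise (· < ·) := Finset.sortedLT_sort _ |>.pairwise
    have := h0 _ hs (fun i hi => by simp [hi])
    exact (QQ_sorted hP hs hl (fun i hi => by simp [hi]) hF _ _).1 this
  · intro h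
    exact ⟨F, fun l' h1 h2 => (QQ_sorted hP hl h1 hF h2 _ _).1 h⟩

theorem sort_pw (F : Finset I) : (F.sort (· ≤ ·)).Pairwise (· < ·) :=
  Finset.sortedLT_sort _ |>.pairwise

theorem WW_not {P : (I → ℕ) → ℕ → Prop} {F : Finset I} (hP : Dep F P) :
    (∀ᶠ p in WW I, ¬ P p.1 p.2) ↔ ¬ (∀ᶠ p in WW I, P p.1 p.2) := by
  have hP' : Dep F (fun x n => ¬ P x n) := fun x y h => by
    have := hP x y h
    simp [this]
  rw [WW_iff hP (sort_pw F) (by simp) (fun _ => 0),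
    WW_iff (P := fun x n => ¬ P x n) hP' (sort_pw F) (by simp) (fun _ => 0)]
  exact QQ_not _ _

theorem WW_of {P : (I → ℕ) → ℕ → Prop} (h : ∀ x, ∀ᶠ n in (UU : Filter ℕ), P x n) :
    ∀ᶠ p in WW I, P p.1 p.2 := ⟨∅, fun l _ _ => QQ_of l h _⟩

instance : (WW I).NeBot := by
  rw [Filter.neBot_iff]
  intro h
  have h1 : ∀ᶠ p in WW I, (fun (_ : I → ℕ) (_ : ℕ) => False) p.1 p.2 := by
    rw [h]; exact Filter.eventually_bot
  have h2 := (WW_not (I := I) (P := fun _ _ => False) (F := ∅) (fun _ _ _ => rfl)).1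
    (Filter.Eventually.of_forall (by simp))
  exact h2 h1

theorem QQ_map {α : I → I} (hα : StrictMono α) (l : List I) {P : (I → ℕ) → ℕ → Prop}
    (x : I → ℕ) : QQ (l.map α) (fun x n => P (x ∘ α) n) x ↔ QQ l P (x ∘ α) := by
  induction l generalizing x with
  | nil => rfl
  | cons q l ih =>
    simp only [QQ, List.map_cons, ih]
    have : ∀ n, Function.update x (α q) n ∘ α = Function.update (x ∘ α) q n := fun n =>
      Function.update_comp_eq_of_injective x hα.injective q n
    simp only [this]

theorem WW_map {α : I → I} (hα : StrictMono α) {P : (I → ℕ) → ℕ → Prop} {F : Finset I}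
    (hP : Dep F P) : (∀ᶠ p in WW I, P (p.1 ∘ α) p.2) ↔ (∀ᶠ p in WW I, P p.1 p.2) := by
  have hP' : Dep (F.image α) (fun x n => P (x ∘ α) n) := fun x y h => by
    have := hP (x ∘ α) (y ∘ α) (fun i hi => h _ (Finset.mem_image_of_mem _ hi))
    simp [this]
  rw [WW_iff hP (sort_pw F) (by simp) ((fun _ => 0) ∘ α), ← QQ_map hα]
  refine WW_iff (P := fun x n => P (x ∘ α) n) hP' ?_ ?_ _
  · rw [List.pairwise_map]
    exact (sort_pw F).imp (fun h => hα h)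
  · intro i hi
    rw [Finset.mem_image] at hi
    obtain ⟨j, hj, rfl⟩ := hi
    exact List.mem_map_of_mem (by simpa using hj)

theorem WW_ne {p q : I} (h : p < q) : ∀ᶠ z in WW I, z.1 p ≠ z.1 q := by
  have hP : Dep {p, q} (fun (x : I → ℕ) (_ : ℕ) => x p ≠ x q) := fun x y h => by
    simp [h p (by simp), h q (by simp)]
  refine (WW_iff (l := [p, q]) hP (by simpa using h) (by simp) (fun _ => 0)).2 ?_
  simp only [QQ]
  refine Filter.Eventually.of_forall fun i => ?_
  have : ∀ᶠ j in (UU : Filter ℕ), j ≠ i := by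
    have := (Set.finite_singleton i).compl_mem_hyperfilter
    filter_upwards [this] with j hj using hj
  filter_upwards [this] with j hj
  refine Filter.Eventually.of_forall fun _ => ?_
  rw [Function.update_of_ne (ne_of_lt h)]
  simpa using hj.symm

end Iter

end MInd

set_option autoImplicit false
open FirstOrder
namespace MInd

section Ultra
open Filter
open scoped Classical

variable {I : Type} [LinearOrder I] (M : ℕ → Type)

/-- Finitely supported functions. -/
structure FS (I : Type) [LinearOrder I] (M : ℕ → Type) where
  f : (I → ℕ) → (n : ℕ) → M n
  dep : ∃ F : Finset I, Dep F f

instance FSsetoid (I : Type) [LinearOrder I] (M : ℕ → Type) : Setoid (FS I M) where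
  r a b := ∀ᶠ p in WW I, a.f p.1 p.2 = b.f p.1 p.2
  iseqv := ⟨fun a => Eventually.of_forall fun _ => rfl,
    fun h => h.mono fun _ h => h.symm,
    fun h h' => by filter_upwards [h, h'] with p h h' using h.trans h'⟩

/-- The iterated ultrapower. -/
def NN (I : Type) [LinearOrder I] (M : ℕ → Type) : Type := Quotient (FSsetoid I M)

variable {M}

def FS.mk' (a : FS I M) : NN I M := Quotient.mk _ a

theorem FS.mk'_eq {a b : FS I M} : a.mk' = b.mk' ↔ ∀ᶠ p in WW I, a.f p.1 p.2 = b.f p.1 p.2 :=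
  Quotient.eq (r := FSsetoid I M)

theorem FS.exists_rep (a : NN I M) : ∃ b : FS I M, b.mk' = a := Quotient.exists_rep a

noncomputable def rep (a : NN I M) : FS I M := Quotient.out a
theorem rep_mk (a : NN I M) : (rep a).mk' = a := Quotient.out_eq a
theorem mk_rep (a : FS I M) : ∀ᶠ p in WW I, (rep a.mk').f p.1 p.2 = a.f p.1 p.2 :=
  FS.mk'_eq.1 (rep_mk a.mk')

theorem eventually_all_fin {α ι : Type} [Finite ι] {l : Filter α} {P : ι → α → Prop} :
    (∀ᶠ p in l, ∀ i, P i p) ↔ ∀ i, ∀ᶠ p in l, P i p := Filter.eventually_all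

variable {L : FirstOrder.Language.{0, 0}} [L.IsRelational] [∀ n, L.Structure (M n)]

noncomputable instance NNstr : L.Structure (NN I M) where
  funMap := fun f _ => isEmptyElim f
  RelMap := fun {_} r xs => ∀ᶠ p in WW I, Language.Structure.RelMap r (fun i => (rep (xs i)).f p.1 p.2)

theorem relMap_NN {n : ℕ} (r : L.Relations n) (xs : Fin n → FS I M) :
    Language.Structure.RelMap r (fun i => (xs i).mk') ↔
      ∀ᶠ p in WW I, Language.Structure.RelMap r (fun i => (xs i).f p.1 p.2) := by
  have h : ∀ᶠ p in WW I, ∀ i, (rep (xs i).mk').f p.1 p.2 = (xs i).f p.1 p.2 :=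
    eventually_all_fin.2 (fun i => mk_rep (xs i))
  refine Filter.eventually_congr ?_
  filter_upwards [h] with p hp
  simp only [hp]

theorem exists_common_dep {ι : Type} [Finite ι] (v : ι → FS I M) :
    ∃ F : Finset I, ∀ i, Dep F (v i).f := by
  have := Fintype.ofFinite ι
  choose G hG using fun i => (v i).dep
  refine ⟨Finset.univ.biUnion G, fun i => (hG i).mono ?_⟩
  exact Finset.subset_biUnion_of_mem G (Finset.mem_univ i)

/-- Łoś' theorem for the iterated ultrapower. -/
theorem los [∀ n, Nonempty (M n)] {α : Type} [Finite α] {n : ℕ} (φ : L.BoundedFormula α n)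
    (v : α → FS I M) (xs : Fin n → FS I M) :
    φ.Realize (fun a => (v a).mk') (fun i => (xs i).mk') ↔
      ∀ᶠ p in WW I, φ.Realize (fun a => (v a).f p.1 p.2) (fun i => (xs i).f p.1 p.2) := by
  have term : ∀ {n : ℕ} (xs : Fin n → FS I M) (t : L.Term (α ⊕ Fin n)),
      ∃ a : FS I M, t.realize (Sum.elim (fun a => (v a).mk') (fun i => (xs i).mk')) = a.mk' ∧
      ∀ x n, t.realize (Sum.elim (fun a => (v a).f x n) (fun i => (xs i).f x n)) = a.f x n := by
    intro n xs t
    cases t with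
    | var s =>
      cases s with
      | inl a => exact ⟨v a, rfl, fun _ _ => rfl⟩
      | inr i => exact ⟨xs i, rfl, fun _ _ => rfl⟩
    | func f => exact isEmptyElim f
  induction φ with
  | falsum =>
    simp only [Language.BoundedFormula.Realize]
    simp only [Filter.eventually_false_iff_eq_bot, false_iff]
    exact NeBot.ne inferInstance
  | @equal n t₁ t₂ =>
    obtain ⟨a, ha, ha'⟩ := term xs t₁
    obtain ⟨b, hb, hb'⟩ := term xs t₂
    simp only [Language.BoundedFormula.Realize, ha, ha', hb, hb']
    exact FS.mk'_eq
  | @rel n l R ts =>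
    choose a ha ha' using fun i => term xs (ts i)
    simp only [Language.BoundedFormula.Realize, ha, ha']
    exact relMap_NN R a
  | @imp n φ ψ ih1 ih2 =>
    simp only [Language.BoundedFormula.realize_imp, ih1, ih2]
    obtain ⟨F1, h1⟩ := exists_common_dep v
    obtain ⟨F2, h2⟩ := exists_common_dep xs
    have hd : Dep (F1 ∪ F2) (fun x n => φ.Realize (fun a => (v a).f x n) (fun i => (xs i).f x n)) := by
      intro x y hxy
      have e1 : ∀ a, (v a).f x = (v a).f y := fun a =>
        (h1 a).mono Finset.subset_union_left x y hxy
      have e2 : ∀ a, (xs a).f x = (xs a).f y := fun a =>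
        (h2 a).mono Finset.subset_union_right x y hxy
      simp only [e1, e2]
    constructor
    · intro h
      by_cases hφ : ∀ᶠ p in WW I, φ.Realize (fun a => (v a).f p.1 p.2) (fun i => (xs i).f p.1 p.2)
      · exact (h hφ).mono fun _ h _ => h
      · exact ((WW_not hd).2 hφ).mono fun _ h h' => absurd h' h
    · intro h h'
      filter_upwards [h, h'] with p h h' using h h'
  | @all n φ ih =>
    simp only [Language.BoundedFormula.realize_all]
    have snoc1 : ∀ a : FS I M, (Fin.snoc (fun i => (xs i).mk') a.mk' : Fin (n + 1) → NN I M) =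
        fun i => ((Fin.snoc xs a : Fin (n + 1) → FS I M) i).mk' := by
      intro a
      funext i
      refine Fin.lastCases ?_ (fun i => ?_) i <;> simp
    have snoc2 : ∀ (a : FS I M) x m,
        (Fin.snoc (fun i => (xs i).f x m) (a.f x m) : Fin (n + 1) → M m) =
        fun i => ((Fin.snoc xs a : Fin (n + 1) → FS I M) i).f x m := by
      intro a x m
      funext i
      refine Fin.lastCases ?_ (fun i => ?_) i <;> simp
    constructor
    · intro h
      obtain ⟨F1, h1⟩ := exists_common_dep v
      obtain ⟨F2, h2⟩ := exists_common_dep xs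
      let R : (I → ℕ) → ∀ n, M n → Prop := fun x m b =>
        φ.Realize (fun a => (v a).f x m) (Fin.snoc (fun i => (xs i).f x m) b)
      have hR : Dep (F1 ∪ F2) R := by
        intro x y hxy
        have e1 : ∀ a, (v a).f x = (v a).f y := fun a =>
          (h1 a).mono Finset.subset_union_left x y hxy
        have e2 : ∀ a, (xs a).f x = (xs a).f y := fun a =>
          (h2 a).mono Finset.subset_union_right x y hxy
        simp only [R, e1, e2]
      let w : FS I M := ⟨fun x m => Classical.epsilon (fun b : M m => ¬ R x m b),
        F1 ∪ F2, fun x y hxy => by simp only [hR x y hxy]⟩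
      have hw := h w.mk'
      rw [snoc1] at hw
      replace hw := (ih (Fin.snoc xs w)).1 hw
      simp only [← snoc2] at hw
      filter_upwards [hw] with p hp b
      by_contra hb
      exact Classical.epsilon_spec (p := fun b : M p.2 => ¬ R p.1 p.2 b) ⟨b, hb⟩ hp
    · intro h a
      obtain ⟨a, rfl⟩ := FS.exists_rep a
      rw [snoc1]
      refine (ih (Fin.snoc xs a)).2 ?_
      simp only [← snoc2]
      exact h.mono fun p hp => hp _

/-- The action of a strictly monotone self-map of the index order. -/
def FS.act (α : I → I) (a : FS I M) : FS I M where
  f x n := a.f (x ∘ α) n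
  dep := by
    obtain ⟨F, hF⟩ := a.dep
    exact ⟨F.image α, fun x y h => by
      funext n
      exact congrFun (hF (x ∘ α) (y ∘ α) (fun i hi => h _ (Finset.mem_image_of_mem _ hi))) n⟩

noncomputable def act (α : I → I) (a : NN I M) : NN I M := ((rep a).act α).mk'

theorem WW_map2 {α : I → I} (hα : StrictMono α) {ι : Type} [Finite ι] (v : ι → FS I M)
    (R : ∀ n, (ι → M n) → Prop) :
    (∀ᶠ p in WW I, R p.2 (fun i => ((v i).act α).f p.1 p.2)) ↔
      ∀ᶠ p in WW I, R p.2 (fun i => (v i).f p.1 p.2) := by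
  obtain ⟨F, hF⟩ := exists_common_dep v
  have hd : Dep F (fun x n => R n (fun i => (v i).f x n)) := by
    intro x y hxy
    have e : ∀ i, (v i).f x = (v i).f y := fun i => hF i x y hxy
    simp only [e]
  exact WW_map hα hd

theorem act_mk {α : I → I} (hα : StrictMono α) (a : FS I M) : act α a.mk' = (a.act α).mk' := by
  refine FS.mk'_eq.2 ?_
  have := (WW_map2 hα ![rep a.mk', a] (fun n z => z 0 = z 1)).2 (by simpa using mk_rep a)
  simpa using this

theorem act_id (a : NN I M) : act id a = a := by
  rw [← rep_mk a, act_mk strictMono_id]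
  rfl

theorem act_act {α β : I → I} (hα : StrictMono α) (hβ : StrictMono β) (a : NN I M) :
    act α (act β a) = act (α ∘ β) a := by
  obtain ⟨a, rfl⟩ := FS.exists_rep a
  rw [act_mk hβ, act_mk hα, act_mk (hα.comp hβ)]
  rfl

theorem relMap_act {α : I → I} (hα : StrictMono α) {n : ℕ} (r : L.Relations n)
    (xs : Fin n → NN I M) : Language.Structure.RelMap r (fun i => act α (xs i)) ↔
      Language.Structure.RelMap r xs := by
  have e : xs = fun i => (rep (xs i)).mk' := by funext i; rw [rep_mk]
  conv_rhs => rw [e]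
  rw [relMap_NN]
  unfold act
  rw [relMap_NN]
  exact WW_map2 hα (fun i => rep (xs i)) (fun _ z => Language.Structure.RelMap r z)

/-- Moving the first argument by `α` or `β` has the same effect, when some `θ` takes one to the
other and fixes the support of the second argument. -/
theorem act_move {α β θ : I → I} (hθ : StrictMono θ)
    (u v : FS I M) {F1 F2 : Finset I} (h1 : Dep F1 u.f) (h2 : Dep F2 v.f)
    (hθ1 : ∀ i ∈ F1, θ (α i) = β i) (hθ2 : ∀ i ∈ F2, θ i = i)
    (R : ∀ n, M n → M n → Prop) :
    (∀ᶠ p in WW I, R p.2 ((u.act α).f p.1 p.2) (v.f p.1 p.2)) ↔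
    (∀ᶠ p in WW I, R p.2 ((u.act β).f p.1 p.2) (v.f p.1 p.2)) := by
  have := WW_map2 hθ ![u.act α, v] (fun n z => R n (z 0) (z 1))
  simp only [Matrix.cons_val_zero, Matrix.cons_val_one] at this
  rw [← this]
  have e1 : ∀ x n, ((u.act α).act θ).f x n = (u.act β).f x n := by
    intro x n
    refine congrFun (h1 _ _ ?_) n
    intro i hi
    simp [hθ1 i hi]
  have e2 : ∀ x n, (v.act θ).f x n = v.f x n := by
    intro x n
    refine congrFun (h2 _ _ ?_) n
    intro i hi
    simp [hθ2 i hi]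
  simp only [e1, e2]

end Ultra

end MInd

set_option autoImplicit false
open FirstOrder
namespace MInd

/-- Eventual independence of the two shifts. -/
def Stab (e : ℤ → ℤ → Prop) (K : ℤ) : Prop :=
  (∀ m n, K ≤ m → (e m n ↔ e K n)) ∧ (∀ m n, m ≤ -K → (e m n ↔ e (-K) n)) ∧
  (∀ m n, K ≤ n → (e m n ↔ e m K)) ∧ (∀ m n, n ≤ -K → (e m n ↔ e m (-K)))

theorem Stab.mono {e : ℤ → ℤ → Prop} {K K' : ℤ} (h : Stab e K) (hK : K ≤ K') : Stab e K' := by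
  obtain ⟨h1, h2, h3, h4⟩ := h
  refine ⟨fun m n hm => ?_, fun m n hm => ?_, fun m n hm => ?_, fun m n hm => ?_⟩
  · rw [h1 m n (by omega), h1 K' n hK]
  · rw [h2 m n (by omega), h2 (-K') n (by omega)]
  · rw [h3 m n (by omega), h3 m K' hK]
  · rw [h4 m n (by omega), h4 m (-K') (by omega)]

/-- A graph with an action of `ℤ²` and a coupling of two orbits. -/
structure Sys (V : Type) (k : ℕ) where
  E : SimpleGraph V
  Col : Fin k → V → Prop
  A : ℤ → ℤ → V → V
  A_zero : ∀ v, A 0 0 v = v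
  A_add : ∀ m n m' n' v, A m n (A m' n' v) = A (m + m') (n + n') v
  A_adj : ∀ m n u v, E.Adj (A m n u) (A m n v) ↔ E.Adj u v
  A_col : ∀ m n i u, Col i (A m n u) ↔ Col i u
  stab : ∀ u v, ∃ K : ℤ, 0 < K ∧ Stab (fun m n => E.Adj (A m n u) v) K ∧
    Stab (fun m n => A m n u = v) K
  Φ : V → V → Prop
  Φ_inv : ∀ τ : V ≃ V, (∀ u v, E.Adj (τ u) (τ v) ↔ E.Adj u v) →
    (∀ i u, Col i (τ u) ↔ Col i u) → ∀ u v, Φ (τ u) (τ v) ↔ Φ u v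
  aL : V
  aR : V
  c : V
  aL_fix : A 0 1 aL = aL
  aR_fix : A 1 0 aR = aR
  hL : Φ aL c
  hL' : ¬ Φ (A 1 0 aL) c
  hR : Φ aR c
  hR' : ¬ Φ (A 0 1 aR) c

section Shift
open Filter

abbrev BZ : Type := Bool ×ₗ ℤ

/-- Coordinatewise self-map of the index order. -/
def TT (g : Bool → ℤ → ℤ) : BZ → BZ := fun p => toLex ((ofLex p).1, g (ofLex p).1 (ofLex p).2)

theorem TT_mono {g : Bool → ℤ → ℤ} (hg : ∀ b, StrictMono (g b)) : StrictMono (TT g) := by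
  intro p q hpq
  rw [Prod.Lex.lt_iff] at hpq
  show toLex _ < toLex _
  rw [Prod.Lex.toLex_lt_toLex]
  rcases hpq with h | ⟨h1, h2⟩
  · exact Or.inl h
  · right
    refine ⟨h1, ?_⟩
    show g _ _ < g _ _
    rw [h1]
    exact hg _ h2

def sh (m n : ℤ) : BZ → BZ := TT (fun b z => z + bif b then n else m)

theorem sh_mono (m n : ℤ) : StrictMono (sh m n) :=
  TT_mono (fun b x y h => by simpa using h)

theorem sh_zero : sh 0 0 = id := by
  funext p
  simp only [sh, TT, id]
  cases h : (ofLex p).1 <;> simp [← h]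

theorem sh_comp (m n m' n' : ℤ) : sh m n ∘ sh m' n' = sh (m + m') (n + n') := by
  funext p
  simp only [sh, TT, Function.comp]
  cases (ofLex p).1 <;> simp <;> ring

theorem stab_aux {M : ℕ → Type} (u v : FS BZ M) : ∃ K : ℤ, 0 < K ∧
    ∀ R : ∀ n, M n → M n → Prop,
    Stab (fun m n => ∀ᶠ p in WW BZ, R p.2 ((u.act (sh m n)).f p.1 p.2) (v.f p.1 p.2)) K := by
  obtain ⟨F1, h1⟩ := u.dep
  obtain ⟨F2, h2⟩ := v.dep
  obtain ⟨B, hB⟩ : ∃ B : ℕ, ∀ i ∈ F1 ∪ F2, (ofLex i).2.natAbs ≤ B :=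
    ⟨(F1 ∪ F2).sup (fun i => (ofLex i).2.natAbs), fun i hi =>
      Finset.le_sup (f := fun i : BZ => (ofLex i).2.natAbs) hi⟩
  have hB1 : ∀ i ∈ F1, -(B : ℤ) ≤ (ofLex i).2 ∧ (ofLex i).2 ≤ B := fun i hi => by
    have := hB i (Finset.mem_union_left _ hi)
    omega
  have hB2 : ∀ i ∈ F2, -(B : ℤ) ≤ (ofLex i).2 ∧ (ofLex i).2 ≤ B := fun i hi => by
    have := hB i (Finset.mem_union_right _ hi)
    omega
  have mono1 : ∀ (b0 : Bool) (d : ℤ), 0 ≤ d → ∀ b, StrictMono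
      (fun z : ℤ => if b = b0 then (if z ≤ B then z else z + d) else z) := by
    intro b0 d hd b x y hxy
    dsimp only
    split_ifs <;> omega
  have mono2 : ∀ (b0 : Bool) (d : ℤ), 0 ≤ d → ∀ b, StrictMono
      (fun z : ℤ => if b = b0 then (if z < -B then z - d else z) else z) := by
    intro b0 d hd b x y hxy
    dsimp only
    split_ifs <;> omega
  refine ⟨2 * B + 1, by omega, fun R => ⟨fun m n hm => ?_, fun m n hm => ?_,
    fun m n hm => ?_, fun m n hm => ?_⟩⟩
  · refine (act_move (TT_mono (mono1 false (m - (2 * B + 1)) (by omega))) u v h1 h2 ?_ ?_ R).symm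
    · intro i hi
      have := hB1 i hi
      cases h : (ofLex i).1
      · simp only [sh, TT, h, ofLex_toLex, cond_false, if_true]
        rw [if_neg (by omega)]
        congr 2; ring
      · simp [sh, TT, h]
    · intro i hi
      have := hB2 i hi
      simp only [TT]
      rw [if_pos this.2]
      simp
  · refine (act_move (TT_mono (mono2 false (-(2 * B + 1) - m) (by omega))) u v h1 h2 ?_ ?_ R).symm
    · intro i hi
      have := hB1 i hi
      cases h : (ofLex i).1
      · simp only [sh, TT, h, ofLex_toLex, cond_false, if_true]
        rw [if_pos (by omega)]
        congr 2; ring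
      · simp [sh, TT, h]
    · intro i hi
      have := hB2 i hi
      simp only [TT]
      rw [if_neg (not_lt.2 this.1)]
      simp
  · refine (act_move (TT_mono (mono1 true (n - (2 * B + 1)) (by omega))) u v h1 h2 ?_ ?_ R).symm
    · intro i hi
      have := hB1 i hi
      cases h : (ofLex i).1
      · simp [sh, TT, h]
      · simp only [sh, TT, h, ofLex_toLex, cond_true, if_true]
        rw [if_neg (by omega)]
        congr 2; ring
    · intro i hi
      have := hB2 i hi
      simp only [TT]
      rw [if_pos this.2]
      simp
  · refine (act_move (TT_mono (mono2 true (-(2 * B + 1) - n) (by omega))) u v h1 h2 ?_ ?_ R).symm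
    · intro i hi
      have := hB1 i hi
      cases h : (ofLex i).1
      · simp [sh, TT, h]
      · simp only [sh, TT, h, ofLex_toLex, cond_true, if_true]
        rw [if_pos (by omega)]
        congr 2; ring
    · intro i hi
      have := hB2 i hi
      simp only [TT]
      rw [if_neg (not_lt.2 this.1)]
      simp

end Shift

instance (k : ℕ) : (colLang k).IsRelational := fun _ => inferInstanceAs (IsEmpty Empty)

/-- Subdivided bicliques from the transduction. -/
theorem trans_data {C : GraphClass} {k : ℕ} {φ : (colLang k).Formula (Fin 2)}
    (h : ∀ (n : ℕ) (H : SimpleGraph (Fin n)),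
      ∃ (N : ℕ) (G : SimpleGraph (Fin N)), C N G ∧
        ∃ (c : Fin N → Fin k) (e : Fin n → Fin N), Function.Injective e ∧
          ∀ u v : Fin n, H.Adj u v ↔
            (e u ≠ e v ∧ (colSat G c φ (e u) (e v) ∨ colSat G c φ (e v) (e u)))) (n : ℕ) :
    ∃ (N : ℕ) (G : SimpleGraph (Fin N)) (c : Fin N → Fin k) (a b : ℕ → Fin N)
      (cc : ℕ → ℕ → Fin N), C N G ∧
      (∀ i k l, i ≤ n → k ≤ n → l ≤ n →
        ((colSat G c φ (a i) (cc k l) ∨ colSat G c φ (cc k l) (a i)) ↔ i = k)) ∧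
      (∀ i k l, i ≤ n → k ≤ n → l ≤ n →
        ((colSat G c φ (b i) (cc k l) ∨ colSat G c φ (cc k l) (b i)) ↔ i = l)) := by
  let T : Type := Fin (n + 1) ⊕ Fin (n + 1) ⊕ (Fin (n + 1) × Fin (n + 1))
  let rel : T → T → Prop := fun x y => match x, y with
    | .inl i, .inr (.inr z) => i = z.1
    | .inr (.inl j), .inr (.inr z) => j = z.2
    | _, _ => False
  let H0 : SimpleGraph T := SimpleGraph.fromRel rel
  let eq := Fintype.equivFin T
  obtain ⟨N, G, hC, c, e, he, hH⟩ := h (Fintype.card T) (H0.comap eq.symm)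
  have key : ∀ x y : T, x ≠ y → ((colSat G c φ (e (eq x)) (e (eq y)) ∨
      colSat G c φ (e (eq y)) (e (eq x))) ↔ (rel x y ∨ rel y x)) := by
    intro x y hxy
    have h1 := hH (eq x) (eq y)
    have h2 : e (eq x) ≠ e (eq y) := fun h => hxy (eq.injective (he h))
    simp only [h2, ne_eq, not_false_eq_true, true_and] at h1
    rw [← h1]
    simp [H0, SimpleGraph.fromRel_adj, hxy]
  let o : ℕ → Fin (n + 1) := fun i => Fin.ofNat (n + 1) i
  have ho : ∀ i j, i ≤ n → j ≤ n → (o i = o j ↔ i = j) := by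
    intro i j hi hj
    simp only [o, Fin.ofNat, Fin.mk.injEq]
    rw [Nat.mod_eq_of_lt (by omega), Nat.mod_eq_of_lt (by omega)]
  refine ⟨N, G, c, fun i => e (eq (.inl (o i))), fun i => e (eq (.inr (.inl (o i)))),
    fun k l => e (eq (.inr (.inr (o k, o l)))), hC, ?_, ?_⟩
  · intro i k l hi hk hl
    rw [key _ _ (by simp)]
    simp [rel, ho i k hi hk]
  · intro i k l hi hk hl
    rw [key _ _ (fun h => by cases h)]
    simp [rel, ho i l hi hl]

open Filter in
theorem exists_sys {C : GraphClass} (hHer : Hereditary C) (hT : TransducesAllGraphs C) :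
    ∃ (V : Type) (k : ℕ) (S : Sys V k), ∀ (m : ℕ) (f : Fin m → V), Function.Injective f →
      C m (S.E.comap f) := by
  obtain ⟨k, φ, h⟩ := hT
  choose N G col a b cc hC ha hb using trans_data h
  let M : ℕ → Type := fun n => Fin (N n)
  let _ : ∀ n, (colLang k).Structure (M n) := fun n => colStruct (G n) (col n)
  have _ : ∀ n, Nonempty (M n) := fun n => ⟨a n 0⟩
  let V := NN BZ M
  let adj : (colLang k).Relations 2 := ()
  let clr : Fin k → (colLang k).Relations 1 := fun i => i
  have adjM : ∀ n (x : Fin 2 → M n), Language.Structure.RelMap adj x ↔ (G n).Adj (x 0) (x 1) :=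
    fun n x => Iff.rfl
  have adjV : ∀ u v : FS BZ M, Language.Structure.RelMap adj ![u.mk', v.mk'] ↔
      ∀ᶠ p in WW BZ, (G p.2).Adj (u.f p.1 p.2) (v.f p.1 p.2) := by
    intro u v
    have := relMap_NN adj ![u, v]
    have e : (fun i => (![u, v] i).mk') = ![u.mk', v.mk'] := by
      funext i; fin_cases i <;> rfl
    rw [e] at this
    rw [this]
    rfl
  let E : SimpleGraph V :=
    { Adj := fun u v => Language.Structure.RelMap adj ![u, v]
      symm := ⟨fun u v huv => by
        obtain ⟨u, rfl⟩ := FS.exists_rep u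
        obtain ⟨v, rfl⟩ := FS.exists_rep v
        rw [adjV] at huv ⊢
        exact huv.mono fun _ h => h.symm⟩
      loopless := ⟨fun u huv => by
        obtain ⟨u, rfl⟩ := FS.exists_rep u
        rw [adjV] at huv
        obtain ⟨p, hp⟩ := huv.exists
        exact hp.ne rfl⟩ }
  have hE : ∀ u v : FS BZ M, E.Adj u.mk' v.mk' ↔
      ∀ᶠ p in WW BZ, (G p.2).Adj (u.f p.1 p.2) (v.f p.1 p.2) := adjV
  let Φ : V → V → Prop := fun u v => φ.Realize ![u, v] ∨ φ.Realize ![v, u]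
  have real : ∀ u v : FS BZ M, φ.Realize ![u.mk', v.mk'] ↔
      ∀ᶠ p in WW BZ, colSat (G p.2) (col p.2) φ (u.f p.1 p.2) (v.f p.1 p.2) := by
    intro u v
    have := los φ ![u, v] (default : Fin 0 → FS BZ M)
    have e : (fun i => (![u, v] i).mk') = ![u.mk', v.mk'] := by
      funext i; fin_cases i <;> rfl
    rw [e] at this
    unfold Language.Formula.Realize
    have e0 : (fun i : Fin 0 => ((default : Fin 0 → FS BZ M) i).mk') = default :=
      Subsingleton.elim _ _
    rw [e0] at this
    refine this.trans (Filter.eventually_congr (Filter.Eventually.of_forall fun p => ?_))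
    · unfold colSat Language.Formula.Realize
      apply iff_of_eq
      congr 1
      · funext i; fin_cases i <;> rfl
      · exact Subsingleton.elim _ _
  have Φpos : ∀ u v : FS BZ M, (∀ᶠ p in WW BZ,
      (colSat (G p.2) (col p.2) φ (u.f p.1 p.2) (v.f p.1 p.2) ∨
      colSat (G p.2) (col p.2) φ (v.f p.1 p.2) (u.f p.1 p.2))) → Φ u.mk' v.mk' := by
    intro u v huv
    obtain ⟨F1, h1⟩ := u.dep
    obtain ⟨F2, h2⟩ := v.dep
    by_contra hn
    simp only [Φ, not_or, real] at hn
    have hd : ∀ R : ∀ n, M n → M n → Prop, Dep (F1 ∪ F2) (fun x n => R n (u.f x n) (v.f x n)) := by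
      intro R x y hxy
      have e1 : u.f x = u.f y := h1.mono Finset.subset_union_left x y hxy
      have e2 : v.f x = v.f y := h2.mono Finset.subset_union_right x y hxy
      simp only [e1, e2]
    have q1 := (WW_not (hd (fun n x y => colSat (G n) (col n) φ x y))).2 hn.1
    have q2 := (WW_not (hd (fun n x y => colSat (G n) (col n) φ y x))).2 hn.2
    obtain ⟨p, hp, hp1, hp2⟩ := (huv.and (q1.and q2)).exists
    exact hp.elim hp1 hp2
  have Φneg : ∀ u v : FS BZ M, (∀ᶠ p in WW BZ,
      ¬ (colSat (G p.2) (col p.2) φ (u.f p.1 p.2) (v.f p.1 p.2) ∨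
      colSat (G p.2) (col p.2) φ (v.f p.1 p.2) (u.f p.1 p.2))) → ¬ Φ u.mk' v.mk' := by
    intro u v huv hn
    rcases hn with hn | hn
    · rw [real] at hn
      obtain ⟨p, hp, hp1⟩ := (huv.and hn).exists
      exact hp (Or.inl hp1)
    · rw [real] at hn
      obtain ⟨p, hp, hp1⟩ := (huv.and hn).exists
      exact hp (Or.inr hp1)
  let iL : BZ := toLex (false, 0)
  let iR : BZ := toLex (true, 0)
  let aL : FS BZ M := ⟨fun x n => a n (x iL), {iL}, fun x y h => by simp [h iL (by simp)]⟩
  let aR : FS BZ M := ⟨fun x n => b n (x iR), {iR}, fun x y h => by simp [h iR (by simp)]⟩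
  let c : FS BZ M := ⟨fun x n => cc n (x iL) (x iR), {iL, iR}, fun x y h => by
    simp [h iL (by simp), h iR (by simp)]⟩
  have big : ∀ i : BZ, ∀ᶠ p in WW BZ, p.1 i ≤ p.2 := by
    intro i
    refine WW_of (P := fun x n => x i ≤ n) (fun x => ?_)
    exact (Filter.eventually_ge_atTop (x i)).filter_mono Nat.hyperfilter_le_atTop
  have rel_act : ∀ m n (u v : V), E.Adj (act (sh m n) u) (act (sh m n) v) ↔ E.Adj u v := by
    intro m n u v
    have := relMap_act (M := M) (sh_mono m n) adj ![u, v]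
    have e : (fun i => act (sh m n) (![u, v] i)) = ![act (sh m n) u, act (sh m n) v] := by
      funext i; fin_cases i <;> rfl
    rw [e] at this
    exact this
  refine ⟨V, k, 
    { E := E
      Col := fun i u => Language.Structure.RelMap (clr i) ![u]
      A := fun m n v => act (sh m n) v
      A_zero := fun v => by rw [sh_zero]; exact act_id v
      A_add := fun m n m' n' v => by rw [act_act (sh_mono _ _) (sh_mono _ _), sh_comp]
      A_adj := rel_act
      A_col := fun m n i u => by
        have := relMap_act (M := M) (sh_mono m n) (clr i) ![u]
        have e : (fun j => act (sh m n) (![u] j)) = ![act (sh m n) u] := by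
          funext i; fin_cases i; rfl
        rw [e] at this
        exact this
      stab := fun u v => by
        obtain ⟨u, rfl⟩ := FS.exists_rep u
        obtain ⟨v, rfl⟩ := FS.exists_rep v
        obtain ⟨K, hK, hR⟩ := stab_aux u v
        refine ⟨K, hK, ?_, ?_⟩
        · have := hR (fun n x y => (G n).Adj x y)
          simp only [act_mk (sh_mono _ _), hE]
          exact this
        · have := hR (fun n x y => x = y)
          simp only [act_mk (sh_mono _ _)]
          have e : ∀ m n, ((u.act (sh m n)).mk' = v.mk') = ∀ᶠ p in WW BZ,
              ((u.act (sh m n)).f p.1 p.2) = (v.f p.1 p.2) := fun m n => propext FS.mk'_eq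
          simp only [e]
          exact this
      Φ := Φ
      Φ_inv := fun τ h1 h2 u v => ?_
      aL := aL.mk'
      aR := aR.mk'
      c := c.mk'
      aL_fix := ?_
      aR_fix := ?_
      hL := ?_
      hL' := ?_
      hR := ?_
      hR' := ?_ }, ?_⟩
  · have τ' : ∃ τ' : V ≃[colLang k] V, ∀ v, τ' v = τ v := by
      refine ⟨{ toEquiv := τ, map_fun' := fun f => isEmptyElim f, map_rel' := ?_ }, fun v => rfl⟩
      intro n r x
      match n, r, x with
      | 0, r, _ => exact Empty.elim r
      | 1, r, x =>
        have := h2 r (x 0)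
        have e : ∀ y : Fin 1 → V, y = ![y 0] := fun y => by funext i; fin_cases i; rfl
        rw [e x]
        rw [e (τ.toFun ∘ ![x 0])]
        exact this
      | 2, r, x =>
        have := h1 (x 0) (x 1)
        have e : ∀ y : Fin 2 → V, y = ![y 0, y 1] := fun y => by funext i; fin_cases i <;> rfl
        rw [e x]
        rw [e (τ.toFun ∘ ![x 0, x 1])]
        exact this
      | _ + 3, r, _ => exact Empty.elim r
    obtain ⟨τ', hτ⟩ := τ'
    have key : ∀ u v, φ.Realize ![τ u, τ v] ↔ φ.Realize ![u, v] := by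
      intro u v
      have := Language.StrongHomClass.realize_formula τ' φ (v := ![u, v])
      rw [← this]
      apply iff_of_eq
      congr 1
      funext i; fin_cases i <;> simp [hτ]
    simp only [Φ, key]
  · rw [act_mk (sh_mono _ _)]
    refine FS.mk'_eq.2 (Filter.Eventually.of_forall fun p => ?_)
    simp [FS.act, aL, sh, TT, iL]
  · rw [act_mk (sh_mono _ _)]
    refine FS.mk'_eq.2 (Filter.Eventually.of_forall fun p => ?_)
    simp [FS.act, aR, sh, TT, iR]
  · apply Φpos
    filter_upwards [big iL, big iR] with p h1 h2
    exact (ha p.2 _ _ _ h1 h1 h2).2 rfl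
  · rw [act_mk (sh_mono _ _)]
    apply Φneg
    have hlt : iL < sh 1 0 iL := by
      simp [sh, TT, iL, Prod.Lex.toLex_lt_toLex]
    filter_upwards [big iL, big iR, big (sh 1 0 iL), WW_ne hlt] with p h1 h2 h3 h4
    intro hh
    exact h4 ((ha p.2 _ _ _ h3 h1 h2).1 hh).symm
  · apply Φpos
    filter_upwards [big iL, big iR] with p h1 h2
    exact (hb p.2 _ _ _ h2 h1 h2).2 rfl
  · rw [act_mk (sh_mono _ _)]
    apply Φneg
    have hlt : iR < sh 0 1 iR := by
      simp [sh, TT, iR, Prod.Lex.toLex_lt_toLex]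
    filter_upwards [big iL, big iR, big (sh 0 1 iR), WW_ne hlt] with p h1 h2 h3 h4
    intro hh
    exact h4 ((hb p.2 _ _ _ h3 h1 h2).1 hh).symm
  · intro m f hf
    dsimp only
    choose g hg using fun i => FS.exists_rep (f i)
    have ev : ∀ᶠ p in WW BZ, ∀ i j, ((G p.2).Adj ((g i).f p.1 p.2) ((g j).f p.1 p.2) ↔
        E.Adj (f i) (f j)) ∧ ((g i).f p.1 p.2 = (g j).f p.1 p.2 ↔ i = j) := by
      refine eventually_all_fin.2 fun i => eventually_all_fin.2 fun j => ?_
      obtain ⟨F1, h1⟩ := (g i).dep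
      obtain ⟨F2, h2⟩ := (g j).dep
      have hd : ∀ R : ∀ n, M n → M n → Prop,
          Dep (F1 ∪ F2) (fun x n => R n ((g i).f x n) ((g j).f x n)) := by
        intro R x y hxy
        have e1 : (g i).f x = (g i).f y := h1.mono Finset.subset_union_left x y hxy
        have e2 : (g j).f x = (g j).f y := h2.mono Finset.subset_union_right x y hxy
        simp only [e1, e2]
      refine Filter.Eventually.and ?_ ?_
      · by_cases hh : E.Adj (f i) (f j)
        · have h' := hh
          rw [← hg i, ← hg j, hE] at h'
          exact h'.mono fun p hp => by simp [hp, hh]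
        · have h' := hh
          rw [← hg i, ← hg j, hE] at h'
          have := (WW_not (hd (fun n x y => (G n).Adj x y))).2 h'
          exact this.mono fun p hp => by simp [hp, hh]
      · by_cases hh : i = j
        · subst hh; simp
        · have h' : ¬ f i = f j := fun h => hh (hf h)
          rw [← hg i, ← hg j, FS.mk'_eq] at h'
          have := (WW_not (hd (fun n x y => x = y))).2 h'
          exact this.mono fun p hp => by simp [hp, hh]
    obtain ⟨p, hp⟩ := ev.exists
    have := hHer _ (G p.2) m (fun i => (g i).f p.1 p.2) (fun i j hij => (hp i j).2.1 hij) (hC p.2)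
    convert this using 1
    ext i j
    exact (hp i j).1.symm

end MInd

set_option autoImplicit false
namespace MInd

/-- `u` realizes the pattern `f` on an `n × n` grid with layers `0, …, r`. -/
structure Realizes {V : Type} (E : SimpleGraph V) (r : ℕ)
    (f : ℕ → ℕ → Ordering → Ordering → Prop) (n : ℕ) (u : ℕ → ℕ → ℕ → V) : Prop where
  inj : ∀ s t i j i' j', s ≤ r → t ≤ r → i < n → j < n → i' < n → j' < n →
    u s i j = u t i' j' → s = t ∧ (s ≠ r → i = i') ∧ (s ≠ 0 → j = j')
  left : ∀ i j j', i < n → j < n → j' < n → u 0 i j = u 0 i j'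
  right : ∀ i i' j, i < n → i' < n → j < n → u r i j = u r i' j
  adj : ∀ s t i j i' j', s ≤ r → t ≤ r → i < n → j < n → i' < n → j' < n →
    u s i j ≠ u t i' j' → (E.Adj (u s i j) (u t i' j') ↔ f s t (compare i i') (compare j j'))

def NonConst (g : Ordering → Ordering → Prop) : Prop :=
  ∃ σ τ σ' τ', ¬ (g σ τ ↔ g σ' τ')

structure Mesh {V : Type} (E : SimpleGraph V) (r : ℕ)
    (f : ℕ → ℕ → Ordering → Ordering → Prop) : Prop where
  pos : 1 ≤ r
  real : ∀ n, ∃ u, Realizes E r f n u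
  nonconst : ∀ s < r, NonConst (f s (s + 1))

namespace Sys
variable {V : Type} {k : ℕ} (S : Sys V k)

def P (u v : V) : Prop := ∃ K0 : ℤ, ∀ K, K0 ≤ K → S.E.Adj (S.A (-K) (-K) u) v

theorem P_iff (u v : V) {K : ℤ} (hK : Stab (fun m n => S.E.Adj (S.A m n u) v) K) (m n : ℤ)
    (hm : m ≤ -K) (hn : n ≤ -K) : S.P u v ↔ S.E.Adj (S.A m n u) v := by
  obtain ⟨h1, h2, h3, h4⟩ := hK
  have key : ∀ m n, m ≤ -K → n ≤ -K →
      (S.E.Adj (S.A m n u) v ↔ S.E.Adj (S.A (-K) (-K) u) v) := fun m n hm hn =>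
    (h2 m n hm).trans (h4 (-K) n hn)
  rw [key m n hm hn]
  constructor
  · rintro ⟨K0, h0⟩
    rw [← key (-(max K0 K)) (-(max K0 K)) (by omega) (by omega)]
    exact h0 _ (by omega)
  · intro h
    exact ⟨K, fun K' hK' => (key _ _ (by omega) (by omega)).2 h⟩

theorem P_left (a b : ℤ) (u v : V) : S.P (S.A a b u) v ↔ S.P u v := by
  obtain ⟨K1, -, h1, -⟩ := S.stab (S.A a b u) v
  obtain ⟨K2, -, h2, -⟩ := S.stab u v
  rw [S.P_iff _ _ h1 (-K1 - |K2| - |a| - |b| - |K1|) (-K1 - |K2| - |a| - |b| - |K1|),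
    S.P_iff _ _ h2 (-K1 - |K2| - |a| - |b| - |K1| + a) (-K1 - |K2| - |a| - |b| - |K1| + b), S.A_add]
  all_goals
    have := abs_nonneg K1; have := abs_nonneg K2; have := le_abs_self a; have := le_abs_self b
    have := le_abs_self K2; have := neg_abs_le K1; have := abs_nonneg a; have := abs_nonneg b
    omega

theorem adj_move (a b m n : ℤ) (u v : V) :
    S.E.Adj (S.A m n u) (S.A a b v) ↔ S.E.Adj (S.A (m - a) (n - b) u) v := by
  rw [← S.A_adj a b (S.A (m - a) (n - b) u) v, S.A_add]
  simp

theorem P_right (a b : ℤ) (u v : V) : S.P u (S.A a b v) ↔ S.P u v := by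
  obtain ⟨K1, -, h1, -⟩ := S.stab u (S.A a b v)
  obtain ⟨K2, -, h2, -⟩ := S.stab u v
  rw [S.P_iff _ _ h1 (-K1 - |K2| - |a| - |b| - |K1|) (-K1 - |K2| - |a| - |b| - |K1|),
    S.P_iff _ _ h2 (-K1 - |K2| - |a| - |b| - |K1| - a) (-K1 - |K2| - |a| - |b| - |K1| - b),
    S.adj_move]
  all_goals
    have := abs_nonneg K1; have := abs_nonneg K2; have := neg_abs_le a; have := neg_abs_le b
    have := le_abs_self K2; have := neg_abs_le K1; have := abs_nonneg a; have := abs_nonneg b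
    omega

def D (u v : V) : Prop := ¬ (S.E.Adj u v ↔ S.P u v)

theorem D_shift (a b : ℤ) {u v : V} (h : S.D u v) : S.D (S.A a b u) (S.A a b v) := by
  unfold D at *
  rwa [S.P_left, S.P_right, S.A_adj]

def Aeq (m n : ℤ) : V ≃ V where
  toFun := S.A m n
  invFun := S.A (-m) (-n)
  left_inv v := by rw [S.A_add]; simp [S.A_zero]
  right_inv v := by rw [S.A_add]; simp [S.A_zero]

open scoped Classical in
theorem partial_auto (m n : ℤ) (X : V → Prop) (hX : ∀ v, X (S.A m n v) ↔ X v)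
    (h : ∀ x y, X x → ¬ X y → (S.E.Adj (S.A m n x) y ↔ S.E.Adj x y)) (u c : V)
    (hu : X u) (hc : ¬ X c) : S.Φ (S.A m n u) c ↔ S.Φ u c := by
  have hX' : ∀ v, X (S.A (-m) (-n) v) ↔ X v := fun v => by
    rw [← hX, S.A_add]; simp [S.A_zero]
  let τ : V ≃ V :=
    { toFun := fun v => if X v then S.A m n v else v
      invFun := fun v => if X v then S.A (-m) (-n) v else v
      left_inv := fun v => by
        by_cases hv : X v
        · simp [hv, hX, S.A_add, S.A_zero]
        · simp [hv]
      right_inv := fun v => by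
        by_cases hv : X v
        · simp [hv, hX', S.A_add, S.A_zero]
        · simp [hv] }
  have t1 : ∀ v, X v → τ v = S.A m n v := fun v hv => if_pos hv
  have t2 : ∀ v, ¬ X v → τ v = v := fun v hv => if_neg hv
  have := S.Φ_inv τ ?_ ?_ u c
  · rwa [t1 u hu, t2 c hc] at this
  · intro u v
    by_cases hu : X u <;> by_cases hv : X v
    · rw [t1 u hu, t1 v hv, S.A_adj]
    · rw [t1 u hu, t2 v hv, h u v hu hv]
    · rw [t2 u hu, t1 v hv, S.E.adj_comm, h v u hv hu, S.E.adj_comm]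
    · rw [t2 u hu, t2 v hv]
  · intro i u
    by_cases hu : X u
    · rw [t1 u hu, S.A_col]
    · rw [t2 u hu]

theorem path_shift (a b : ℤ) {u v : V} (h : Relation.ReflTransGen S.D u v) :
    Relation.ReflTransGen S.D (S.A a b u) (S.A a b v) :=
  h.lift (S.A a b) (fun _ _ => S.D_shift a b)

theorem reach_left : ∃ m, Relation.ReflTransGen S.D (S.A m 0 S.aL) S.c := by
  let X : V → Prop := fun x => ∃ m, Relation.ReflTransGen S.D (S.A m 0 S.aL) x
  by_contra hc
  have sh : ∀ a v, X v → X (S.A a 0 v) := by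
    rintro a v ⟨m, hm⟩
    refine ⟨a + m, ?_⟩
    have := S.path_shift a 0 hm
    rwa [S.A_add, add_zero] at this
  have hX : ∀ v, X (S.A 1 0 v) ↔ X v := by
    intro v
    refine ⟨fun h => ?_, sh 1 v⟩
    have := sh (-1) _ h
    rwa [S.A_add, neg_add_cancel, add_zero, S.A_zero] at this
  have := S.partial_auto 1 0 X hX ?_ S.aL S.c ⟨0, by rw [S.A_zero]⟩ hc
  · exact S.hL' (this.2 S.hL)
  · rintro x y hx hy
    have nd : ∀ z, X z → ¬ S.D z y := by
      rintro z ⟨m, hm⟩ hd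
      exact hy ⟨m, hm.tail hd⟩
    have h1 := not_not.1 (nd x hx)
    have h2 := not_not.1 (nd (S.A 1 0 x) ((hX x).2 hx))
    rw [h1, h2, S.P_left]

theorem reach_right : ∃ n, Relation.ReflTransGen S.D S.c (S.A 0 n S.aR) := by
  let X : V → Prop := fun x => ∃ n, Relation.ReflTransGen S.D x (S.A 0 n S.aR)
  by_contra hc
  have sh : ∀ a v, X v → X (S.A 0 a v) := by
    rintro a v ⟨m, hm⟩
    refine ⟨a + m, ?_⟩
    have := S.path_shift 0 a hm
    rwa [S.A_add, add_zero] at this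
  have hX : ∀ v, X (S.A 0 1 v) ↔ X v := by
    intro v
    refine ⟨fun h => ?_, sh 1 v⟩
    have := sh (-1) _ h
    rwa [S.A_add, neg_add_cancel, add_zero, S.A_zero] at this
  have := S.partial_auto 0 1 X hX ?_ S.aR S.c ⟨0, by rw [S.A_zero]⟩ hc
  · exact S.hR' (this.2 S.hR)
  · rintro x y hx hy
    have nd : ∀ z, X z → ¬ S.D y z := by
      rintro z ⟨m, hm⟩ hd
      exact hy ⟨m, Relation.ReflTransGen.head hd hm⟩
    have h1 := not_not.1 (nd x hx)
    have h2 := not_not.1 (nd (S.A 0 1 x) ((hX x).2 hx))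
    rw [S.E.adj_comm, S.E.adj_comm x, h1, h2, S.P_right]

/-- A path of length `r` between a vertex fixed by the second and one fixed by the first shift. -/
def IsPath (r : ℕ) (p : ℕ → V) : Prop :=
  1 ≤ r ∧ S.A 0 1 (p 0) = p 0 ∧ S.A 1 0 (p r) = p r ∧ ∀ s < r, S.D (p s) (p (s + 1))

theorem A_comm (m n m' n' : ℤ) (v : V) : S.A m n (S.A m' n' v) = S.A m' n' (S.A m n v) := by
  rw [S.A_add, S.A_add, add_comm m, add_comm n]

theorem exists_path : ∃ r p, S.IsPath r p := by
  obtain ⟨m, hm⟩ := S.reach_left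
  obtain ⟨n, hn⟩ := S.reach_right
  have h := hm.trans hn
  have gen : ∀ u v, Relation.ReflTransGen S.D u v →
      ∃ (r : ℕ) (p : ℕ → V), p 0 = u ∧ p r = v ∧ ∀ s < r, S.D (p s) (p (s + 1)) := by
    intro u v h
    induction h with
    | refl => exact ⟨0, fun _ => u, rfl, rfl, by simp⟩
    | @tail b c _ hd ih =>
      obtain ⟨r, p, h0, hr, hp⟩ := ih
      refine ⟨r + 1, fun s => if s ≤ r then p s else c, by simp [h0], by simp, ?_⟩
      intro s hs
      by_cases hsr : s = r
      · subst hsr; simpa [hr] using hd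
      · have h1 : s ≤ r := by omega
        have h2 : s + 1 ≤ r := by omega
        simp only [h1, h2, if_true]
        exact hp s (by omega)
  obtain ⟨r, p, h0, hr, hp⟩ := gen _ _ h
  have e0 : S.A 0 1 (p 0) = p 0 := by rw [h0, S.A_comm, S.aL_fix]
  have e1 : S.A 1 0 (p r) = p r := by rw [hr, S.A_comm, S.aR_fix]
  refine ⟨r, p, ?_, e0, e1, hp⟩
  by_contra hlt
  have hr0 : r = 0 := by omega
  subst hr0
  rw [h0, S.A_comm] at e1
  have : S.A 1 0 S.aL = S.aL := (S.Aeq m 0).injective e1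
  exact S.hL' (this.symm ▸ S.hL)

theorem A_iter {a b : ℤ} {v : V} (h : S.A a b v = v) (k : ℤ) : S.A (k * a) (k * b) v = v := by
  induction k using Int.induction_on with
  | zero => simp [S.A_zero]
  | succ i ih =>
    rw [add_mul, add_mul, ← S.A_add, one_mul, one_mul, h, ih]
  | pred i ih =>
    have h' : S.A (-a) (-b) v = v := by
      conv_lhs => rw [← h]
      rw [S.A_add]; simp [S.A_zero]
    have e : ∀ x : ℤ, (-(i : ℤ) - 1) * x = -(i : ℤ) * x + -x := fun x => by ring
    rw [e, e, ← S.A_add, h', ih]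

theorem fix_left {a b : ℤ} {u : V} (h : S.A a b u = u) (hu : S.A 1 0 u ≠ u) : a = 0 := by
  by_contra ha
  obtain ⟨K, hK, -, hs⟩ := S.stab u u
  have h1 := S.A_iter h (K * a)
  have hp : 0 < a * a := mul_self_pos.2 ha
  have hge : K ≤ K * a * a := by nlinarith
  have h2 := (hs.1 (K * a * a) (K * a * b) hge).1 h1
  have h3 := (hs.1 (1 + K * a * a) (0 + K * a * b) (by omega)).2 (by simpa using h2)
  simp only at h3
  rw [← S.A_add, h1] at h3
  exact hu h3

theorem fix_right {a b : ℤ} {u : V} (h : S.A a b u = u) (hu : S.A 0 1 u ≠ u) : b = 0 := by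
  by_contra ha
  obtain ⟨K, hK, -, hs⟩ := S.stab u u
  have h1 := S.A_iter h (K * b)
  have hp : 0 < b * b := mul_self_pos.2 ha
  have hge : K ≤ K * b * b := by nlinarith
  have h2 := (hs.2.2.1 (K * b * a) (K * b * b) hge).1 h1
  have h3 := (hs.2.2.1 (0 + K * b * a) (1 + K * b * b) (by omega)).2 (by simpa using h2)
  simp only at h3
  rw [← S.A_add, h1] at h3
  exact hu h3

def iot : Ordering → ℤ
  | .lt => -1
  | .eq => 0
  | .gt => 1

theorem stab_iot {e : ℤ → ℤ → Prop} {K : ℤ} (hK : 0 < K) (h : Stab e K) (i j i' j' : ℕ) :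
    e (K * ((i : ℤ) - i')) (K * ((j : ℤ) - j')) ↔
      e (K * iot (compare i i')) (K * iot (compare j j')) := by
  have h1 : ∀ n, e (K * ((i : ℤ) - i')) n ↔ e (K * iot (compare i i')) n := by
    intro n
    rcases lt_trichotomy i i' with hi | hi | hi
    · rw [compare_lt_iff_lt.2 hi, h.2.1 _ n (by nlinarith)]
      simp [iot]
    · subst hi; simp [iot]
    · rw [compare_gt_iff_gt.2 hi, h.1 _ n (by nlinarith)]
      simp [iot]
  have h2 : ∀ m, e m (K * ((j : ℤ) - j')) ↔ e m (K * iot (compare j j')) := by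
    intro n
    rcases lt_trichotomy j j' with hi | hi | hi
    · rw [compare_lt_iff_lt.2 hi, h.2.2.2 n _ (by nlinarith)]
      simp [iot]
    · subst hi; simp [iot]
    · rw [compare_gt_iff_gt.2 hi, h.2.2.1 n _ (by nlinarith)]
      simp [iot]
  rw [h1, h2]

theorem exists_mesh : ∃ r f, Mesh S.E r f := by
  classical
  have hex : ∃ r, ∃ p, S.IsPath r p := S.exists_path
  let r := Nat.find hex
  obtain ⟨p, hr, h0, h1, hD⟩ : ∃ p, S.IsPath r p := Nat.find_spec hex
  have hmin : ∀ r' < r, ∀ p, ¬ S.IsPath r' p := fun r' hr' p hp => Nat.find_min hex hr' ⟨p, hp⟩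
  have fix01 : ∀ {v n}, S.A 0 1 v = v → S.A 0 n v = v := fun {v n} h => by
    simpa using S.A_iter h n
  have fix10 : ∀ {v n}, S.A 1 0 v = v → S.A n 0 v = v := fun {v n} h => by
    simpa using S.A_iter h n
  have fixall : ∀ {v m n}, S.A 0 1 v = v → S.A 1 0 v = v → S.A m n v = v := fun {v m n} h h' => by
    have := S.A_add m 0 0 n v
    rw [fix01 h, fix10 h'] at this
    simpa using this.symm
  -- no total fixed points
  have nf01 : ∀ s, 1 ≤ s → s ≤ r → S.A 0 1 (p s) ≠ p s := by
    intro s hs hsr hfix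
    rcases Nat.lt_or_ge s r with h | h
    · refine hmin (r - s) (by omega) (fun i => p (i + s)) ⟨by omega, by simpa using hfix, ?_, ?_⟩
      · simpa [Nat.sub_add_cancel hsr] using h1
      · intro i hi
        have := hD (i + s) (by omega)
        rwa [show i + s + 1 = i + 1 + s by ring] at this
    · have : s = r := le_antisymm hsr h
      subst this
      have hd := hD (r - 1) (by omega)
      rw [Nat.sub_add_cancel hr] at hd
      apply hd
      obtain ⟨K, -, hst, -⟩ := S.stab (p (r - 1)) (p r)
      rw [S.P_iff _ _ hst (-K) (-K) le_rfl le_rfl]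
      conv_rhs => rw [← fixall (m := -K) (n := -K) hfix h1]
      rw [S.A_adj]
  have nf10 : ∀ s, s < r → S.A 1 0 (p s) ≠ p s := by
    intro s hsr hfix
    rcases Nat.eq_zero_or_pos s with h | h
    · subst h
      have hd := hD 0 hsr
      apply hd
      obtain ⟨K, -, hst, -⟩ := S.stab (p 0) (p (0 + 1))
      rw [S.P_iff _ _ hst (-K) (-K) le_rfl le_rfl, fixall h0 hfix]
    · exact hmin s hsr p ⟨h, h0, hfix, fun i hi => hD i (by omega)⟩
  have sep : ∀ s t, s < t → t ≤ r → ∀ m n, p s ≠ S.A m n (p t) := by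
    intro s t hst htr m n heq
    by_cases hc : s = 0 ∧ t = r
    · obtain ⟨rfl, ht⟩ := hc
      rw [ht] at heq
      refine nf10 0 (by omega) ?_
      rw [heq, S.A_comm, h1]
    · refine hmin (r - (t - s)) (by omega)
        (fun i => if i < s then p i else S.A m n (p (i + (t - s)))) ⟨by omega, ?_, ?_, ?_⟩
      · by_cases hs : 0 < s
        · simpa [hs] using h0
        · have hs0 : s = 0 := by omega
          subst hs0
          simp only [lt_irrefl, if_false]
          have : 0 + (t - 0) = t := by omega
          rw [this, ← heq, h0]
      · have h2 : ¬ (r - (t - s) < s) := by omega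
        simp only [h2, if_false]
        rw [S.A_comm, Nat.sub_add_cancel (by omega), h1]
      · intro i hi
        dsimp only
        rcases lt_trichotomy (i + 1) s with h | h | h
        · rw [if_pos (by omega), if_pos h]
          exact hD i (by omega)
        · rw [if_pos (by omega), if_neg (by omega)]
          have : i + 1 + (t - s) = t := by omega
          rw [this, ← heq, ← h]
          exact hD i (by omega)
        · rw [if_neg (by omega), if_neg (by omega)]
          have := S.D_shift m n (hD (i + (t - s)) (by omega))
          rwa [show i + 1 + (t - s) = i + (t - s) + 1 by ring]
  -- common stability bound
  choose KK hKK using fun s t => S.stab (p s) (p t)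
  obtain ⟨K0, hK0⟩ := Finset.exists_le
    (((Finset.range (r + 1)) ×ˢ (Finset.range (r + 1))).image (fun z => KK z.1 z.2))
  let K : ℤ := max K0 1
  have hK : 0 < K := by omega
  have hst : ∀ s t, s ≤ r → t ≤ r → Stab (fun m n => S.E.Adj (S.A m n (p s)) (p t)) K := by
    intro s t hs ht
    refine (hKK s t).2.1.mono ?_
    have := hK0 (KK s t) (Finset.mem_image.2 ⟨(s, t), by simp; omega, rfl⟩)
    omega
  refine ⟨r, fun s t σ τ => S.E.Adj (S.A (K * iot σ) (K * iot τ) (p s)) (p t),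
    hr, fun N => ⟨fun s i j => S.A (K * i) (K * j) (p s), ?_, ?_, ?_, ?_⟩, ?_⟩
  · intro s t i j i' j' hs ht _ _ _ _ heq
    have e1 : p s = S.A (K * i' - K * i) (K * j' - K * j) (p t) := by
      apply (S.Aeq (K * i) (K * j)).injective
      show S.A _ _ _ = S.A _ _ _
      rw [heq, S.A_add]; simp
    have e2 : p t = S.A (K * i - K * i') (K * j - K * j') (p s) := by
      apply (S.Aeq (K * i') (K * j')).injective
      show S.A _ _ _ = S.A _ _ _
      rw [← heq, S.A_add]; simp
    rcases lt_trichotomy s t with h | h | h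
    · exact absurd e1 (sep s t h ht _ _)
    · subst h
      refine ⟨rfl, fun hsr => ?_, fun hs0 => ?_⟩
      · have := S.fix_left e1.symm (nf10 s (by omega))
        have : (i : ℤ) = i' := by nlinarith
        exact_mod_cast this
      · have := S.fix_right e1.symm (nf01 s (by omega) hs)
        have : (j : ℤ) = j' := by nlinarith
        exact_mod_cast this
    · exact absurd e2 (sep t s h hs _ _)
  · intro i j j' _ _ _
    have : ∀ j : ℤ, S.A (K * i) j (p 0) = S.A (K * i) 0 (p 0) := fun j => by
      conv_rhs => rw [← fix01 (n := j) h0]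
      rw [S.A_add]; simp
    rw [this, this (K * j')]
  · intro i i' j _ _ _
    have : ∀ i : ℤ, S.A i (K * j) (p r) = S.A 0 (K * j) (p r) := fun i => by
      conv_rhs => rw [← fix10 (n := i) h1]
      rw [S.A_add]; simp
    rw [this, this (K * i')]
  · intro s t i j i' j' hs ht _ _ _ _ _
    rw [S.adj_move, ← mul_sub, ← mul_sub]
    exact stab_iot hK (hst s t hs ht) i j i' j'
  · intro s hs
    refine ⟨.eq, .eq, .lt, .lt, ?_⟩
    have hd := hD s hs
    unfold D at hd
    rw [S.P_iff _ _ (hst s (s + 1) (by omega) (by omega)) (-K) (-K) le_rfl le_rfl] at hd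
    simpa [iot, S.A_zero] using hd

end Sys
end MInd

set_option autoImplicit false
namespace MInd

theorem cmp_rep (σ : Ordering) : ∃ i < 3, compare i 1 = σ := by
  cases σ
  · exact ⟨0, by omega, by decide⟩
  · exact ⟨1, by omega, by decide⟩
  · exact ⟨2, by omega, by decide⟩

theorem cmp_swap (i j : ℕ) : compare i j = (compare j i).swap := (Nat.compare_swap j i).symm

theorem cmp_rev {n i j : ℕ} (hi : i < n) (hj : j < n) :
    compare (n - 1 - i) (n - 1 - j) = (compare i j).swap := by
  rcases lt_trichotomy i j with h | h | h
  · rw [compare_lt_iff_lt.2 h, compare_gt_iff_gt.2 (by omega)]; rfl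
  · subst h; simp
  · rw [compare_gt_iff_gt.2 h, compare_lt_iff_lt.2 (by omega)]; rfl

theorem cmp_succ (i j : ℕ) : compare (i + 1) (j + 1) = compare i j := by
  rcases lt_trichotomy i j with h | h | h
  · rw [compare_lt_iff_lt.2 h, compare_lt_iff_lt.2 (by omega)]
  · subst h; simp
  · rw [compare_gt_iff_gt.2 h, compare_gt_iff_gt.2 (by omega)]

section
variable {V : Type} {E : SimpleGraph V} {r : ℕ} {f : ℕ → ℕ → Ordering → Ordering → Prop}

/-- A mesh of minimal length. -/
def MinMesh (E : SimpleGraph V) (r : ℕ) (f : ℕ → ℕ → Ordering → Ordering → Prop) : Prop :=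
  Mesh E r f ∧ ∀ r' < r, ∀ f', ¬ Mesh E r' f'

theorem MinMesh.rowRev (h : MinMesh E r f) : MinMesh E r (fun s t σ τ => f s t σ.swap τ) := by
  refine ⟨⟨h.1.pos, fun n => ?_, fun s hs => ?_⟩, h.2⟩
  · obtain ⟨u, hu⟩ := h.1.real n
    refine ⟨fun s i j => u s (n - 1 - i) j, ?_, ?_, ?_, ?_⟩
    · intro s t i j i' j' hs ht hi hj hi' hj' e
      obtain ⟨h1, h2, h3⟩ := hu.inj s t _ j _ j' hs ht (by omega) hj (by omega) hj' e
      exact ⟨h1, fun h => by have := h2 h; omega, h3⟩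
    · intro i j j' hi hj hj'
      exact hu.left _ j j' (by omega) hj hj'
    · intro i i' j hi hi' hj
      exact hu.right _ _ j (by omega) (by omega) hj
    · intro s t i j i' j' hs ht hi hj hi' hj' e
      rw [hu.adj s t _ j _ j' hs ht (by omega) hj (by omega) hj' e, cmp_rev hi hi']
  · obtain ⟨σ, τ, σ', τ', h⟩ := h.1.nonconst s hs
    exact ⟨σ.swap, τ, σ'.swap, τ', by simpa using h⟩

theorem MinMesh.colRev (h : MinMesh E r f) : MinMesh E r (fun s t σ τ => f s t σ τ.swap) := by
  refine ⟨⟨h.1.pos, fun n => ?_, fun s hs => ?_⟩, h.2⟩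
  · obtain ⟨u, hu⟩ := h.1.real n
    refine ⟨fun s i j => u s i (n - 1 - j), ?_, ?_, ?_, ?_⟩
    · intro s t i j i' j' hs ht hi hj hi' hj' e
      obtain ⟨h1, h2, h3⟩ := hu.inj s t i _ i' _ hs ht hi (by omega) hi' (by omega) e
      exact ⟨h1, h2, fun h => by have := h3 h; omega⟩
    · intro i j j' hi hj hj'
      exact hu.left _ _ _ hi (by omega) (by omega)
    · intro i i' j hi hi' hj
      exact hu.right _ _ _ hi hi' (by omega)
    · intro s t i j i' j' hs ht hi hj hi' hj' e
      rw [hu.adj s t i _ i' _ hs ht hi (by omega) hi' (by omega) e, cmp_rev hj hj']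
  · obtain ⟨σ, τ, σ', τ', h⟩ := h.1.nonconst s hs
    exact ⟨σ, τ.swap, σ', τ'.swap, by simpa using h⟩

theorem Mesh.rep (h : Mesh E r f) (s t : ℕ) (hs : s ≤ r) (ht : t ≤ r) (σ τ : Ordering) :
    ∃ i < 3, ∃ j < 3, compare i 1 = σ ∧ compare j 1 = τ := by
  obtain ⟨i, hi, h1⟩ := cmp_rep σ
  obtain ⟨j, hj, h2⟩ := cmp_rep τ
  exact ⟨i, hi, j, hj, h1, h2⟩

theorem Mesh.sym (h : Mesh E r f) (s t : ℕ) (hs : s ≤ r) (ht : t ≤ r) (σ τ : Ordering)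
    (hd : s ≠ t ∨ (s ≠ 0 ∧ s ≠ r ∧ ¬ (σ = .eq ∧ τ = .eq))) :
    f s t σ τ ↔ f t s σ.swap τ.swap := by
  obtain ⟨u, hu⟩ := h.real 3
  obtain ⟨i, hi, j, hj, rfl, rfl⟩ := h.rep s t hs ht σ τ
  have ne : u s i j ≠ u t 1 1 := by
    intro e
    obtain ⟨h1, h2, h3⟩ := hu.inj s t i j 1 1 hs ht hi hj (by omega) (by omega) e
    rcases hd with hd | ⟨hd1, hd2, hd3⟩
    · exact hd h1
    · apply hd3
      rw [h2 hd2, h3 hd1]; simp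
  rw [← hu.adj s t i j 1 1 hs ht hi hj (by omega) (by omega) ne, SimpleGraph.adj_comm,
    hu.adj t s 1 1 i j ht hs (by omega) (by omega) hi hj ne.symm, cmp_swap 1 i, cmp_swap 1 j]

theorem Mesh.zero (h : Mesh E r f) (t : ℕ) (ht1 : 1 ≤ t) (ht : t ≤ r) (σ τ τ' : Ordering) :
    f 0 t σ τ ↔ f 0 t σ τ' := by
  obtain ⟨u, hu⟩ := h.real 3
  obtain ⟨i, hi, rfl⟩ := cmp_rep σ
  obtain ⟨j, hj, rfl⟩ := cmp_rep τ
  obtain ⟨j', hj', rfl⟩ := cmp_rep τ'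
  have ne : ∀ j < 3, u 0 i j ≠ u t 1 1 := by
    intro j hj e
    obtain ⟨h1, h2, h3⟩ := hu.inj 0 t i j 1 1 (by omega) ht hi hj (by omega) (by omega) e
    omega
  rw [← hu.adj 0 t i j 1 1 (by omega) ht hi hj (by omega) (by omega) (ne j hj),
    ← hu.adj 0 t i j' 1 1 (by omega) ht hi hj' (by omega) (by omega) (ne j' hj'),
    hu.left i j j' hi hj hj']

theorem Mesh.last (h : Mesh E r f) (s : ℕ) (hs : s < r) (σ σ' τ : Ordering) :
    f s r σ τ ↔ f s r σ' τ := by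
  obtain ⟨u, hu⟩ := h.real 3
  rw [h.sym s r hs.le le_rfl σ τ (Or.inl hs.ne), h.sym s r hs.le le_rfl σ' τ (Or.inl hs.ne)]
  generalize τ.swap = τ
  generalize σ.swap = σ
  generalize σ'.swap = σ'
  obtain ⟨i, hi, rfl⟩ := cmp_rep σ
  obtain ⟨i', hi', rfl⟩ := cmp_rep σ'
  obtain ⟨j, hj, rfl⟩ := cmp_rep τ
  have ne : ∀ i < 3, u r i j ≠ u s 1 1 := by
    intro i hi e
    obtain ⟨h1, h2, h3⟩ := hu.inj r s i j 1 1 le_rfl hs.le hi hj (by omega) (by omega) e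
    omega
  rw [← hu.adj r s i j 1 1 le_rfl hs.le hi hj (by omega) (by omega) (ne i hi),
    ← hu.adj r s i' j 1 1 le_rfl hs.le hi' hj (by omega) (by omega) (ne i' hi'),
    hu.right i i' j hi hi' hj]

theorem MinMesh.transp (h : MinMesh E r f) :
    MinMesh E r (fun s t σ τ => f (r - s) (r - t) τ σ) := by
  refine ⟨⟨h.1.pos, fun n => ?_, fun s hs => ?_⟩, h.2⟩
  · obtain ⟨u, hu⟩ := h.1.real n
    refine ⟨fun s i j => u (r - s) j i, ?_, ?_, ?_, ?_⟩
    · intro s t i j i' j' hs ht hi hj hi' hj' e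
      obtain ⟨h1, h2, h3⟩ := hu.inj _ _ _ _ _ _ (by omega) (by omega) hj hi hj' hi' e
      exact ⟨by omega, fun h => h3 (by omega), fun h => h2 (by omega)⟩
    · intro i j j' hi hj hj'
      exact hu.right _ _ _ hj hj' hi
    · intro i i' j hi hi' hj
      simp only [Nat.sub_self]
      exact hu.left _ _ _ hj hi hi'
    · intro s t i j i' j' hs ht hi hj hi' hj' e
      exact hu.adj _ _ _ _ _ _ (by omega) (by omega) hj hi hj' hi' e
  · obtain ⟨σ, τ, σ', τ', h0⟩ := h.1.nonconst (r - (s + 1)) (by omega)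
    have e : r - (s + 1) + 1 = r - s := by omega
    rw [e] at h0
    rw [h.1.sym _ _ (by omega) (by omega) σ τ (Or.inl (by omega)),
      h.1.sym _ _ (by omega) (by omega) σ' τ' (Or.inl (by omega))] at h0
    exact ⟨τ.swap, σ.swap, τ'.swap, σ'.swap, h0⟩

theorem MinMesh.two (h : MinMesh E r f) : 2 ≤ r := by
  by_contra hlt
  have hr : r = 1 := by have := h.1.pos; omega
  subst hr
  obtain ⟨σ, τ, σ', τ', h0⟩ := h.1.nonconst 0 (by omega)
  apply h0
  rw [h.1.zero 1 le_rfl le_rfl σ τ τ']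
  exact h.1.last 0 (by omega) σ σ' τ'

theorem MinMesh.const (h : MinMesh E r f) (s t : ℕ) (hst : s + 2 ≤ t) (ht : t ≤ r)
    (σ τ σ' τ' : Ordering) : f s t σ τ ↔ f s t σ' τ' := by
  by_contra hne
  let g : ℕ → ℕ := fun a => if a ≤ s then a else a + (t - s - 1)
  have gmono : ∀ a b, g a = g b → a = b := by
    intro a b; simp only [g]; split_ifs <;> omega
  have gle : ∀ a, a ≤ r - (t - s - 1) → g a ≤ r := by
    intro a; simp only [g]; split_ifs <;> omega
  have g0 : g 0 = 0 := by simp [g]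
  have gr : g (r - (t - s - 1)) = r := by simp only [g]; split_ifs <;> omega
  refine h.2 (r - (t - s - 1)) (by omega) (fun a b => f (g a) (g b)) ⟨by omega, fun n => ?_, ?_⟩
  · obtain ⟨u, hu⟩ := h.1.real n
    refine ⟨fun a => u (g a), ?_, ?_, ?_, ?_⟩
    · intro a b i j i' j' ha hb hi hj hi' hj' e
      obtain ⟨h1, h2, h3⟩ := hu.inj _ _ _ _ _ _ (gle a ha) (gle b hb) hi hj hi' hj' e
      refine ⟨gmono _ _ h1, fun hh => h2 ?_, fun hh => h3 ?_⟩
      · intro hh'; exact hh (gmono _ _ (hh'.trans gr.symm))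
      · intro hh'; exact hh (gmono _ _ (hh'.trans g0.symm))
    · intro i j j'
      rw [g0]; exact hu.left i j j'
    · intro i j j'
      rw [gr]; exact hu.right i j j'
    · intro a b i j i' j' ha hb
      exact hu.adj _ _ _ _ _ _ (gle a ha) (gle b hb)
  · intro a ha
    rcases lt_trichotomy a s with h1 | h1 | h1
    · have e1 : g a = a := by simp only [g]; split_ifs <;> omega
      have e2 : g (a + 1) = a + 1 := by simp only [g]; split_ifs <;> omega
      rw [e1, e2]
      exact h.1.nonconst a (by omega)
    · have e1 : g a = s := by simp only [g]; split_ifs <;> omega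
      have e2 : g (a + 1) = t := by simp only [g]; split_ifs <;> omega
      rw [e1, e2]
      exact ⟨σ, τ, σ', τ', hne⟩
    · have e1 : g a = a + (t - s - 1) := by simp only [g]; split_ifs <;> omega
      have e2 : g (a + 1) = a + (t - s - 1) + 1 := by simp only [g]; split_ifs <;> omega
      rw [e1, e2]
      exact h.1.nonconst _ (by omega)

theorem MinMesh.indep_lt (h : MinMesh E r f) (s : ℕ) (hs : 1 ≤ s) (hsr : s < r)
    (σ σ' : Ordering) : f s (s + 1) σ .lt ↔ f s (s + 1) σ' .lt := by
  by_contra hne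
  refine h.2 (r - s) (by omega) (fun a b σ τ => f (s + a) (s + b) σ
    (if a = 0 then (if b = 0 then .eq else .lt) else (if b = 0 then .gt else τ)))
    ⟨by omega, fun n => ?_, ?_⟩
  · obtain ⟨u, hu⟩ := h.1.real (n + 1)
    refine ⟨fun a i j => u (s + a) i (if a = 0 then 0 else j + 1), ?_, ?_, ?_, ?_⟩
    · intro a b i j i' j' ha hb hi hj hi' hj' e
      obtain ⟨h1, h2, h3⟩ := hu.inj _ _ _ _ _ _ (by omega) (by omega) (by omega)
        (by split_ifs <;> omega) (by omega) (by split_ifs <;> omega) e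
      have hab : a = b := by omega
      subst hab
      refine ⟨rfl, fun hh => h2 (by omega), fun hh => ?_⟩
      have := h3 (by omega)
      simpa [hh] using this
    · intro i j j' _ _ _
      simp
    · intro i j j' hi hj hj'
      have : r - s ≠ 0 := by omega
      simp only [this, if_false]
      have e : s + (r - s) = r := by omega
      rw [e]
      exact hu.right i j (j' + 1) (by omega) (by omega) (by omega)
    · intro a b i j i' j' ha hb hi hj hi' hj' e
      rw [hu.adj _ _ _ _ _ _ (by omega) (by omega) (by omega)
        (by split_ifs <;> omega) (by omega) (by split_ifs <;> omega) e]
      have : compare (if a = 0 then 0 else j + 1) (if b = 0 then 0 else j' + 1) =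
          (if a = 0 then (if b = 0 then .eq else .lt) else
            (if b = 0 then .gt else compare j j')) := by
        split_ifs
        · simp
        · exact compare_lt_iff_lt.2 (by omega)
        · exact compare_gt_iff_gt.2 (by omega)
        · exact cmp_succ _ _
      rw [this]
  · intro a ha
    rcases Nat.eq_zero_or_pos a with h1 | h1
    · subst h1
      exact ⟨σ, .eq, σ', .eq, by simpa using hne⟩
    · obtain ⟨σ, τ, σ', τ', h0⟩ := h.1.nonconst (s + a) (by omega)
      exact ⟨σ, τ, σ', τ', by simpa [h1.ne', ← add_assoc] using h0⟩

theorem MinMesh.indep (h : MinMesh E r f) (s : ℕ) (hs : 1 ≤ s) (hsr : s < r)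
    (σ σ' τ : Ordering) (hτ : τ ≠ .eq) : f s (s + 1) σ τ ↔ f s (s + 1) σ' τ := by
  cases τ
  · exact h.indep_lt s hs hsr σ σ'
  · exact absurd rfl hτ
  · exact h.colRev.indep_lt s hs hsr σ σ'

theorem MinMesh.indep' (h : MinMesh E r f) (s : ℕ) (hsr : s + 2 ≤ r)
    (σ τ τ' : Ordering) (hσ : σ ≠ .eq) : f s (s + 1) σ τ ↔ f s (s + 1) σ τ' := by
  have := h.transp.indep (r - (s + 1)) (by omega) (by omega) τ.swap τ'.swap σ.swap
    (by cases σ <;> simp_all)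
  rw [show r - (r - (s + 1)) = s + 1 by omega, show r - (r - (s + 1) + 1) = s by omega] at this
  rw [h.1.sym s (s + 1) (by omega) (by omega) _ _ (Or.inl (by omega)),
    h.1.sym s (s + 1) (by omega) (by omega) _ τ' (Or.inl (by omega))]
  exact this

theorem MinMesh.off (h : MinMesh E r f) (s : ℕ) (hs : 1 ≤ s) (hsr : s + 2 ≤ r)
    (σ τ : Ordering) (hne : ¬ (σ = .eq ∧ τ = .eq)) :
    ¬ (f s (s + 1) .eq .eq ↔ f s (s + 1) σ τ) := by
  have key : ∀ σ τ, ¬ (σ = .eq ∧ τ = .eq) → (f s (s + 1) σ τ ↔ f s (s + 1) .lt .lt) := by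
    have hgt : ∀ τ, f s (s + 1) .gt τ ↔ f s (s + 1) .lt .lt := fun τ =>
      (h.indep' s hsr .gt τ .lt (by simp)).trans (h.indep s hs (by omega) .gt .lt .lt (by simp))
    have hlt : ∀ τ, f s (s + 1) .lt τ ↔ f s (s + 1) .lt .lt := fun τ =>
      h.indep' s hsr .lt τ .lt (by simp)
    intro σ τ hne
    by_cases hτ : τ = .eq
    · cases σ
      · exact hlt τ
      · exact absurd ⟨rfl, hτ⟩ hne
      · exact hgt τ
    · exact (h.indep s hs (by omega) σ .lt τ hτ).trans (hlt τ)
  rw [key σ τ hne]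
  intro heq
  obtain ⟨σ1, τ1, σ2, τ2, h0⟩ := h.1.nonconst s (by omega)
  have all : ∀ σ τ, f s (s + 1) σ τ ↔ f s (s + 1) .lt .lt := by
    intro σ τ
    by_cases hh : σ = .eq ∧ τ = .eq
    · rw [hh.1, hh.2]; exact heq
    · exact key σ τ hh
  exact h0 ((all σ1 τ1).trans (all σ2 τ2).symm)

/-- The normal form of a minimal mesh. -/
structure Good (E : SimpleGraph V) (r : ℕ) (f : ℕ → ℕ → Ordering → Ordering → Prop) : Prop where
  two : 2 ≤ r
  real : ∀ n, ∃ u, Realizes E r f n u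
  const : ∀ s t, s + 2 ≤ t → t ≤ r → ∀ σ τ σ' τ', (f s t σ τ ↔ f s t σ' τ')
  sym : ∀ s t, s ≤ r → t ≤ r → s ≠ t → ∀ σ τ, (f s t σ τ ↔ f t s σ.swap τ.swap)
  sym1 : ∀ σ τ, ¬ (σ = .eq ∧ τ = .eq) → (f 1 1 σ τ ↔ f 1 1 σ.swap τ.swap)
  zero : ∀ t, 1 ≤ t → t ≤ r → ∀ σ τ τ', (f 0 t σ τ ↔ f 0 t σ τ')
  last : ∀ s, s < r → ∀ σ σ' τ, (f s r σ τ ↔ f s r σ' τ)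
  diag : ∀ s, 1 ≤ s → s < r → ∀ σ, ¬ (f s (s + 1) .eq .eq ↔ f s (s + 1) σ .gt)
  indep : ∀ s, 1 ≤ s → s < r → ∀ σ σ' τ, τ ≠ .eq → (f s (s + 1) σ τ ↔ f s (s + 1) σ' τ)
  off : ∀ s, 1 ≤ s → s + 2 ≤ r → ∀ σ τ, ¬ (σ = .eq ∧ τ = .eq) →
    ¬ (f s (s + 1) .eq .eq ↔ f s (s + 1) σ τ)
  cs : ((∀ σ σ', (f 1 1 σ .lt ↔ f 1 1 σ' .lt)) ∧ (∀ τ τ', ¬ (f 0 1 .eq τ ↔ f 0 1 .lt τ'))) ∨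
    ¬ (f 1 1 .eq .lt ↔ f 1 1 .gt .lt)

theorem MinMesh.good (h : MinMesh E r f)
    (hd : ∀ σ, ¬ (f (r - 1) r .eq .eq ↔ f (r - 1) r σ .gt))
    (hc : ((∀ σ σ', (f 1 1 σ .lt ↔ f 1 1 σ' .lt)) ∧ (∀ τ τ', ¬ (f 0 1 .eq τ ↔ f 0 1 .lt τ'))) ∨
    ¬ (f 1 1 .eq .lt ↔ f 1 1 .gt .lt)) : Good E r f where
  two := h.two
  real := h.1.real
  const := h.const
  sym s t hs ht hst σ τ := h.1.sym s t hs ht σ τ (Or.inl hst)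
  sym1 σ τ hh := h.1.sym 1 1 h.1.pos h.1.pos σ τ
    (Or.inr ⟨one_ne_zero, by have := h.two; omega, hh⟩)
  zero := h.1.zero
  last := h.1.last
  diag s hs hsr σ := by
    rcases Nat.lt_or_ge (s + 1) r with h1 | h1
    · exact h.off s hs (by omega) σ .gt (by simp)
    · have e : s = r - 1 := by omega
      have e' : s + 1 = r := by omega
      rw [e']
      subst e
      exact hd σ
  indep := h.indep
  off := h.off
  cs := hc

theorem exists_good {r : ℕ} {f : ℕ → ℕ → Ordering → Ordering → Prop} (h : Mesh E r f) :
    ∃ r f, Good E r f := by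
  classical
  have hex : ∃ r, ∃ f, Mesh E r f := ⟨r, f, h⟩
  clear h
  obtain ⟨f, hf⟩ := Nat.find_spec hex
  generalize hr : Nat.find hex = r at hf
  have h : MinMesh E r f := ⟨hf, fun r' hr' f' hf' => Nat.find_min hex (hr ▸ hr') ⟨f', hf'⟩⟩
  clear hf hr hex
  -- orient the columns
  obtain ⟨f, h, hd⟩ : ∃ f, MinMesh E r f ∧ ∀ σ, ¬ (f (r - 1) r .eq .eq ↔ f (r - 1) r σ .gt) := by
    have h2 := h.two
    have hl := h.1.last (r - 1) (by omega)
    obtain ⟨σ1, τ1, σ2, τ2, h0⟩ := h.1.nonconst (r - 1) (by omega)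
    rw [Nat.sub_add_cancel (by omega), hl σ1 .eq τ1, hl σ2 .eq τ2] at h0
    by_cases h1 : f (r - 1) r .eq .eq ↔ f (r - 1) r .eq .gt
    · refine ⟨_, h.colRev, fun σ => ?_⟩
      simp only [Ordering.swap]
      rw [hl σ .eq]
      intro h3
      apply h0
      have all : ∀ τ, f (r - 1) r .eq τ ↔ f (r - 1) r .eq .eq := by
        intro τ
        cases τ
        · exact h3.symm
        · exact Iff.rfl
        · exact h1.symm
      exact (all τ1).trans (all τ2).symm
    · refine ⟨f, h, fun σ => ?_⟩
      rw [hl σ .eq]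
      exact h1
  have hd' : ∀ σ, ¬ (f (r - 1) r .eq .eq ↔ f (r - 1) r σ .gt) := hd
  have hl := h.1.last (r - 1) (by have := h.two; omega)
  by_cases hc : ∀ σ σ', (f 1 1 σ .lt ↔ f 1 1 σ' .lt)
  · -- case I
    have hz := h.1.zero 1 le_rfl h.1.pos
    by_cases h1 : f 0 1 .eq .eq ↔ f 0 1 .lt .eq
    · refine ⟨r, _, h.rowRev.good (fun σ => ?_) (Or.inl ⟨fun σ σ' => hc _ _, fun τ τ' => ?_⟩)⟩
      · exact hd _
      · simp only [Ordering.swap]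
        rw [hz .eq τ .eq, hz .gt τ' .eq]
        intro h3
        obtain ⟨σ1, τ1, σ2, τ2, h0⟩ := h.1.nonconst 0 h.1.pos
        apply h0
        have all : ∀ σ τ, f 0 1 σ τ ↔ f 0 1 .eq .eq := by
          intro σ τ
          rw [hz σ τ .eq]
          cases σ
          · exact h1.symm
          · exact Iff.rfl
          · exact h3.symm
        exact (all _ _).trans (all _ _).symm
    · refine ⟨r, f, h.good hd (Or.inl ⟨hc, fun τ τ' => ?_⟩)⟩
      rw [hz .eq τ .eq, hz .lt τ' .eq]
      exact h1
  · by_cases h1 : f 1 1 .eq .lt ↔ f 1 1 .gt .lt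
    · refine ⟨r, _, h.rowRev.good (fun σ => hd _) (Or.inr ?_)⟩
      simp only [Ordering.swap]
      intro h3
      apply hc
      have all : ∀ σ, f 1 1 σ .lt ↔ f 1 1 .eq .lt := by
        intro σ
        cases σ
        · exact h3.symm
        · exact Iff.rfl
        · exact h1.symm
      exact fun σ σ' => (all σ).trans (all σ').symm
    · exact ⟨r, f, h.good hd (Or.inr h1)⟩

end
end MInd

set_option autoImplicit false
namespace MInd

/-! ### The layered graph encoding a pattern -/

/-- Order of the blocks of the layer of twins. -/
def bord (P i : ℕ) : ℕ := if i = 0 then P + 2 else i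

/-- Membership in the twin part, as a condition on row and column. -/
def InT (r P q i j : ℕ) : Prop := i ≤ P + 1 ∧ ∃ κ < r + 2, j = q + 1 + (r + 2) * bord P i + κ

/-- The triples (layer, row, column) used in the construction. -/
def Mem (d r P q : ℕ) (S : ℕ → ℕ → Prop) (s i j : ℕ) : Prop :=
  (s = 0 ∧ d = 1 ∧ i ≤ P ∧ j = 0) ∨ (1 ≤ s ∧ s < r ∧ S i j) ∨
  (s = r ∧ i = 0 ∧ j ≤ q ∧ (r = 2 ∨ j < q)) ∨ (s = 1 ∧ InT r P q i j)

structure Pat (P q : ℕ) (S : ℕ → ℕ → Prop) : Prop where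
  hP : 3 ≤ P
  hq : 1 ≤ q
  bd : ∀ i j, S i j → 1 ≤ i ∧ i ≤ P ∧ j ≤ q
  ne : ∀ j, j ≤ q → ∃ i, S i j
  full : ∀ i, 1 ≤ i → i ≤ P → S i q ∧ S i (q - 1)

structure Frame {W : Type} (E : SimpleGraph W) (r : ℕ) (f : ℕ → ℕ → Ordering → Ordering → Prop)
    (d P q : ℕ) (S : ℕ → ℕ → Prop) {V : Type} (G : SimpleGraph V) where
  good : Good E r f
  pat : Pat P q S
  cs : (d = 1 ∧ (∀ σ σ', (f 1 1 σ .lt ↔ f 1 1 σ' .lt)) ∧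
    (∀ τ τ', ¬ (f 0 1 .eq τ ↔ f 0 1 .lt τ'))) ∨ (d = 0 ∧ ¬ (f 1 1 .eq .lt ↔ f 1 1 .gt .lt))
  lay : V → ℕ
  row : V → ℕ
  col : V → ℕ
  ext : ∀ x y, lay x = lay y → row x = row y → col x = col y → x = y
  mem : ∀ x, Mem d r P q S (lay x) (row x) (col x)
  surj : ∀ s i j, Mem d r P q S s i j → ∃ x, lay x = s ∧ row x = i ∧ col x = j
  adj : ∀ x y, x ≠ y →
    (G.Adj x y ↔ f (lay x) (lay y) (compare (row x) (row y)) (compare (col x) (col y)))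

namespace Frame
variable {W : Type} {E : SimpleGraph W} {r : ℕ} {f : ℕ → ℕ → Ordering → Ordering → Prop}
  {d P q : ℕ} {S : ℕ → ℕ → Prop} {V : Type} {G : SimpleGraph V} (F : Frame E r f d P q S G)
include F

/-- The twin part. -/
def T (x : V) : Prop := F.lay x = 1 ∧ q < F.col x

theorem T_inT {x : V} (h : F.T x) : InT r P q (F.row x) (F.col x) := by
  obtain ⟨h1, h2⟩ := h
  have hr := F.good.two
  rcases F.mem x with h | h | h | h
  · omega
  · have := F.pat.bd _ _ h.2.2
    omega
  · omega
  · exact h.2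

theorem exT {i : ℕ} (hi : i ≤ P + 1) {κ : ℕ} (hκ : κ < r + 2) :
    ∃ x, F.T x ∧ F.row x = i ∧ F.col x = q + 1 + (r + 2) * bord P i + κ := by
  obtain ⟨x, h1, h2, h3⟩ := F.surj 1 i (q + 1 + (r + 2) * bord P i + κ)
    (Or.inr (Or.inr (Or.inr ⟨rfl, hi, κ, hκ, rfl⟩)))
  exact ⟨x, ⟨h1, by omega⟩, h2, h3⟩

theorem T_lt {x y : V} (hx : F.T x) (hy : F.T y) (h : bord P (F.row x) < bord P (F.row y)) :
    F.col x < F.col y := by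
  obtain ⟨_, κ, hκ, e⟩ := F.T_inT hx
  obtain ⟨_, κ', hκ', e'⟩ := F.T_inT hy
  have := Nat.mul_le_mul_left (r + 2) (Nat.succ_le_of_lt h)
  rw [Nat.mul_succ] at this
  omega

theorem bord_inj {i i' : ℕ} (hi : i ≤ P + 1) (hi' : i' ≤ P + 1) (h : bord P i = bord P i') :
    i = i' := by
  unfold bord at h
  split_ifs at h <;> omega

/-- A twin vertex with row `i` which avoids a given vertex. -/
theorem exT_ne {i : ℕ} (hi : i ≤ P + 1) (t : V) : ∃ x, F.T x ∧ F.row x = i ∧ x ≠ t := by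
  obtain ⟨x, h1, h2, h3⟩ := F.exT hi (κ := 0) (by omega)
  obtain ⟨y, h4, h5, h6⟩ := F.exT hi (κ := 1) (by omega)
  by_cases h : x = t
  · refine ⟨y, h4, h5, fun e => ?_⟩
    rw [e, ← h] at h6
    omega
  · exact ⟨x, h1, h2, h⟩

/-- Classification of the vertices outside the twin part. -/
theorem nT {x : V} (h : ¬ F.T x) : (F.lay x = 0 ∧ d = 1 ∧ F.row x ≤ P ∧ F.col x = 0) ∨
    (1 ≤ F.lay x ∧ F.lay x < r ∧ S (F.row x) (F.col x)) ∨
    (F.lay x = r ∧ F.row x = 0 ∧ F.col x ≤ q ∧ (r = 2 ∨ F.col x < q)) := by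
  rcases F.mem x with h1 | h1 | h1 | h1
  · exact Or.inl h1
  · exact Or.inr (Or.inl h1)
  · exact Or.inr (Or.inr h1)
  · refine absurd ⟨h1.1, ?_⟩ h
    obtain ⟨_, _, κ, hκ, e⟩ := h1
    omega

theorem nT_col {x : V} (h : ¬ F.T x) : F.col x ≤ q := by
  rcases F.nT h with h | h | h
  · omega
  · exact (F.pat.bd _ _ h.2.2).2.2
  · omega

theorem lay_le (x : V) : F.lay x ≤ r := by
  have := F.good.two
  rcases F.mem x with h | h | h | h <;> omega

theorem ne_lay {x y : V} (h : F.lay x ≠ F.lay y) : x ≠ y := fun e => h (by rw [e])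

theorem main_S {x : V} (h : ¬ F.T x) (h1 : 1 ≤ F.lay x) (h2 : F.lay x < r) :
    S (F.row x) (F.col x) := by
  rcases F.nT h with h | h | h
  · omega
  · exact h.2.2
  · omega

theorem exM {s i j : ℕ} (h1 : 1 ≤ s) (h2 : s < r) (h : S i j) :
    ∃ x, ¬ F.T x ∧ F.lay x = s ∧ F.row x = i ∧ F.col x = j := by
  obtain ⟨x, a, b, c⟩ := F.surj s i j (Or.inr (Or.inl ⟨h1, h2, h⟩))
  refine ⟨x, fun hT => ?_, a, b, c⟩
  have := hT.2
  have := F.pat.bd _ _ h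
  omega

theorem exB {j : ℕ} (h1 : j ≤ q) (h2 : r = 2 ∨ j < q) :
    ∃ x, ¬ F.T x ∧ F.lay x = r ∧ F.row x = 0 ∧ F.col x = j := by
  obtain ⟨x, a, b, c⟩ := F.surj r 0 j (Or.inr (Or.inr (Or.inl ⟨rfl, rfl, h1, h2⟩)))
  refine ⟨x, fun hT => ?_, a, b, c⟩
  have := hT.2
  omega

theorem exA {i : ℕ} (hd : d = 1) (h1 : i ≤ P) :
    ∃ x, ¬ F.T x ∧ F.lay x = 0 ∧ F.row x = i ∧ F.col x = 0 := by
  obtain ⟨x, a, b, c⟩ := F.surj 0 i 0 (Or.inl ⟨rfl, hd, h1, rfl⟩)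
  exact ⟨x, fun hT => by have := hT.1; omega, a, b, c⟩

/-- Twin vertices see the second layer uniformly. -/
theorem nu {t x : V} (ht : F.T t) (hx : F.lay x = 2) : G.Adj t x ↔ f 1 2 .eq .gt := by
  have hr := F.good.two
  have hxT : ¬ F.T x := fun h => by have := h.1; omega
  have hc := F.nT_col hxT
  have := ht.2
  have e : compare (F.col t) (F.col x) = .gt := compare_gt_iff_gt.2 (by omega)
  rw [F.adj t x (F.ne_lay (by rw [ht.1, hx]; omega)), ht.1, hx, e]
  exact F.good.indep 1 le_rfl (by omega) _ _ _ (by simp)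

theorem far {x y x' y' : V} (h : F.lay x + 2 ≤ F.lay y) (hx : F.lay x = F.lay x')
    (hy : F.lay y = F.lay y') : G.Adj x y ↔ G.Adj x' y' := by
  rw [F.adj x y (F.ne_lay (by omega)), F.adj x' y' (F.ne_lay (by omega)), ← hx, ← hy]
  exact F.good.const _ _ h (F.lay_le y) _ _ _ _

theorem T_high {t t' x x' : V} (ht : F.T t) (ht' : F.T t') (hx : 2 ≤ F.lay x)
    (hx' : F.lay x = F.lay x') : G.Adj t x ↔ G.Adj t' x' := by
  have := ht.1
  have := ht'.1
  by_cases h : F.lay x = 2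
  · rw [F.nu ht h, F.nu ht' (by omega)]
  · exact F.far (by omega) (by omega) hx'

theorem T_col_ne {t y : V} (ht : F.T t) (hy : F.lay y = 1) (h : y ≠ t) : F.col y ≠ F.col t := by
  intro e
  have hyT : F.T y := ⟨hy, by have := ht.2; omega⟩
  by_cases hr : F.row y = F.row t
  · exact h (F.ext _ _ (by rw [hy, ht.1]) hr e)
  · have h1 := (F.T_inT ht).1
    have h2 := (F.T_inT hyT).1
    rcases Nat.lt_trichotomy (bord P (F.row y)) (bord P (F.row t)) with h3 | h3 | h3
    · have := F.T_lt hyT ht h3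
      omega
    · exact hr (F.bord_inj h2 h1 h3)
    · have := F.T_lt ht hyT h3
      omega

theorem om (hd : d = 1) {t y : V} (ht : F.T t) (hy : F.lay y = 1) (h : y ≠ t) :
    G.Adj y t ↔ f 1 1 .eq .lt := by
  have hc := F.T_col_ne ht hy h
  obtain ⟨_, h1, _⟩ | h1 := F.cs
  · rw [F.adj y t h, hy, ht.1]
    rcases lt_or_gt_of_ne hc with h2 | h2
    · rw [compare_lt_iff_lt.2 h2]
      exact h1 _ _
    · rw [compare_gt_iff_gt.2 h2]
      rw [F.good.sym1 _ _ (by simp)]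
      exact h1 _ _
  · omega

/-- Lower partner. -/
theorem lower {x : V} (h : ¬ F.T x) (h2 : 2 ≤ F.lay x) : ∃ y, ¬ F.T y ∧ F.lay y + 1 = F.lay x ∧
    F.col y = F.col x ∧ (F.lay x < r → F.row y = F.row x) ∧
    (G.Adj y x ↔ f (F.lay x - 1) (F.lay x) .eq .eq) := by
  have hr := F.good.two
  have key : ∀ y, ¬ F.T y → F.lay y + 1 = F.lay x → F.col y = F.col x →
    (F.lay x < r → F.row y = F.row x) → (G.Adj y x ↔ f (F.lay x - 1) (F.lay x) .eq .eq) := by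
    intro y _ a b c
    have e : F.lay y = F.lay x - 1 := by omega
    rw [F.adj y x (F.ne_lay (by omega)), e, b, compare_eq_iff_eq.2 rfl]
    by_cases hl : F.lay x < r
    · rw [c hl, compare_eq_iff_eq.2 rfl]
    · have : F.lay x = r := by have := F.lay_le x; omega
      rw [this]
      exact F.good.last _ (by omega) _ _ _
  rcases F.nT h with h1 | h1 | h1
  · omega
  · obtain ⟨y, a, b, c, e⟩ := F.exM (s := F.lay x - 1) (by omega) (by omega) h1.2.2
    exact ⟨y, a, by omega, e, fun _ => c, key y a (by omega) e (fun _ => c)⟩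
  · obtain ⟨i, hi⟩ := F.pat.ne _ h1.2.2.1
    obtain ⟨y, a, b, c, e⟩ := F.exM (s := F.lay x - 1) (by omega) (by omega) hi
    exact ⟨y, a, by omega, e, fun _ => by omega, key y a (by omega) e (fun _ => by omega)⟩

theorem diag_ne {y x : V} (h1 : 1 ≤ F.lay y) (h2 : F.lay x = F.lay y + 1)
    (h : F.col x < F.col y) : ¬ (f (F.lay y) (F.lay x) .eq .eq ↔ G.Adj y x) := by
  have := F.lay_le x
  rw [F.adj y x (F.ne_lay (by omega)), compare_gt_iff_gt.2 h, h2]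
  exact F.good.diag _ h1 (by omega) _

/-- Upper partner. -/
theorem upper {y : V} (h : ¬ F.T y) (h1 : 1 ≤ F.lay y) (h2 : F.lay y < r)
    (hc : F.lay y + 1 < r ∨ r = 2 ∨ F.col y < q) : ∃ x, ¬ F.T x ∧ F.lay x = F.lay y + 1 ∧
    F.col x = F.col y ∧ (G.Adj y x ↔ f (F.lay y) (F.lay y + 1) .eq .eq) := by
  have hS := F.main_S h h1 h2
  have hr := F.good.two
  by_cases hl : F.lay y + 1 < r
  · obtain ⟨x, a, b, c, e⟩ := F.exM (s := F.lay y + 1) (by omega) (by omega) hS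
    refine ⟨x, a, b, e, ?_⟩
    rw [F.adj y x (F.ne_lay (by omega)), b, c, e, compare_eq_iff_eq.2 rfl, compare_eq_iff_eq.2 rfl]
  · obtain ⟨x, a, b, c, e⟩ := F.exB (j := F.col y) (F.nT_col h) (by omega)
    have e' : r = F.lay y + 1 := by omega
    refine ⟨x, a, by omega, e, ?_⟩
    rw [F.adj y x (F.ne_lay (by omega)), b, e, compare_eq_iff_eq.2 rfl, ← e']
    exact F.good.last _ (by omega) _ _ _

end Frame
end MInd

set_option autoImplicit false
namespace MInd

def Twin (V : Type) (G : SimpleGraph V) (x y : V) : Prop :=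
  ∀ z, z ≠ x → z ≠ y → (G.Adj x z ↔ G.Adj y z)

theorem Twin.symm {V : Type} {G : SimpleGraph V} {x y : V} (h : Twin V G x y) : Twin V G y x :=
  fun z h1 h2 => (h z h2 h1).symm

namespace Frame
variable {W : Type} {E : SimpleGraph W} {r : ℕ} {f : ℕ → ℕ → Ordering → Ordering → Prop}
  {d P q : ℕ} {S : ℕ → ℕ → Prop} {V : Type} {G : SimpleGraph V} (F : Frame E r f d P q S G)
include F

open Classical in
/-- The rank of a vertex. -/
noncomputable def rk (x : V) : ℕ := if F.T x then 0 else F.lay x + d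

theorem rk_T {x : V} (h : F.T x) : F.rk x = 0 := by
  unfold rk
  rw [if_pos h]

theorem rk_nT {x : V} (h : ¬ F.T x) : F.rk x = F.lay x + d := by
  unfold rk
  rw [if_neg h]

theorem rk_pos {x : V} (h : ¬ F.T x) : 1 ≤ F.rk x := by
  rw [F.rk_nT h]
  rcases F.nT h with h | h | h
  · omega
  · omega
  · have := F.good.two
    omega

theorem rk_eq_zero {x : V} : F.rk x = 0 ↔ F.T x := by
  constructor
  · intro h
    by_contra h1
    have := F.rk_pos h1
    omega
  · exact F.rk_T

theorem rk_d {p : V} (h : F.rk p = d) : (d = 1 ∧ F.lay p = 0) ∨ (d = 0 ∧ F.T p) := by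
  obtain ⟨h1, _⟩ | ⟨h1, _⟩ := F.cs
  · left
    have : ¬ F.T p := fun hT => by have := F.rk_T hT; omega
    rw [F.rk_nT this] at h
    omega
  · right
    exact ⟨h1, F.rk_eq_zero.1 (by omega)⟩

theorem rowdist {x y : V} (hx : ¬ F.T x) (hy : ¬ F.T y) (hx1 : F.lay x = 1) (hy1 : F.lay y = 1)
    (h : F.row x < F.row y) :
    ∃ p, F.rk p = d ∧ p ≠ x ∧ p ≠ y ∧ ¬ (G.Adj p x ↔ G.Adj p y) := by
  have hr := F.good.two
  have hS := F.pat.bd _ _ (F.main_S hx (by omega) (by omega))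
  have hcx := F.nT_col hx
  have hcy := F.nT_col hy
  obtain ⟨h1, h2, h3⟩ | ⟨h1, h2⟩ := F.cs
  · obtain ⟨p, a, b, c, e⟩ := F.exA h1 (i := F.row x) (by omega)
    refine ⟨p, by rw [F.rk_nT a, b]; omega, F.ne_lay (by omega), F.ne_lay (by omega), ?_⟩
    rw [F.adj p x (F.ne_lay (by omega)), F.adj p y (F.ne_lay (by omega)), b, hx1, hy1, c,
      compare_eq_iff_eq.2 rfl, compare_lt_iff_lt.2 h]
    exact h3 _ _
  · obtain ⟨p, a, b, c⟩ := F.exT (i := F.row x) (by omega) (κ := 0) (by omega)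
    have hpx : x ≠ p := fun e => hx (e ▸ a)
    have hpy : y ≠ p := fun e => hy (e ▸ a)
    refine ⟨p, by rw [F.rk_T a]; omega, hpx.symm, hpy.symm, ?_⟩
    have := a.2
    rw [G.adj_comm, G.adj_comm p y, F.adj x p hpx, F.adj y p hpy, hx1, hy1, a.1, b,
      compare_eq_iff_eq.2 rfl, compare_gt_iff_gt.2 h,
      compare_lt_iff_lt.2 (show F.col x < F.col p by omega),
      compare_lt_iff_lt.2 (show F.col y < F.col p by omega)]
    exact h2

theorem rowsame {x y p : V} (hx : ¬ F.T x) (hy : ¬ F.T y) (hx1 : F.lay x = 1) (hy1 : F.lay y = 1)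
    (h : F.row x = F.row y) (hp : F.rk p = d) : G.Adj p x ↔ G.Adj p y := by
  have hr := F.good.two
  have hcx := F.nT_col hx
  have hcy := F.nT_col hy
  obtain ⟨h1, h2⟩ | ⟨h1, h2⟩ := F.rk_d hp
  · rw [F.adj p x (F.ne_lay (by omega)), F.adj p y (F.ne_lay (by omega)), h2, hx1, hy1, h]
    exact F.good.zero 1 le_rfl (by omega) _ _ _
  · have hpx : x ≠ p := fun e => hx (e ▸ h2)
    have hpy : y ≠ p := fun e => hy (e ▸ h2)
    have := h2.2
    rw [G.adj_comm, G.adj_comm p y, F.adj x p hpx, F.adj y p hpy, hx1, hy1, h2.1, h,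
      compare_lt_iff_lt.2 (show F.col x < F.col p by omega),
      compare_lt_iff_lt.2 (show F.col y < F.col p by omega)]

theorem coldist {x y : V} (hx : ¬ F.T x) (hy : ¬ F.T y) (h1 : 1 ≤ F.lay x) (h2 : F.lay x < r)
    (hxy : F.lay x = F.lay y) (h : F.col x < F.col y) :
    ∃ p, ¬ F.T p ∧ F.lay p = F.lay x + 1 ∧ ¬ (G.Adj x p ↔ G.Adj y p) := by
  have hcy := F.nT_col hy
  obtain ⟨p, a, b, c, e⟩ := F.upper hx h1 h2 (by omega)
  refine ⟨p, a, b, ?_⟩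
  have := F.diag_ne (y := y) (x := p) (by omega) (by omega) (by omega)
  rwa [← hxy, b, ← e] at this

theorem main_lt {x y : V} (hx : ¬ F.T x) (hy : ¬ F.T y) (hxy : F.lay x = F.lay y)
    (h : F.col x < F.col y ∨ (F.col x = F.col y ∧ F.row x < F.row y)) : ¬ Twin V G x y := by
  intro ht
  have hr := F.good.two
  rcases F.nT hx with h1 | h1 | h1
  · -- layer zero
    rcases F.nT hy with h2 | h2 | h2
    · obtain ⟨_, _, h4⟩ | ⟨h3, _⟩ := F.cs
      · obtain ⟨t, a, b, c⟩ := F.exT (i := F.row y) (by omega) (κ := 0) (by omega)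
        have a1 := a.1
        have := ht t (F.ne_lay (by omega)) (F.ne_lay (by omega))
        rw [F.adj x t (F.ne_lay (by omega)), F.adj y t (F.ne_lay (by omega)), a1, ← hxy, h1.1, b,
          compare_eq_iff_eq.2 rfl, compare_lt_iff_lt.2 (show F.row x < F.row y by omega)] at this
        exact h4 _ _ this.symm
      · omega
    · omega
    · omega
  · rcases h with h | ⟨h, h'⟩
    · obtain ⟨p, a, b, c⟩ := F.coldist hx hy h1.1 h1.2.1 hxy h
      exact c (ht p (F.ne_lay (by omega)) (F.ne_lay (by omega)))
    · by_cases hl : F.lay x = 1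
      · obtain ⟨p, _, b, c, e⟩ := F.rowdist hx hy hl (by omega) h'
        apply e
        rw [G.adj_comm, G.adj_comm p y]
        exact ht p b c
      · obtain ⟨p, a, b, c, e, e'⟩ := F.lower hx (by omega)
        have := ht p (F.ne_lay (by omega)) (F.ne_lay (by omega))
        rw [G.adj_comm, e', G.adj_comm, F.adj p y (F.ne_lay (by omega)), ← hxy,
          e h1.2.1, c, h, compare_eq_iff_eq.2 rfl, compare_lt_iff_lt.2 h',
          show F.lay p = F.lay x - 1 by omega] at this
        have h3 := F.good.off (F.lay x - 1) (by omega) (by omega) .lt .eq (by simp)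
        rw [show F.lay x - 1 + 1 = F.lay x by omega] at h3
        exact h3 this
  · rcases F.nT hy with h2 | h2 | h2
    · omega
    · omega
    · obtain ⟨p, a, b, c, _, e⟩ := F.lower hy (by omega)
      have := ht p (F.ne_lay (by omega)) (F.ne_lay (by omega))
      rw [G.adj_comm, G.adj_comm y, e] at this
      have h3 := F.diag_ne (y := p) (x := x) (by omega) (by omega) (by omega)
      rw [hxy, show F.lay p = F.lay y - 1 by omega] at h3
      exact h3 this.symm

theorem main_ne {x y : V} (hx : ¬ F.T x) (hy : ¬ F.T y) (hxy : F.lay x = F.lay y)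
    (h : x ≠ y) : ¬ Twin V G x y := by
  intro ht
  rcases Nat.lt_trichotomy (F.col x) (F.col y) with h1 | h1 | h1
  · exact F.main_lt hx hy hxy (Or.inl h1) ht
  · rcases Nat.lt_trichotomy (F.row x) (F.row y) with h2 | h2 | h2
    · exact F.main_lt hx hy hxy (Or.inr ⟨h1, h2⟩) ht
    · exact h (F.ext _ _ hxy h2 h1)
    · exact F.main_lt hy hx hxy.symm (Or.inr ⟨h1.symm, h2⟩) ht.symm
  · exact F.main_lt hy hx hxy.symm (Or.inl h1) ht.symm

/-- Vertices of layer at least three split the previous layer. -/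
theorem split3 {x : V} (hx : ¬ F.T x) (h3 : 3 ≤ F.lay x) : ∃ y z, ¬ F.T y ∧ ¬ F.T z ∧
    F.lay y + 1 = F.lay x ∧ F.lay z + 1 = F.lay x ∧ ¬ (G.Adj y x ↔ G.Adj z x) := by
  have hr := F.good.two
  have hP := F.pat.hP
  obtain ⟨y, a, b, c, e, e'⟩ := F.lower hx (by omega)
  have hle := F.lay_le x
  by_cases hl : F.lay x < r
  · have hS := F.pat.bd _ _ (F.main_S hx (by omega) hl)
    obtain ⟨i, hi, hi1, hi2⟩ : ∃ i, i ≠ F.row x ∧ 1 ≤ i ∧ i ≤ P := by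
      by_cases h : F.row x = 1
      · exact ⟨2, by omega, by omega, by omega⟩
      · exact ⟨1, by omega, by omega, by omega⟩
    obtain ⟨z, a1, b1, c1, e1⟩ := F.exM (s := F.lay x - 1) (by omega) (by omega)
      (F.pat.full i hi1 hi2).1
    refine ⟨y, z, a, a1, b, by omega, ?_⟩
    have h4 := F.good.off (F.lay x - 1) (by omega) (by omega) (compare (F.row z) (F.row x))
      (compare (F.col z) (F.col x)) (by
        rw [compare_eq_iff_eq]
        omega)
    rw [e', F.adj z x (F.ne_lay (by omega)), b1]
    rwa [show F.lay x - 1 + 1 = F.lay x by omega] at h4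
  · have hB : F.col x < q := by
      rcases F.nT hx with h | h | h <;> omega
    obtain ⟨z, a1, b1, c1, e1⟩ := F.exM (s := F.lay x - 1) (by omega) (by omega)
      (F.pat.full 1 (by omega) (by omega)).1
    refine ⟨y, z, a, a1, b, by omega, ?_⟩
    have := F.diag_ne (y := z) (x := x) (by omega) (by omega) (by omega)
    rwa [e', ← b1]

theorem T_not_twin {x t : V} (hx : ¬ F.T x) (ht : F.T t) : ¬ Twin V G x t := by
  intro h
  have hr := F.good.two
  have hP := F.pat.hP
  have hq := F.pat.hq
  have ht1 := ht.1
  have hti := F.T_inT ht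
  have hle := F.lay_le x
  have hxt : x ≠ t := fun e => hx (e ▸ ht)
  obtain h0 | h0 | h0 | h0 : F.lay x = 0 ∨ F.lay x = 1 ∨ F.lay x = 2 ∨ 3 ≤ F.lay x := by omega
  · -- layer zero
    rcases F.nT hx with h1 | h1 | h1
    · obtain ⟨hd, _, h4⟩ | ⟨h3, _⟩ := F.cs
      · obtain ⟨p, a, b, c⟩ := F.exT_ne (i := F.row x) (by omega) t
        obtain ⟨p', a', b', c'⟩ := F.exT_ne (i := F.row x + 1) (by omega) t
        have k := h p (F.ne_lay (by have := a.1; omega)) c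
        have k' := h p' (F.ne_lay (by have := a'.1; omega)) c'
        rw [G.adj_comm t, F.om hd ht a.1 c, F.adj x p (F.ne_lay (by have := a.1; omega)), h0, a.1,
          b, compare_eq_iff_eq.2 rfl] at k
        rw [G.adj_comm t, F.om hd ht a'.1 c', F.adj x p' (F.ne_lay (by have := a'.1; omega)), h0,
          a'.1, b', compare_lt_iff_lt.2 (Nat.lt_succ_self _)] at k'
        exact h4 _ _ (k.trans k'.symm)
      · omega
    · omega
    · omega
  · obtain ⟨p, a, b, c, e⟩ := F.upper hx (by omega) (by omega) (by omega)
    have k := h p (F.ne_lay (by omega)) (F.ne_lay (by omega))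
    rw [e, F.nu ht (by omega), h0] at k
    exact F.good.diag 1 le_rfl (by omega) _ k
  · obtain ⟨y, a, b, c, _, e⟩ := F.lower hx (by omega)
    have hyt : y ≠ t := fun e => a (e ▸ ht)
    have k := h y (F.ne_lay (by omega)) hyt
    rw [h0] at e
    rw [G.adj_comm, e, G.adj_comm] at k
    obtain ⟨t1, a1, b1, c1⟩ := F.exT_ne (i := 1) (by omega) t
    have ht11 := a1.1
    have k1 := h t1 (F.ne_lay (by omega)) c1
    rw [G.adj_comm, F.nu a1 h0, G.adj_comm] at k1
    have hdg : ¬ (G.Adj y t ↔ G.Adj t1 t) := by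
      rw [← k, ← k1]
      exact F.good.diag 1 le_rfl (by omega) _
    obtain ⟨hd, _⟩ | ⟨hd, h4⟩ := F.cs
    · rw [F.om hd ht (by omega) hyt, F.om hd ht ht11 c1] at hdg
      exact hdg Iff.rfl
    · obtain ⟨j, hj, hj'⟩ : ∃ j, j ≠ F.col x ∧ (j = q ∨ j = q - 1) := by
        by_cases hh : F.col x = q
        · exact ⟨q - 1, by omega, by omega⟩
        · exact ⟨q, fun e => hh e.symm, by omega⟩
      have hcol : ∀ i, 1 ≤ i → i ≤ P →
          (f 1 1 (compare i (F.row t)) .lt ↔ f 1 2 .eq (compare j (F.col x))) := by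
        intro i h1 h2
        have hSij : S i j := by
          rcases hj' with rfl | rfl
          · exact (F.pat.full i h1 h2).1
          · exact (F.pat.full i h1 h2).2
        obtain ⟨z, a2, b2, c2, e2⟩ := F.exM (s := 1) le_rfl (by omega) hSij
        have hzt : z ≠ t := fun e => a2 (e ▸ ht)
        have k2 := h z (F.ne_lay (by omega)) hzt
        have := ht.2
        rw [G.adj_comm, G.adj_comm t, F.adj z x (F.ne_lay (by omega)), F.adj z t hzt, b2, h0,
          ht1, c2, e2, compare_lt_iff_lt.2 (show j < F.col t by omega)] at k2
        rw [← k2]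
        exact F.good.indep 1 le_rfl (by omega) _ _ _ (by rwa [Ne, compare_eq_iff_eq])
      have hrow : F.row t = 0 ∨ P ≤ F.row t := by
        by_contra hcon
        have k3 := hcol (F.row t) (by omega) (by omega)
        have k4 := hcol (F.row t + 1) (by omega) (by omega)
        rw [compare_eq_iff_eq.2 rfl] at k3
        rw [compare_gt_iff_gt.2 (Nat.lt_succ_self _)] at k4
        exact h4 (k3.trans k4.symm)
      apply hdg
      have hS := F.pat.bd _ _ (F.main_S a (by omega) (by omega))
      have hcy := F.nT_col a
      have hct := ht.2
      have hlt : F.col t1 < F.col t := by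
        apply F.T_lt a1 ht
        have hb1 : bord P 1 = 1 := rfl
        rw [b1, hb1]
        unfold bord
        by_cases hh : F.row t = 0
        · rw [if_pos hh]
          omega
        · rw [if_neg hh]
          omega
      rw [F.adj y t hyt, F.adj t1 t c1, ht1, ht11, show F.lay y = 1 by omega,
        compare_lt_iff_lt.2 hlt, compare_lt_iff_lt.2 (show F.col y < F.col t by omega), b1,
        hcol _ hS.1 hS.2.1, hcol 1 le_rfl (by omega)]
  · obtain ⟨y, z, a, b, c, e, k⟩ := F.split3 hx h0
    apply k
    have k1 := h y (F.ne_lay (by omega)) (F.ne_lay (by omega))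
    have k2 := h z (F.ne_lay (by omega)) (F.ne_lay (by omega))
    rw [G.adj_comm, k1, G.adj_comm z, k2]
    exact F.T_high ht ht (by omega) (by omega)

theorem T_twin {t t' : V} (ht : F.T t) (ht' : F.T t') (h : F.row t = F.row t') :
    Twin V G t t' := by
  intro z h1 h2
  rw [F.adj t z h1.symm, F.adj t' z h2.symm, ht.1, ht'.1, h]
  have hc1 := ht.2
  have hc2 := ht'.2
  by_cases hz : F.T z
  · by_cases hr : F.row z = F.row t
    · rw [hz.1, hr, h, compare_eq_iff_eq.2 rfl]
      have key : ∀ τ τ' : Ordering, τ ≠ .eq → τ' ≠ .eq → (f 1 1 .eq τ ↔ f 1 1 .eq τ') := by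
        have hs := F.good.sym1 .eq .lt (by simp)
        intro τ τ' h1 h2
        cases τ <;> cases τ' <;> simp_all
      have k1 := F.T_col_ne ht hz.1 h1
      have k2 := F.T_col_ne ht' hz.1 h2
      exact key _ _ (by rw [Ne, compare_eq_iff_eq]; exact k1.symm)
        (by rw [Ne, compare_eq_iff_eq]; exact k2.symm)
    · rcases Nat.lt_trichotomy (bord P (F.row z)) (bord P (F.row t)) with h3 | h3 | h3
      · have a := F.T_lt hz ht h3
        have b := F.T_lt hz ht' (h ▸ h3)
        rw [compare_gt_iff_gt.2 a, compare_gt_iff_gt.2 b]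
      · exact absurd (F.bord_inj (F.T_inT hz).1 (F.T_inT ht).1 h3) hr
      · have a := F.T_lt ht hz h3
        have b := F.T_lt ht' hz (h ▸ h3)
        rw [compare_lt_iff_lt.2 a, compare_lt_iff_lt.2 b]
  · have hcz := F.nT_col hz
    rw [compare_gt_iff_gt.2 (show F.col z < F.col t by omega),
      compare_gt_iff_gt.2 (show F.col z < F.col t' by omega)]

end Frame
end MInd

set_option autoImplicit false
namespace MInd

/-! ### Defining the layers -/

theorem Def.twin (m n : ℕ) : Def (fun V G v => Twin V G (v m) (v n)) := by
  refine Def.all (P := fun V G v z => z ≠ v m → z ≠ v n → (G.Adj (v m) z ↔ G.Adj (v n) z)) ?_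
  exact (Def.eq 0 (m + 1)).not.imp ((Def.eq 0 (n + 1)).not.imp
    ((Def.adj (m + 1) 0).iff (Def.adj (n + 1) 0)))

/-- Membership in a set of many mutual twins. -/
def ZT (k : ℕ) (V : Type) (G : SimpleGraph V) (x : V) : Prop :=
  ∃ w : Fin (k + 1) → V, (∀ i j, i ≠ j → w i ≠ w j ∧ Twin V G (w i) (w j)) ∧ w 0 = x

theorem ZT_def (k : ℕ) : Def1 (ZT k) := by
  refine Def.exFin (P := fun V G v w =>
    (∀ i j : Fin (k + 1), i ≠ j → w i ≠ w j ∧ Twin V G (w i) (w j)) ∧ w 0 = v 0) ?_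
  refine Def.and ?_ ?_
  · refine Def.allFin (fun i => Def.allFin (fun j => ?_))
    exact (Def.const (i ≠ j)).imp ((Def.eq i j).not.and (Def.twin i j))
  · exact Def.eq _ _

def Spl (X : ∀ V : Type, SimpleGraph V → V → Prop) (V : Type) (G : SimpleGraph V) (x : V) : Prop :=
  ∃ y z, y ≠ x ∧ z ≠ x ∧ X V G y ∧ X V G z ∧ ¬ (G.Adj y x ↔ G.Adj z x)

theorem Spl_def {X : ∀ V : Type, SimpleGraph V → V → Prop} (h : Def1 X) : Def1 (Spl X) := by
  refine Def.ex (P := fun V G v y => ∃ z, y ≠ v 0 ∧ z ≠ v 0 ∧ X V G y ∧ X V G z ∧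
    ¬ (G.Adj y (v 0) ↔ G.Adj z (v 0))) ?_
  refine Def.ex (P := fun V G v z => v 0 ≠ v 1 ∧ z ≠ v 1 ∧ X V G (v 0) ∧ X V G z ∧
    ¬ (G.Adj (v 0) (v 1) ↔ G.Adj z (v 1))) ?_
  exact (Def.eq 1 2).not.and ((Def.eq 0 2).not.and ((h.at 1).and ((h.at 0).and
    ((Def.adj 1 2).iff (Def.adj 0 2)).not)))

/-- The sequence of definable layers, together with the union of the layers so far. -/
def ZU (k o : ℕ) : ℕ → (∀ V : Type, SimpleGraph V → V → Prop) ×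
    (∀ V : Type, SimpleGraph V → V → Prop)
  | 0 => (ZT k, ZT k)
  | s + 1 =>
    (fun V G x => ¬ (ZU k o s).2 V G x ∧
        Spl (fun V G y => (ZU k o s).1 V G y ∨ (s = o ∧ ZT k V G y)) V G x,
      fun V G x => (ZU k o s).2 V G x ∨ (¬ (ZU k o s).2 V G x ∧
        Spl (fun V G y => (ZU k o s).1 V G y ∨ (s = o ∧ ZT k V G y)) V G x))

theorem ZU_def (k o s : ℕ) : Def1 (ZU k o s).1 ∧ Def1 (ZU k o s).2 := by
  induction s with
  | zero => exact ⟨ZT_def k, ZT_def k⟩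
  | succ s ih =>
    have h : Def1 (fun V G x => ¬ (ZU k o s).2 V G x ∧
        Spl (fun V G y => (ZU k o s).1 V G y ∨ (s = o ∧ ZT k V G y)) V G x) :=
      ih.2.not.and (Spl_def (Def.or ih.1 ((Def.const (s = o)).and (ZT_def k))))
    exact ⟨h, Def.or ih.2 h⟩

namespace Frame
variable {W : Type} {E : SimpleGraph W} {r : ℕ} {f : ℕ → ℕ → Ordering → Ordering → Prop}
  {d P q : ℕ} {S : ℕ → ℕ → Prop} {V : Type} {G : SimpleGraph V} (F : Frame E r f d P q S G)
include F

theorem ZT_iff (x : V) : ZT (r + 1) V G x ↔ F.T x := by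
  constructor
  · rintro ⟨w, hw, rfl⟩
    by_contra h0
    have hn : ∀ i, ¬ F.T (w i) := by
      intro i
      by_cases hi : i = 0
      · rw [hi]
        exact h0
      · exact fun h => F.T_not_twin h0 h (hw 0 i (Ne.symm hi)).2
    have hc : Fintype.card (Fin (r + 1)) < Fintype.card (Fin (r + 1 + 1)) := by simp
    obtain ⟨i, j, hij, e⟩ := Fintype.exists_ne_map_eq_of_card_lt
      (fun i : Fin (r + 1 + 1) => (⟨F.lay (w i), Nat.lt_succ_of_le (F.lay_le _)⟩ : Fin (r + 1))) hc
    have e' : F.lay (w i) = F.lay (w j) := congrArg Fin.val e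
    exact F.main_ne (hn i) (hn j) e' (hw i j hij).1 (hw i j hij).2
  · intro hx
    obtain ⟨hi, κ, hκ, e⟩ := F.T_inT hx
    have hex : ∀ a : Fin (r + 1 + 1), ∃ y, F.T y ∧ F.row y = F.row x ∧
        F.col y = q + 1 + (r + 2) * bord P (F.row x) + a := fun a => F.exT hi a.2
    choose g hg1 hg2 hg3 using hex
    let κ' : Fin (r + 1 + 1) := ⟨κ, hκ⟩
    refine ⟨fun a => g (Equiv.swap 0 κ' a), ?_, ?_⟩
    · intro a b hab
      refine ⟨fun h => hab ?_, F.T_twin (hg1 _) (hg1 _) (by rw [hg2, hg2])⟩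
      have h3 := congrArg F.col h
      rw [hg3, hg3] at h3
      have h4 : Equiv.swap 0 κ' a = Equiv.swap 0 κ' b := Fin.ext (by omega)
      exact (Equiv.swap 0 κ').injective h4
    · simp only [Equiv.swap_apply_left]
      refine F.ext _ _ ?_ (hg2 _) ?_
      · rw [(hg1 _).1, hx.1]
      · rw [hg3, e]

/-- The vertices one layer above split the layer; the vertices further above do not. -/
theorem spl_iff (s : ℕ) (x : V) (hs : s < F.rk x) :
    (∃ y z, y ≠ x ∧ z ≠ x ∧ (F.rk y = s ∨ (s = d + 1 ∧ F.T y)) ∧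
      (F.rk z = s ∨ (s = d + 1 ∧ F.T z)) ∧ ¬ (G.Adj y x ↔ G.Adj z x)) ↔ F.rk x = s + 1 := by
  have hr := F.good.two
  have hxT : ¬ F.T x := fun h => by rw [F.rk_T h] at hs; omega
  have hrk := F.rk_nT hxT
  constructor
  · rintro ⟨y, z, hy, hz, hy1, hz1, hn⟩
    by_contra hne
    apply hn
    rcases Nat.eq_zero_or_pos s with rfl | hs0
    · have hyT : F.T y := F.rk_eq_zero.1 (by omega)
      have hzT : F.T z := F.rk_eq_zero.1 (by omega)
      by_cases h2 : 2 ≤ F.lay x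
      · exact F.T_high hyT hzT h2 rfl
      · obtain ⟨hd, _⟩ | ⟨hd, _⟩ := F.cs
        · rw [G.adj_comm, F.om hd hyT (by omega) hy.symm, G.adj_comm, F.om hd hzT (by omega) hz.symm]
        · omega
    · have key : ∀ y, (F.rk y = s ∨ (s = d + 1 ∧ F.T y)) → F.lay y + d = s := by
        rintro y (h | ⟨h, h'⟩)
        · have : ¬ F.T y := fun hT => by rw [F.rk_T hT] at h; omega
          rw [← F.rk_nT this, h]
        · rw [h'.1, h]; omega
      have k1 := key y hy1
      have k2 := key z hz1
      exact F.far (by omega) (by omega) rfl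
  · intro hx
    have hle := F.lay_le x
    obtain h0 | h0 | h0 | h0 : F.lay x = 0 ∨ F.lay x = 1 ∨ F.lay x = 2 ∨ 3 ≤ F.lay x := by omega
    · obtain ⟨hd, _, h4⟩ | ⟨hd, _⟩ := F.cs
      · have hrow : F.row x ≤ P := by
          rcases F.nT hxT with h | h | h <;> omega
        obtain ⟨p, a, b, c⟩ := F.exT_ne (i := F.row x) (by omega) x
        obtain ⟨p', a', b', c'⟩ := F.exT_ne (i := F.row x + 1) (by omega) x
        refine ⟨p, p', c, c', Or.inl (by rw [F.rk_T a]; omega), Or.inl (by rw [F.rk_T a']; omega), ?_⟩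
        rw [G.adj_comm, F.adj x p c.symm, G.adj_comm, F.adj x p' c'.symm, h0, a.1, a'.1, b, b',
          compare_eq_iff_eq.2 rfl, compare_lt_iff_lt.2 (Nat.lt_succ_self _)]
        exact h4 _ _
      · omega
    · have hS := F.pat.bd _ _ (F.main_S hxT (by omega) (by omega))
      obtain ⟨hd, _, h4⟩ | ⟨hd, h4⟩ := F.cs
      · obtain ⟨p, a, b, c, e⟩ := F.exA hd (i := F.row x) (by omega)
        obtain ⟨p', a', b', c', e'⟩ := F.exA hd (i := F.row x - 1) (by omega)
        refine ⟨p, p', F.ne_lay (by omega), F.ne_lay (by omega), Or.inl (by rw [F.rk_nT a]; omega),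
          Or.inl (by rw [F.rk_nT a']; omega), ?_⟩
        rw [F.adj p x (F.ne_lay (by omega)), F.adj p' x (F.ne_lay (by omega)), h0, b, b', c, c',
          compare_eq_iff_eq.2 rfl, compare_lt_iff_lt.2 (show F.row x - 1 < F.row x by omega)]
        exact h4 _ _
      · obtain ⟨p, a, b, c⟩ := F.exT_ne (i := F.row x) (by omega) x
        obtain ⟨p', a', b', c'⟩ := F.exT_ne (i := F.row x - 1) (by omega) x
        refine ⟨p, p', c, c', Or.inl (by rw [F.rk_T a]; omega), Or.inl (by rw [F.rk_T a']; omega), ?_⟩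
        have hcx := F.nT_col hxT
        have h5 := a.2
        have h6 := a'.2
        rw [G.adj_comm, F.adj x p c.symm, G.adj_comm, F.adj x p' c'.symm, h0, a.1, a'.1, b, b',
          compare_eq_iff_eq.2 rfl, compare_gt_iff_gt.2 (show F.row x - 1 < F.row x by omega),
          compare_lt_iff_lt.2 (show F.col x < F.col p by omega),
          compare_lt_iff_lt.2 (show F.col x < F.col p' by omega)]
        exact h4
    · obtain ⟨y, a, b, c, _, e⟩ := F.lower hxT (by omega)
      obtain ⟨t, a', b', c'⟩ := F.exT_ne (i := 1) (by omega) x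
      refine ⟨y, t, F.ne_lay (by omega), c', Or.inl (by rw [F.rk_nT a]; omega),
        Or.inr ⟨by omega, a'⟩, ?_⟩
      rw [e, F.nu a' h0, h0]
      exact F.good.diag 1 le_rfl (by omega) _
    · obtain ⟨y, z, a, b, c, e, k⟩ := F.split3 hxT h0
      exact ⟨y, z, F.ne_lay (by omega), F.ne_lay (by omega), Or.inl (by rw [F.rk_nT a]; omega),
        Or.inl (by rw [F.rk_nT b]; omega), k⟩

theorem ZU_iff (s : ℕ) : (∀ x, (ZU (r + 1) (d + 1) s).1 V G x ↔ F.rk x = s) ∧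
    (∀ x, (ZU (r + 1) (d + 1) s).2 V G x ↔ F.rk x ≤ s) := by
  induction s with
  | zero =>
    refine ⟨fun x => ?_, fun x => ?_⟩
    · rw [F.rk_eq_zero]
      exact F.ZT_iff x
    · rw [Nat.le_zero, F.rk_eq_zero]
      exact F.ZT_iff x
  | succ s ih =>
    have h : ∀ x, (¬ (ZU (r + 1) (d + 1) s).2 V G x ∧
        Spl (fun V G y => (ZU (r + 1) (d + 1) s).1 V G y ∨ (s = d + 1 ∧ ZT (r + 1) V G y)) V G x) ↔
        F.rk x = s + 1 := by
      intro x
      unfold Spl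
      simp only [ih.1, ih.2, F.ZT_iff, not_le]
      constructor
      · rintro ⟨h1, h2⟩
        exact (F.spl_iff s x h1).1 h2
      · intro h
        have h1 : s < F.rk x := by omega
        exact ⟨h1, (F.spl_iff s x h1).2 h⟩
    refine ⟨h, fun x => ?_⟩
    change (_ ∨ _) ↔ _
    rw [h, ih.2]
    omega

end Frame
end MInd

set_option autoImplicit false
namespace MInd

/-! ### The interpreting formulas -/

section
variable (Z : ℕ → ∀ V : Type, SimpleGraph V → V → Prop)
  (f : ℕ → ℕ → Ordering → Ordering → Prop) (d r : ℕ)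

/-- Chains of partners starting from the first main layer. -/
def RC : ℕ → ∀ V : Type, SimpleGraph V → V → V → Prop
  | 0 => fun _ _ x y => x = y
  | s + 1 => fun V G x y => ∃ z, RC s V G x z ∧ Z (d + s + 2) V G y ∧
      (G.Adj z y ↔ f (s + 1) (s + 2) .eq .eq)

def EqI (V : Type) (G : SimpleGraph V) (x y : V) : Prop :=
  ∀ p, Z d V G p → (G.Adj p x ↔ G.Adj p y)

def EqJ (V : Type) (G : SimpleGraph V) (x y : V) : Prop :=
  ∀ x' y' b, RC Z f d (r - 2) V G x x' → RC Z f d (r - 2) V G y y' → Z (r + d) V G b →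
    (G.Adj x' b ↔ G.Adj y' b)

def DelF (V : Type) (G : SimpleGraph V) (x : V) : Prop :=
  Z (d + 1) V G x ∧ ∀ y, Z (d + 1) V G y → EqJ Z f d r V G x y → y = x

def PhiF (V : Type) (G : SimpleGraph V) (x y : V) : Prop :=
  ∃ c c', Z (d + 1) V G c ∧ Z (d + 1) V G c' ∧ c ≠ c' ∧ EqI Z d V G x c ∧ EqI Z d V G y c' ∧
    EqJ Z f d r V G c c' ∧ ∀ e, Z (d + 1) V G e → EqJ Z f d r V G c e → e = c ∨ e = c'

variable {Z}

theorem RC_def (hZ : ∀ s, Def1 (Z s)) (s : ℕ) : Def2 (RC Z f d s) := by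
  induction s with
  | zero => exact Def.eq 0 1
  | succ s ih =>
    refine Def.ex (P := fun V G v z => RC Z f d s V G (v 0) z ∧ Z (d + s + 2) V G (v 1) ∧
      (G.Adj z (v 1) ↔ f (s + 1) (s + 2) .eq .eq)) ?_
    exact (ih.at 1 0).and (((hZ _).at 2).and ((Def.adj 0 2).iff (Def.const _)))

theorem EqI_def (hZ : ∀ s, Def1 (Z s)) : Def2 (EqI Z d) := by
  refine Def.all (P := fun V G v p => Z d V G p → (G.Adj p (v 0) ↔ G.Adj p (v 1))) ?_
  exact ((hZ _).at 0).imp ((Def.adj 0 1).iff (Def.adj 0 2))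

theorem EqJ_def (hZ : ∀ s, Def1 (Z s)) : Def2 (EqJ Z f d r) := by
  have hR := RC_def f d hZ (r - 2)
  refine Def.all (P := fun V G v x' => ∀ y' b, RC Z f d (r - 2) V G (v 0) x' →
    RC Z f d (r - 2) V G (v 1) y' → Z (r + d) V G b → (G.Adj x' b ↔ G.Adj y' b)) ?_
  refine Def.all (P := fun V G v y' => ∀ b, RC Z f d (r - 2) V G (v 1) (v 0) →
    RC Z f d (r - 2) V G (v 2) y' → Z (r + d) V G b → (G.Adj (v 0) b ↔ G.Adj y' b)) ?_
  refine Def.all (P := fun V G v b => RC Z f d (r - 2) V G (v 2) (v 1) →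
    RC Z f d (r - 2) V G (v 3) (v 0) → Z (r + d) V G b → (G.Adj (v 1) b ↔ G.Adj (v 0) b)) ?_
  exact (hR.at 3 2).imp ((hR.at 4 1).imp (((hZ _).at 0).imp ((Def.adj 2 0).iff (Def.adj 1 0))))

theorem DelF_def (hZ : ∀ s, Def1 (Z s)) : Def1 (DelF Z f d r) := by
  have hJ := EqJ_def f d r hZ
  refine Def.and (hZ _) (Def.all (P := fun V G v y => Z (d + 1) V G y →
    EqJ Z f d r V G (v 0) y → y = v 0) ?_)
  exact ((hZ _).at 0).imp ((hJ.at 1 0).imp (Def.eq 0 1))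

theorem PhiF_def (hZ : ∀ s, Def1 (Z s)) : Def2 (PhiF Z f d r) := by
  have hJ := EqJ_def f d r hZ
  have hI := EqI_def d hZ
  refine Def.ex (P := fun V G v c => ∃ c', Z (d + 1) V G c ∧ Z (d + 1) V G c' ∧ c ≠ c' ∧
    EqI Z d V G (v 0) c ∧ EqI Z d V G (v 1) c' ∧
    EqJ Z f d r V G c c' ∧ ∀ e, Z (d + 1) V G e → EqJ Z f d r V G c e → e = c ∨ e = c') ?_
  refine Def.ex (P := fun V G v c' => Z (d + 1) V G (v 0) ∧ Z (d + 1) V G c' ∧ v 0 ≠ c' ∧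
    EqI Z d V G (v 1) (v 0) ∧ EqI Z d V G (v 2) c' ∧
    EqJ Z f d r V G (v 0) c' ∧
      ∀ e, Z (d + 1) V G e → EqJ Z f d r V G (v 0) e → e = v 0 ∨ e = c') ?_
  refine ((hZ _).at 1).and (((hZ _).at 0).and ((Def.eq 1 0).not.and ((hI.at 2 1).and
    ((hI.at 3 0).and ((hJ.at 1 0).and ?_)))))
  refine Def.all (P := fun V G v e => Z (d + 1) V G e → EqJ Z f d r V G (v 1) e →
    e = v 1 ∨ e = v 0) ?_
  exact ((hZ _).at 0).imp ((hJ.at 2 0).imp ((Def.eq 0 2).or (Def.eq 0 1)))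

end

namespace Frame
variable {W : Type} {E : SimpleGraph W} {r : ℕ} {f : ℕ → ℕ → Ordering → Ordering → Prop}
  {d P q : ℕ} {S : ℕ → ℕ → Prop} {V : Type} {G : SimpleGraph V} (F : Frame E r f d P q S G)
  {Z : ℕ → ∀ V : Type, SimpleGraph V → V → Prop}
  (hZ : ∀ s x, Z s V G x ↔ F.rk x = s)
include F

/-- The first main layer. -/
def M (x : V) : Prop := ¬ F.T x ∧ F.lay x = 1

theorem rk_lay {x : V} {s : ℕ} (hs : 1 ≤ s) : F.rk x = d + s ↔ ¬ F.T x ∧ F.lay x = s := by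
  constructor
  · intro h
    have : ¬ F.T x := fun hT => by rw [F.rk_T hT] at h; omega
    rw [F.rk_nT this] at h
    exact ⟨this, by omega⟩
  · rintro ⟨h, h'⟩
    rw [F.rk_nT h, h']
    omega

include hZ

theorem M_iff (x : V) : Z (d + 1) V G x ↔ F.M x := by
  rw [hZ, F.rk_lay le_rfl]
  rfl

theorem M_S {x : V} (h : F.M x) : S (F.row x) (F.col x) := by
  have := F.good.two
  have h1 := h.2
  exact F.main_S h.1 (by omega) (by omega)

theorem RC_iff {x : V} (hx : F.M x) (s : ℕ) (hs : s + 2 ≤ r) (y : V) :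
    RC Z f d s V G x y ↔ ¬ F.T y ∧ F.lay y = s + 1 ∧ F.row y = F.row x ∧ F.col y = F.col x := by
  induction s generalizing y with
  | zero =>
    constructor
    · rintro rfl
      exact ⟨hx.1, hx.2, rfl, rfl⟩
    · rintro ⟨_, h2, h3, h4⟩
      exact F.ext _ _ (by rw [hx.2, h2]) h3.symm h4.symm
  | succ s ih =>
    have hk : ∀ z, ¬ F.T z → F.lay z = s + 1 → F.lay y = s + 2 →
        ((G.Adj z y ↔ f (s + 1) (s + 2) .eq .eq) ↔ (F.row z = F.row y ∧ F.col z = F.col y)) := by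
      intro z _ h2 h3
      rw [F.adj z y (F.ne_lay (by omega)), h2, h3]
      constructor
      · intro h
        by_contra hc
        refine F.good.off (s + 1) (by omega) (by omega) (compare (F.row z) (F.row y))
          (compare (F.col z) (F.col y)) ?_ h.symm
        rwa [compare_eq_iff_eq, compare_eq_iff_eq]
      · rintro ⟨h4, h5⟩
        rw [h4, h5, compare_eq_iff_eq.2 rfl, compare_eq_iff_eq.2 rfl]
    constructor
    · rintro ⟨z, h1, h2, h3⟩
      rw [ih (by omega)] at h1
      rw [hZ, show d + s + 2 = d + (s + 2) by omega, F.rk_lay (by omega)] at h2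
      obtain ⟨h4, h5⟩ := (hk z h1.1 h1.2.1 h2.2).1 h3
      exact ⟨h2.1, h2.2, by omega, by omega⟩
    · rintro ⟨h1, h2, h3, h4⟩
      obtain ⟨z, a, b, c, e⟩ := F.exM (s := s + 1) (by omega) (by omega) (F.M_S hZ hx)
      refine ⟨z, (ih (by omega) z).2 ⟨a, b, c, e⟩, ?_, ?_⟩
      · rw [hZ, show d + s + 2 = d + (s + 2) by omega, F.rk_lay (by omega)]
        exact ⟨h1, h2⟩
      · rw [hk z a b h2]
        omega

theorem EqI_iff {x y : V} (hx : F.M x) (hy : F.M y) :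
    EqI Z d V G x y ↔ F.row x = F.row y := by
  constructor
  · intro h
    rcases Nat.lt_trichotomy (F.row x) (F.row y) with h1 | h1 | h1
    · obtain ⟨p, a, _, _, k⟩ := F.rowdist hx.1 hy.1 hx.2 hy.2 h1
      exact absurd (h p ((hZ _ _).2 a)) k
    · exact h1
    · obtain ⟨p, a, _, _, k⟩ := F.rowdist hy.1 hx.1 hy.2 hx.2 h1
      exact absurd (h p ((hZ _ _).2 a)).symm k
  · intro h p hp
    exact F.rowsame hx.1 hy.1 hx.2 hy.2 h ((hZ _ _).1 hp)

theorem EqJ_iff {x y : V} (hx : F.M x) (hy : F.M y) :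
    EqJ Z f d r V G x y ↔ F.col x = F.col y := by
  have hr := F.good.two
  have key : ∀ x y, F.M x → F.M y → F.col x < F.col y → ¬ EqJ Z f d r V G x y := by
    intro x y hx hy hlt h
    obtain ⟨x', a, b, c, e⟩ := F.exM (s := r - 1) (by omega) (by omega) (F.M_S hZ hx)
    obtain ⟨y', a', b', c', e'⟩ := F.exM (s := r - 1) (by omega) (by omega) (F.M_S hZ hy)
    obtain ⟨p, a2, b2, k⟩ := F.coldist a a' (by omega) (by omega) (by omega) (by omega)
    refine k (h x' y' p ((F.RC_iff hZ hx (r - 2) (by omega) x').2 ⟨a, by omega, c, e⟩)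
      ((F.RC_iff hZ hy (r - 2) (by omega) y').2 ⟨a', by omega, c', e'⟩) ?_)
    rw [hZ, Nat.add_comm, F.rk_lay (by omega)]
    exact ⟨a2, by omega⟩
  constructor
  · intro h
    rcases Nat.lt_trichotomy (F.col x) (F.col y) with h1 | h1 | h1
    · exact absurd h (key _ _ hx hy h1)
    · exact h1
    · refine absurd ?_ (key _ _ hy hx h1)
      intro y' x' b h1 h2 h3
      exact (h x' y' b h2 h1 h3).symm
  · intro h x' y' b h1 h2 h3
    rw [F.RC_iff hZ hx (r - 2) (by omega)] at h1
    rw [F.RC_iff hZ hy (r - 2) (by omega)] at h2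
    rw [hZ, Nat.add_comm, F.rk_lay (by omega)] at h3
    rw [F.adj x' b (F.ne_lay (by omega)), F.adj y' b (F.ne_lay (by omega)), h1.2.1, h2.2.1,
      h1.2.2.2, h2.2.2.2, h, h3.2]
    exact F.good.last _ (by omega) _ _ _

theorem exMM {i j : ℕ} (h : S i j) : ∃ x, F.M x ∧ F.row x = i ∧ F.col x = j := by
  have hr := F.good.two
  obtain ⟨x, a, b, c, e⟩ := F.exM (s := 1) le_rfl (by omega) h
  exact ⟨x, ⟨a, b⟩, c, e⟩

theorem DelF_iff (x : V) :
    DelF Z f d r V G x ↔ F.M x ∧ ∀ i, S i (F.col x) → i = F.row x := by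
  unfold DelF
  rw [F.M_iff hZ]
  refine and_congr_right fun hx => ?_
  constructor
  · intro h i hi
    obtain ⟨y, a, b, c⟩ := F.exMM hZ hi
    rw [← b, h y ((F.M_iff hZ y).2 a) ((F.EqJ_iff hZ hx a).2 c.symm)]
  · intro h y hy hJ
    rw [F.M_iff hZ] at hy
    rw [F.EqJ_iff hZ hx hy] at hJ
    have := F.M_S hZ hy
    rw [← hJ] at this
    exact F.ext _ _ (by rw [hx.2, hy.2]) (h _ this) hJ.symm

theorem PhiF_iff {x y : V} (hx : F.M x) (hy : F.M y) :
    PhiF Z f d r V G x y ↔ F.row x ≠ F.row y ∧ ∃ j, S (F.row x) j ∧ S (F.row y) j ∧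
      ∀ i, S i j → i = F.row x ∨ i = F.row y := by
  constructor
  · rintro ⟨c, c', h1, h2, h3, h4, h5, h6, h7⟩
    rw [F.M_iff hZ] at h1 h2
    rw [F.EqI_iff hZ hx h1] at h4
    rw [F.EqI_iff hZ hy h2] at h5
    rw [F.EqJ_iff hZ h1 h2] at h6
    refine ⟨fun e => h3 (F.ext _ _ (by rw [h1.2, h2.2]) (by omega) h6), F.col c, ?_, ?_, ?_⟩
    · rw [h4]
      exact F.M_S hZ h1
    · rw [h5, h6]
      exact F.M_S hZ h2
    · intro i hi
      obtain ⟨e, a, b, k⟩ := F.exMM hZ hi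
      rcases h7 e ((F.M_iff hZ e).2 a) ((F.EqJ_iff hZ h1 a).2 k.symm) with rfl | rfl
      · left; omega
      · right; omega
  · rintro ⟨hne, j, h1, h2, h3⟩
    obtain ⟨c, a, b, k⟩ := F.exMM hZ h1
    obtain ⟨c', a', b', k'⟩ := F.exMM hZ h2
    refine ⟨c, c', (F.M_iff hZ c).2 a, (F.M_iff hZ c').2 a', ?_, (F.EqI_iff hZ hx a).2 b.symm,
      (F.EqI_iff hZ hy a').2 b'.symm, (F.EqJ_iff hZ a a').2 (by omega), ?_⟩
    · rintro rfl
      omega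
    · intro e he hJ
      rw [F.M_iff hZ] at he
      rw [F.EqJ_iff hZ a he] at hJ
      have hS := F.M_S hZ he
      rw [← hJ, k] at hS
      rcases h3 _ hS with h | h
      · left
        exact F.ext _ _ (by rw [he.2, a.2]) (by omega) (by omega)
      · right
        exact F.ext _ _ (by rw [he.2, a'.2]) (by omega) (by omega)

end Frame
end MInd

set_option autoImplicit false
namespace MInd

/-! ### Building the frame inside the given graph -/

theorem Mem.bound {d r P q : ℕ} {S : ℕ → ℕ → Prop} (hp : Pat P q S) (hr : 2 ≤ r) {s i j : ℕ}
    (h : Mem d r P q S s i j) : s ≤ r ∧ i < P + q + 10 + (r + 2) * (P + 4) ∧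
      j < P + q + 10 + (r + 2) * (P + 4) := by
  rcases h with h | h | h | ⟨h1, h2, κ, hκ, e⟩
  · omega
  · have := hp.bd _ _ h.2.2
    omega
  · omega
  · have h3 : bord P i ≤ P + 2 := by
      unfold bord
      split_ifs <;> omega
    have h4 := Nat.mul_le_mul_left (r + 2) h3
    have h5 : (r + 2) * (P + 4) = (r + 2) * (P + 2) + 2 * (r + 2) := by ring
    omega

theorem Mem.canon {d r P q : ℕ} {S : ℕ → ℕ → Prop} (hr : 2 ≤ r) {s i j i' j' : ℕ}
    (h : Mem d r P q S s i j) (h' : Mem d r P q S s i' j') (hi : s ≠ r → i = i')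
    (hj : s ≠ 0 → j = j') : i = i' ∧ j = j' := by
  by_cases h0 : s = 0
  · refine ⟨hi (by omega), ?_⟩
    rcases h with h | h | h | h <;> rcases h' with h1 | h1 | h1 | h1 <;> omega
  · refine ⟨?_, hj h0⟩
    by_cases h2 : s = r
    · rcases h with h | h | h | h <;> rcases h' with h1 | h1 | h1 | h1 <;> omega
    · exact hi h2

open Classical in
theorem exists_frame {W : Type} {E : SimpleGraph W} {r : ℕ}
    {f : ℕ → ℕ → Ordering → Ordering → Prop} (hg : Good E r f) {d P q : ℕ} {S : ℕ → ℕ → Prop}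
    (hp : Pat P q S)
    (hcs : (d = 1 ∧ (∀ σ σ', (f 1 1 σ .lt ↔ f 1 1 σ' .lt)) ∧
      (∀ τ τ', ¬ (f 0 1 .eq τ ↔ f 0 1 .lt τ'))) ∨ (d = 0 ∧ ¬ (f 1 1 .eq .lt ↔ f 1 1 .gt .lt))) :
    ∃ (N : ℕ) (g : Fin N → W), Function.Injective g ∧
      Nonempty (Frame E r f d P q S (E.comap g)) := by
  have hr := hg.two
  obtain ⟨u, hu⟩ := hg.real (P + q + 10 + (r + 2) * (P + 4))
  let B := P + q + 10 + (r + 2) * (P + 4)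
  let D : Finset (ℕ × ℕ × ℕ) := ((Finset.range (r + 1)) ×ˢ (Finset.range B ×ˢ Finset.range B)).filter
    (fun p => Mem d r P q S p.1 p.2.1 p.2.2)
  have hD : ∀ p : ℕ × ℕ × ℕ, p ∈ D ↔ Mem d r P q S p.1 p.2.1 p.2.2 := by
    intro p
    simp only [D, Finset.mem_filter, Finset.mem_product, Finset.mem_range]
    constructor
    · exact fun h => h.2
    · intro h
      obtain ⟨h1, h2, h3⟩ := Mem.bound hp hr h
      exact ⟨⟨by omega, h2, h3⟩, h⟩
  let e := D.equivFin.symm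
  let p : Fin D.card → ℕ × ℕ × ℕ := fun x => (e x).1
  have hm : ∀ x, Mem d r P q S (p x).1 (p x).2.1 (p x).2.2 := fun x => (hD _).1 (e x).2
  have hpinj : Function.Injective p := fun x y h => e.injective (Subtype.ext h)
  have hbd := fun x => Mem.bound hp hr (hm x)
  let g : Fin D.card → W := fun x => u (p x).1 (p x).2.1 (p x).2.2
  have hgi : Function.Injective g := by
    intro x y h
    obtain ⟨h1, h2, h3⟩ := hu.inj _ _ _ _ _ _ (hbd x).1 (hbd y).1 (hbd x).2.1 (hbd x).2.2
      (hbd y).2.1 (hbd y).2.2 h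
    have h4 := hm y
    rw [← h1] at h4
    obtain ⟨h5, h6⟩ := Mem.canon hr (hm x) h4 h2 h3
    exact hpinj (Prod.ext h1 (Prod.ext h5 h6))
  refine ⟨D.card, g, hgi, ⟨?_⟩⟩
  exact {
    good := hg
    pat := hp
    cs := hcs
    lay := fun x => (p x).1
    row := fun x => (p x).2.1
    col := fun x => (p x).2.2
    ext := fun x y h1 h2 h3 => hpinj (Prod.ext h1 (Prod.ext h2 h3))
    mem := hm
    surj := fun s i j h => by
      refine ⟨e.symm ⟨(s, i, j), (hD _).2 h⟩, ?_⟩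
      simp [p]
    adj := fun x y hxy => by
      rw [SimpleGraph.comap_adj]
      exact hu.adj _ _ _ _ _ _ (hbd x).1 (hbd y).1 (hbd x).2.1 (hbd x).2.2
        (hbd y).2.1 (hbd y).2.2 (fun h => hxy (hgi h)) }

/-! ### The pattern encoding a graph -/

/-- The incidence pattern of a graph `H`. -/
def SH (n : ℕ) (H : SimpleGraph (Fin n)) (i j : ℕ) : Prop :=
  1 ≤ i ∧ i ≤ n + 3 ∧ j ≤ n * n + 1 ∧ ∀ a b : Fin n, j = a * n + b → (H.Adj a b ∨ a = b) →
    i = a + 1 ∨ i = b + 1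

theorem pair_lt {n : ℕ} (a b : Fin n) : (a : ℕ) * n + b < n * n := by
  have h := Nat.mul_le_mul_right n (Nat.succ_le_of_lt a.2)
  rw [Nat.succ_mul] at h
  have := b.2
  omega

theorem pair_inj {n : ℕ} {a b a' b' : Fin n} (h : (a : ℕ) * n + b = a' * n + b') :
    a = a' ∧ b = b' := by
  have hn : 0 < n := a.pos
  have h1 := congrArg (· / n) h
  have h2 := congrArg (· % n) h
  rw [Nat.mul_comm, Nat.mul_comm (a' : ℕ), Nat.mul_add_div hn, Nat.mul_add_div hn,
    Nat.div_eq_of_lt b.2, Nat.div_eq_of_lt b'.2] at h1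
  rw [Nat.mul_comm, Nat.mul_comm (a' : ℕ), Nat.mul_add_mod, Nat.mul_add_mod,
    Nat.mod_eq_of_lt b.2, Nat.mod_eq_of_lt b'.2] at h2
  exact ⟨Fin.ext (by omega), Fin.ext (by omega)⟩

section
variable {n : ℕ} {H : SimpleGraph (Fin n)}

theorem SH_pair {a b : Fin n} (h : H.Adj a b ∨ a = b) (i : ℕ) :
    SH n H i (a * n + b) ↔ i = a + 1 ∨ i = b + 1 := by
  have := pair_lt a b
  have ha := a.2
  have hb := b.2
  constructor
  · intro h1
    exact h1.2.2.2 a b rfl h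
  · intro h1
    refine ⟨by omega, by omega, by omega, fun a' b' e _ => ?_⟩
    obtain ⟨rfl, rfl⟩ := pair_inj e
    exact h1

theorem SH_free {j : ℕ} (hj : j ≤ n * n + 1)
    (h : ¬ ∃ a b : Fin n, j = a * n + b ∧ (H.Adj a b ∨ a = b)) {i : ℕ} (h1 : 1 ≤ i)
    (h2 : i ≤ n + 3) : SH n H i j :=
  ⟨h1, h2, hj, fun a b e hab => absurd ⟨a, b, e, hab⟩ h⟩

theorem SH_pat (n : ℕ) (H : SimpleGraph (Fin n)) : Pat (n + 3) (n * n + 1) (SH n H) where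
  hP := by omega
  hq := by omega
  bd i j h := ⟨h.1, h.2.1, h.2.2.1⟩
  ne j hj := by
    by_cases h : ∃ a b : Fin n, j = a * n + b ∧ (H.Adj a b ∨ a = b)
    · obtain ⟨a, b, rfl, hab⟩ := h
      exact ⟨a + 1, (SH_pair hab _).2 (Or.inl rfl)⟩
    · exact ⟨1, SH_free hj h le_rfl (by omega)⟩
  full i h1 h2 := by
    constructor
    · exact ⟨h1, h2, by omega, fun a b e _ => by have := pair_lt a b; omega⟩
    · exact ⟨h1, h2, by omega, fun a b e _ => by have := pair_lt a b; omega⟩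

theorem SH_single {i j : ℕ} (hS : SH n H i j) (h : ∀ i', SH n H i' j → i' = i) :
    ∃ a : Fin n, i = a + 1 ∧ j = a * n + a := by
  by_cases hh : ∃ a b : Fin n, j = a * n + b ∧ (H.Adj a b ∨ a = b)
  · obtain ⟨a, b, rfl, hab⟩ := hh
    have h1 := h _ ((SH_pair hab _).2 (Or.inl rfl))
    have h2 := h _ ((SH_pair hab _).2 (Or.inr rfl))
    have h3 : a = b := Fin.ext (by omega)
    subst h3
    exact ⟨a, h1.symm, rfl⟩
  · have h1 := h 1 (SH_free hS.2.2.1 hh (by omega) (by omega))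
    have h2 := h 2 (SH_free hS.2.2.1 hh (by omega) (by omega))
    omega

theorem SH_edge (u v : Fin n) : (((u : ℕ) + 1 ≠ v + 1) ∧ ∃ j, SH n H (u + 1) j ∧
    SH n H (v + 1) j ∧ ∀ i, SH n H i j → i = u + 1 ∨ i = v + 1) ↔ H.Adj u v := by
  constructor
  · rintro ⟨hne, j, h1, h2, h3⟩
    by_cases hh : ∃ a b : Fin n, j = a * n + b ∧ (H.Adj a b ∨ a = b)
    · obtain ⟨a, b, rfl, hab⟩ := hh
      rw [SH_pair hab] at h1 h2
      have hab' : H.Adj a b := by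
        rcases hab with h | rfl
        · exact h
        · omega
      rcases h1 with h1 | h1
      · have e1 : u = a := Fin.ext (by omega)
        have e2 : v = b := Fin.ext (by omega)
        rw [e1, e2]
        exact hab'
      · have e1 : u = b := Fin.ext (by omega)
        have e2 : v = a := Fin.ext (by omega)
        rw [e1, e2]
        exact hab'.symm
    · have k1 := h3 1 (SH_free h1.2.2.1 hh (by omega) (by omega))
      have k2 := h3 2 (SH_free h1.2.2.1 hh (by omega) (by omega))
      have k3 := h3 3 (SH_free h1.2.2.1 hh (by omega) (by omega))
      omega
  · intro h
    refine ⟨fun e => h.ne (Fin.ext (by omega)), u * n + v, ?_, ?_, ?_⟩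
    · exact (SH_pair (Or.inl h) _).2 (Or.inl rfl)
    · exact (SH_pair (Or.inl h) _).2 (Or.inr rfl)
    · exact fun i hi => (SH_pair (Or.inl h) _).1 hi

end

/-! ### Assembly -/

theorem main_aux (C : GraphClass) (hHer : Hereditary C) (hT : TransducesAllGraphs C) :
    ∃ (δ : (colLang 0).Formula (Fin 1)) (φ : (colLang 0).Formula (Fin 2)),
      (∀ (n : ℕ) (G : SimpleGraph (Fin n)),
        (∀ u v : Fin n, gSat2 G φ u v ↔ gSat2 G φ v u) ∧
        (∀ u : Fin n, ¬ gSat2 G φ u u)) ∧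
      (∀ (n : ℕ) (H : SimpleGraph (Fin n)),
        ∃ (N : ℕ) (G : SimpleGraph (Fin N)), C N G ∧
          ∃ e : Fin n → Fin N, Function.Injective e ∧
            (∀ u : Fin n, gSat1 G δ (e u)) ∧
            (∀ w : Fin N, gSat1 G δ w → ∃ u : Fin n, e u = w) ∧
            (∀ u v : Fin n, H.Adj u v ↔ gSat2 G φ (e u) (e v))) := by
  obtain ⟨W, k, Sy, hSy⟩ := exists_sys hHer hT
  obtain ⟨r0, f0, hM⟩ := Sy.exists_mesh
  obtain ⟨r, f, hg⟩ := exists_good hM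
  obtain ⟨d, hcs⟩ : ∃ d : ℕ, (d = 1 ∧ (∀ σ σ', (f 1 1 σ .lt ↔ f 1 1 σ' .lt)) ∧
      (∀ τ τ', ¬ (f 0 1 .eq τ ↔ f 0 1 .lt τ'))) ∨
      (d = 0 ∧ ¬ (f 1 1 .eq .lt ↔ f 1 1 .gt .lt)) := by
    rcases hg.cs with h | h
    · exact ⟨1, Or.inl ⟨rfl, h⟩⟩
    · exact ⟨0, Or.inr ⟨rfl, h⟩⟩
  let Z : ℕ → ∀ V : Type, SimpleGraph V → V → Prop := fun s => (ZU (r + 1) (d + 1) s).1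
  have hZd : ∀ s, Def1 (Z s) := fun s => (ZU_def _ _ s).1
  obtain ⟨δ, hδ⟩ := (DelF_def f d r hZd).formula
  have hPd := PhiF_def f d r hZd
  have hφd : Def2 (fun V G x y => x ≠ y ∧ (PhiF Z f d r V G x y ∨ PhiF Z f d r V G y x)) :=
    (Def.eq 0 1).not.and ((hPd.at 0 1).or (hPd.at 1 0))
  obtain ⟨φ, hφ⟩ := hφd.formula
  refine ⟨δ, φ, ?_, ?_⟩
  · intro n G
    refine ⟨fun u v => ?_, fun u => ?_⟩
    · rw [hφ, hφ]
      rw [ne_comm, or_comm]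
    · rw [hφ]
      exact fun h => h.1 rfl
  · intro n H
    obtain ⟨N, g, hgi, ⟨F⟩⟩ := exists_frame hg (SH_pat n H) hcs
    have hZ : ∀ s x, Z s (Fin N) (Sy.E.comap g) x ↔ F.rk x = s := fun s => (F.ZU_iff s).1
    refine ⟨N, Sy.E.comap g, hSy N g hgi, ?_⟩
    have hex : ∀ u : Fin n, ∃ x, F.M x ∧ F.row x = u + 1 ∧ F.col x = u * n + u := fun u =>
      F.exMM hZ ((SH_pair (Or.inr rfl) _).2 (Or.inl rfl))
    choose e he1 he2 he3 using hex
    refine ⟨e, ?_, ?_, ?_, ?_⟩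
    · intro u v h
      have := congrArg F.row h
      rw [he2, he2] at this
      exact Fin.ext (by omega)
    · intro u
      rw [hδ, F.DelF_iff hZ]
      refine ⟨he1 u, fun i hi => ?_⟩
      rw [he3, SH_pair (Or.inr rfl)] at hi
      rw [he2]
      omega
    · intro w hw
      rw [hδ, F.DelF_iff hZ] at hw
      obtain ⟨a, h1, h2⟩ := SH_single (F.M_S hZ hw.1) hw.2
      exact ⟨a, F.ext _ _ (by rw [(he1 a).2, hw.1.2]) (by rw [he2, h1]) (by rw [he3, h2])⟩
    · intro u v
      rw [hφ, F.PhiF_iff hZ (he1 u) (he1 v), F.PhiF_iff hZ (he1 v) (he1 u), he2, he2, SH_edge,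
        SH_edge]
      constructor
      · intro h
        refine ⟨fun e' => ?_, Or.inl h⟩
        have := congrArg F.row e'
        rw [he2, he2] at this
        exact h.ne (Fin.ext (by omega))
      · rintro ⟨_, h | h⟩
        · exact h
        · exact h.symm

end MInd

/-- Every hereditary graph class that is monadically independent interprets
the class of all graphs: there exist first-order formulas `δ(x)` and `φ(x,y)` over the language
of graphs, with `φ` symmetric and irreflexive, such that every finite graph is isomorphic to
`I_{δ,φ}(G)` (the graph on `{v : δ(v)}` with edges `{uv : φ(u,v)}`) for some `G` in the class. -/
theorem hereditary_monadicallyIndependent_interprets_all_graphs (C : GraphClass)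
    (hHer : Hereditary C) (hInd : ¬ MonadicallyDependent C) :
    ∃ (δ : (colLang 0).Formula (Fin 1)) (φ : (colLang 0).Formula (Fin 2)),
      (∀ (n : ℕ) (G : SimpleGraph (Fin n)),
        (∀ u v : Fin n, gSat2 G φ u v ↔ gSat2 G φ v u) ∧
        (∀ u : Fin n, ¬ gSat2 G φ u u)) ∧
      (∀ (n : ℕ) (H : SimpleGraph (Fin n)),
        ∃ (N : ℕ) (G : SimpleGraph (Fin N)), C N G ∧
          ∃ e : Fin n → Fin N, Function.Injective e ∧
            (∀ u : Fin n, gSat1 G δ (e u)) ∧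
            (∀ w : Fin N, gSat1 G δ w → ∃ u : Fin n, e u = w) ∧
            (∀ u v : Fin n, H.Adj u v ↔ gSat2 G φ (e u) (e v))) := by
  exact MInd.main_aux C hHer (not_not.1 hInd)
end

section
/- Every flip-breakable class of finite graphs is monadically dependent. -/
set_option autoImplicit false

open FirstOrder

/-- `H` is a `k`-flip of `G`: for some partition of the vertex set into at most `k` parts
(given by `P : V → Fin k`) and some symmetric relation `F` on the parts, distinct vertices
`u, v` are adjacent in `H` iff (`uv ∈ E(G)`) XOR (`(P u, P v) ∈ F`). -/
def IsKFlip {V : Type} (k : ℕ) (G H : SimpleGraph V) : Prop :=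
  ∃ (P : V → Fin k) (F : Fin k → Fin k → Prop), Symmetric F ∧
    ∀ u v : V, u ≠ v → (H.Adj u v ↔ Xor' (G.Adj u v) (F (P u) (P v)))

/-- A graph class `C` is flip-breakable: for every radius `r` there are `N : ℕ → ℕ` and
`k : ℕ` such that for all `m`, every `W ⊆ V(G)` with `|W| ≥ N m` in a graph `G ∈ C`
contains subsets `A, B` of size at least `m` and there is a `k`-flip `H` of `G` in which
every path from `A` to `B` has length greater than `r` (i.e. `dist_H(A,B) > r`). -/
def FlipBreakable (C : GraphClass) : Prop :=
  ∀ r : ℕ, ∃ (N : ℕ → ℕ) (k : ℕ),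
    ∀ (m n : ℕ) (G : SimpleGraph (Fin n)), C n G →
      ∀ W : Finset (Fin n), N m ≤ W.card →
        ∃ A B : Finset (Fin n), A ⊆ W ∧ B ⊆ W ∧ m ≤ A.card ∧ m ≤ B.card ∧
          ∃ H : SimpleGraph (Fin n), IsKFlip k G H ∧
            ∀ a ∈ A, ∀ b ∈ B, ∀ p : H.Walk a b, r < p.length

/-- Ehrenfeucht–Fraïssé equivalence with `s` rounds left, on a set of matched pairs, in a
graph `H` whose vertices are coloured by `col`. -/
def EFEquiv {V K : Type} (H : SimpleGraph V) (col : V → K) : ℕ → Set (V × V) → Prop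
  | 0, p => ∀ x ∈ p, ∀ y ∈ p, (x.1 = y.1 ↔ x.2 = y.2) ∧
      (H.Adj x.1 y.1 ↔ H.Adj x.2 y.2) ∧ col x.1 = col x.2
  | s + 1, p => (∀ u, ∃ u', EFEquiv H col s (insert (u, u') p)) ∧
      (∀ u', ∃ u, EFEquiv H col s (insert (u, u') p))

theorem EFEquiv.mono {V K : Type} {H : SimpleGraph V} {col : V → K} (s : ℕ) :
    ∀ {p q : Set (V × V)}, q ⊆ p → EFEquiv H col s p → EFEquiv H col s q := by
  induction s with
  | zero => intro p q hqp h x hx y hy; exact h x (hqp hx) y (hqp hy)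
  | succ s ih =>
    intro p q hqp h
    refine ⟨fun u => ?_, fun u => ?_⟩
    · obtain ⟨u', hu⟩ := h.1 u
      exact ⟨u', ih (Set.insert_subset_insert hqp) hu⟩
    · obtain ⟨u', hu⟩ := h.2 u
      exact ⟨u', ih (Set.insert_subset_insert hqp) hu⟩

theorem EFEquiv.pred {V K : Type} [Nonempty V] {H : SimpleGraph V} {col : V → K} {s : ℕ}
    {p : Set (V × V)} (h : EFEquiv H col (s + 1) p) : EFEquiv H col s p := by
  obtain ⟨u', hu⟩ := h.1 (Classical.arbitrary V)
  exact EFEquiv.mono s (Set.subset_insert _ _) hu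

theorem EFEquiv.le {V K : Type} [Nonempty V] {H : SimpleGraph V} {col : V → K} {s t : ℕ}
    (hst : s ≤ t) {p : Set (V × V)} (h : EFEquiv H col t p) : EFEquiv H col s p := by
  induction t, hst using Nat.le_induction with
  | base => exact h
  | succ t _ ih => exact ih h.pred

theorem EFEquiv.diag {V K : Type} (H : SimpleGraph V) (col : V → K) (s : ℕ) :
    ∀ {p : Set (V × V)}, (∀ x ∈ p, x.1 = x.2) → EFEquiv H col s p := by
  induction s with
  | zero =>
    intro p hp x hx y hy
    rw [hp x hx, hp y hy]; simp
  | succ s ih =>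
    intro p hp
    have : ∀ u, EFEquiv H col s (insert (u, u) p) := by
      intro u
      apply ih
      intro x hx
      rcases hx with rfl | hx
      · rfl
      · exact hp x hx
    exact ⟨fun u => ⟨u, this u⟩, fun u => ⟨u, this u⟩⟩

/-- Locality: near and far positions can be played independently. -/
theorem EFEquiv.union {V K : Type} [Nonempty V] {H : SimpleGraph V} {col : V → K} (l : V → ℕ)
    (hl : ∀ u w, H.Adj u w → l w ≤ l u + 1) (hc : ∀ u w, col u = col w → l u = l w) (s : ℕ) :
    ∀ (p q : Set (V × V)) (i j : ℕ), i + 2 ^ s < j → (∀ x ∈ p, l x.1 ≤ i) →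
      (∀ x ∈ q, j ≤ l x.1) → EFEquiv H col s p → EFEquiv H col s q →
      EFEquiv H col s (p ∪ q) := by
  induction s with
  | zero =>
    intro p q i j hij hp hq Ep Eq
    have key : ∀ x ∈ p, ∀ y ∈ q, l x.1 + 1 < l y.1 ∧ l x.2 + 1 < l y.2 := by
      intro x hx y hy
      have h1 := hp x hx
      have h2 := hq y hy
      have h3 := hc _ _ (Ep x hx x hx).2.2
      have h4 := hc _ _ (Eq y hy y hy).2.2
      simp at hij
      omega
    have far : ∀ u w, l u + 1 < l w → ¬ u = w ∧ ¬ H.Adj u w := by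
      intro u w h
      refine ⟨?_, fun h' => ?_⟩
      · rintro rfl; omega
      · have := hl _ _ h'; omega
    intro x hx y hy
    rcases hx with hx | hx <;> rcases hy with hy | hy
    · exact Ep x hx y hy
    · have k := key x hx y hy
      have k1 := far _ _ k.1
      have k2 := far _ _ k.2
      exact ⟨iff_of_false k1.1 k2.1, iff_of_false k1.2 k2.2, (Ep x hx x hx).2.2⟩
    · have k := key y hy x hx
      have k1 := far _ _ k.1
      have k2 := far _ _ k.2
      refine ⟨iff_of_false (fun h => k1.1 h.symm) (fun h => k2.1 h.symm),
        iff_of_false (fun h => k1.2 h.symm) (fun h => k2.2 h.symm), (Eq x hx x hx).2.2⟩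
    · exact Eq x hx y hy
  | succ s ih =>
    intro p q i j hij hp hq Ep Eq
    rw [pow_succ] at hij
    have hcol : ∀ (t : ℕ) (r : Set (V × V)) (u u' : V),
        EFEquiv H col t (insert (u, u') r) → l u = l u' := by
      intro t r u u' h
      have h0 := EFEquiv.le (Nat.zero_le t) h
      exact hc _ _ (h0 (u, u') (Set.mem_insert _ _) (u, u') (Set.mem_insert _ _)).2.2
    have near : ∀ u u', l u ≤ i + 2 ^ s → EFEquiv H col s (insert (u, u') p) →
        EFEquiv H col s (insert (u, u') (p ∪ q)) := by
      intro u u' hu h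
      rw [← Set.insert_union]
      refine ih _ _ (i + 2 ^ s) j (by omega) ?_ hq h Eq.pred
      intro x hx
      rcases hx with rfl | hx
      · exact hu
      · have := hp x hx; omega
    have far : ∀ u u', i + 2 ^ s < l u → EFEquiv H col s (insert (u, u') q) →
        EFEquiv H col s (insert (u, u') (p ∪ q)) := by
      intro u u' hu h
      rw [← Set.union_insert]
      refine ih _ _ i (i + 2 ^ s + 1) (by omega) hp ?_ Ep.pred h
      intro x hx
      rcases hx with rfl | hx
      · exact hu
      · have := hq x hx; omega
    refine ⟨fun u => ?_, fun u' => ?_⟩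
    · rcases le_or_gt (l u) (i + 2 ^ s) with hu | hu
      · obtain ⟨u', h⟩ := Ep.1 u
        exact ⟨u', near u u' hu h⟩
      · obtain ⟨u', h⟩ := Eq.1 u
        exact ⟨u', far u u' hu h⟩
    · rcases le_or_gt (l u') (i + 2 ^ s) with hu | hu
      · obtain ⟨u, h⟩ := Ep.2 u'
        exact ⟨u, near u u' (by rw [hcol _ _ _ _ h]; exact hu) h⟩
      · obtain ⟨u, h⟩ := Eq.2 u'
        exact ⟨u, far u u' (by rw [hcol _ _ _ _ h]; exact hu) h⟩

/-- The finite set of rank-`s` types of `n`-tuples. -/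
def EFType (K : Type) : ℕ → ℕ → Type
  | 0, n => (Fin n → Fin n → Prop × Prop) × (Fin n → K)
  | s + 1, n => Set (EFType K s (n + 1))

theorem EFType.finite (K : Type) [Finite K] (s : ℕ) : ∀ n, Finite (EFType K s n) := by
  induction s with
  | zero =>
    intro n
    show Finite ((Fin n → Fin n → Prop × Prop) × (Fin n → K))
    infer_instance
  | succ s ih =>
    intro n
    have := ih (n + 1)
    show Finite (Set (EFType K s (n + 1)))
    infer_instance

/-- The rank-`s` type of a tuple. -/
def efType {V K : Type} (H : SimpleGraph V) (col : V → K) :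
    ∀ (s n : ℕ), (Fin n → V) → EFType K s n
  | 0, _, x => (fun i j => (x i = x j, H.Adj (x i) (x j)), fun i => col (x i))
  | s + 1, n, x => Set.range fun u : V => efType H col s (n + 1) (Fin.cons u x)

theorem efType_equiv {V K : Type} (H : SimpleGraph V) (col : V → K) (s : ℕ) :
    ∀ (n : ℕ) (x y : Fin n → V), efType H col s n x = efType H col s n y →
      EFEquiv H col s (Set.range fun i => (x i, y i)) := by
  induction s with
  | zero =>
    intro n x y h
    have h1 := congrArg Prod.fst h
    have h2 := congrArg Prod.snd h
    rintro _ ⟨i, rfl⟩ _ ⟨j, rfl⟩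
    have h3 := congrFun (congrFun h1 i) j
    exact ⟨iff_of_eq (congrArg Prod.fst h3), iff_of_eq (congrArg Prod.snd h3), congrFun h2 i⟩
  | succ s ih =>
    intro n x y h
    have h' : (Set.range fun u : V => efType H col s (n + 1) (Fin.cons u x)) =
      Set.range fun u : V => efType H col s (n + 1) (Fin.cons u y) := h
    have key : ∀ u u', efType H col s (n + 1) (Fin.cons u x) =
        efType H col s (n + 1) (Fin.cons u' y) →
        EFEquiv H col s (insert (u, u') (Set.range fun i => (x i, y i))) := by
      intro u u' e
      refine EFEquiv.mono s ?_ (ih _ _ _ e)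
      intro z hz
      rcases hz with rfl | ⟨i, rfl⟩
      · exact ⟨0, by simp⟩
      · exact ⟨i.succ, by simp⟩
    refine ⟨fun u => ?_, fun u' => ?_⟩
    · have : efType H col s (n + 1) (Fin.cons u x) ∈
          Set.range fun u : V => efType H col s (n + 1) (Fin.cons u y) := by
        rw [← h']; exact ⟨u, rfl⟩
      obtain ⟨u', hu'⟩ := this
      exact ⟨u', key u u' hu'.symm⟩
    · have : efType H col s (n + 1) (Fin.cons u' y) ∈
          Set.range fun u : V => efType H col s (n + 1) (Fin.cons u x) := by
        rw [h']; exact ⟨u', rfl⟩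
      obtain ⟨u, hu⟩ := this
      have hkey := key u u' hu
      exact ⟨u, hkey⟩

/-- Formulas are preserved by Ehrenfeucht–Fraïssé equivalence of sufficiently large rank. -/
theorem EFEquiv.realize {k : ℕ} {α : Type} {n : ℕ} (φ : (colLang k).BoundedFormula α n) :
    ∃ s : ℕ, ∀ (V K : Type) (_ : Nonempty V) (G H : SimpleGraph V) (c : V → Fin k) (col : V → K),
      (∀ u u', col u = col u' → c u = c u') →
      (∀ u u' w w', (u = w ↔ u' = w') → (H.Adj u w ↔ H.Adj u' w') → col u = col u' →
        col w = col w' → (G.Adj u w ↔ G.Adj u' w')) →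
      ∀ p, EFEquiv H col s p → ∀ (f f' : α → V) (x x' : Fin n → V),
        (∀ i, (f i, f' i) ∈ p) → (∀ i, (x i, x' i) ∈ p) →
        letI := colStruct G c
        (φ.Realize f x ↔ φ.Realize f' x') := by
  have term : ∀ {m : ℕ} (t : (colLang k).Term (α ⊕ Fin m)), ∃ z, t = FirstOrder.Language.Term.var z := by
    intro m t
    cases t with
    | var z => exact ⟨z, rfl⟩
    | func f _ => exact Empty.elim f
  have pair : ∀ {V : Type} {m : ℕ} {p : Set (V × V)} {f f' : α → V} {x x' : Fin m → V},
      (∀ i, (f i, f' i) ∈ p) → (∀ i, (x i, x' i) ∈ p) →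
      ∀ z, (Sum.elim f x z, Sum.elim f' x' z) ∈ p := by
    intro V m p f f' x x' h h' z
    cases z with
    | inl i => exact h i
    | inr i => exact h' i
  induction φ with
  | falsum => exact ⟨0, by intros; exact Iff.rfl⟩
  | equal t₁ t₂ =>
    obtain ⟨z₁, rfl⟩ := term t₁
    obtain ⟨z₂, rfl⟩ := term t₂
    refine ⟨0, ?_⟩
    intro V K _ G H c col hc hG p hp f f' x x' hf hx
    exact (hp _ (pair hf hx z₁) _ (pair hf hx z₂)).1
  | @rel m l R ts =>
    refine ⟨0, ?_⟩
    intro V K _ G H c col hc hG p hp f f' x x' hf hx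
    choose z hz using fun i => term (ts i)
    obtain rfl : ts = fun i => FirstOrder.Language.Term.var (z i) := funext hz
    match l, R, z with
    | 0, R, _ => exact Empty.elim R
    | 1, R, z =>
      have := hc _ _ (hp _ (pair hf hx (z 0)) _ (pair hf hx (z 0))).2.2
      show c (Sum.elim f x (z 0)) = R ↔ c (Sum.elim f' x' (z 0)) = R
      dsimp only at this
      rw [this]
    | 2, _, z =>
      show G.Adj (Sum.elim f x (z 0)) (Sum.elim f x (z 1)) ↔
        G.Adj (Sum.elim f' x' (z 0)) (Sum.elim f' x' (z 1))
      have h1 := hp _ (pair hf hx (z 0)) _ (pair hf hx (z 1))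
      have h2 := hp _ (pair hf hx (z 1)) _ (pair hf hx (z 0))
      exact hG _ _ _ _ h1.1 h1.2.1 h1.2.2 h2.2.2
    | _ + 3, R, _ => exact Empty.elim R
  | imp φ ψ ih₁ ih₂ =>
    obtain ⟨s₁, h₁⟩ := ih₁
    obtain ⟨s₂, h₂⟩ := ih₂
    refine ⟨max s₁ s₂, ?_⟩
    intro V K _ G H c col hc hG p hp f f' x x' hf hx
    exact imp_congr
      (h₁ V K ‹_› G H c col hc hG p (hp.le (le_max_left _ _)) f f' x x' hf hx)
      (h₂ V K ‹_› G H c col hc hG p (hp.le (le_max_right _ _)) f f' x x' hf hx)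
  | @all m φ ih =>
    obtain ⟨s, h⟩ := ih
    refine ⟨s + 1, ?_⟩
    intro V K _ G H c col hc hG p hp f f' x x' hf hx
    have key : ∀ u u', EFEquiv H col s (insert (u, u') p) →
        letI := colStruct G c
        (φ.Realize f (Fin.snoc x u) ↔ φ.Realize f' (Fin.snoc x' u')) := by
      intro u u' hu
      refine h V K ‹_› G H c col hc hG _ hu f f' _ _ (fun i => Or.inr (hf i)) ?_
      intro i
      refine Fin.lastCases ?_ (fun i => ?_) i
      · simp
      · simpa using Or.inr (hx i)
    constructor
    · intro hall u'
      obtain ⟨u, hu⟩ := hp.2 u'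
      exact (key u u' hu).1 (hall u)
    · intro hall u
      obtain ⟨u', hu'⟩ := hp.1 u
      have hkey := (key u u' hu').2 (hall u')
      exact hkey

/-- Truncated distance to the set `A`. -/
theorem exists_layer {V : Type} (H : SimpleGraph V) (A : Set V) (R : ℕ) :
    ∃ l : V → ℕ, (∀ v, l v ≤ R + 1) ∧ (∀ a ∈ A, l a = 0) ∧
      (∀ u w, H.Adj u w → l w ≤ l u + 1) ∧
      (∀ v, l v ≤ R → ∃ a ∈ A, ∃ p : H.Walk a v, p.length ≤ R) := by
  classical
  let P : V → ℕ → Prop := fun v i => R + 1 ≤ i ∨ ∃ a ∈ A, ∃ p : H.Walk a v, p.length ≤ i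
  have ex : ∀ v, ∃ i, P v i := fun v => ⟨R + 1, Or.inl le_rfl⟩
  refine ⟨fun v => Nat.find (ex v), fun v => Nat.find_min' _ (Or.inl le_rfl), ?_, ?_, ?_⟩
  · intro a ha
    exact Nat.le_zero.1 (Nat.find_min' _ (Or.inr ⟨a, ha, SimpleGraph.Walk.nil, le_rfl⟩))
  · intro u w huw
    show Nat.find (ex w) ≤ Nat.find (ex u) + 1
    apply Nat.find_min'
    rcases Nat.find_spec (ex u) with h | ⟨a, ha, p, hp⟩
    · left; omega
    · right
      refine ⟨a, ha, p.concat huw, ?_⟩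
      rw [SimpleGraph.Walk.length_concat]; omega
  · intro v hv
    rcases Nat.find_spec (ex v) with h | ⟨a, ha, p, hp⟩
    · exact absurd (h.trans hv) (by omega)
    · exact ⟨a, ha, p, hp.trans hv⟩

/-- In a large set `A`, some two vertices cannot be distinguished by `φ` from any vertex which
is far from `A` in the flip `H`. -/
theorem indist {k : ℕ} (φ : (colLang k).Formula (Fin 2)) :
    ∃ R : ℕ, ∀ kr : ℕ, ∃ m : ℕ, ∀ (V : Type) (G H : SimpleGraph V) (c : V → Fin k),
      IsKFlip kr G H → ∀ A : Finset V, m ≤ A.card →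
        ∃ a ∈ A, ∃ a' ∈ A, a ≠ a' ∧ ∀ v, (∀ b ∈ A, ∀ p : H.Walk b v, R < p.length) →
          (colSat G c φ a v ↔ colSat G c φ a' v) ∧ (colSat G c φ v a ↔ colSat G c φ v a') := by
  classical
  obtain ⟨s, hs⟩ := EFEquiv.realize φ
  refine ⟨2 ^ s, fun kr => ?_⟩
  let K := Fin k × Fin kr × Fin (2 ^ s + 2)
  have := EFType.finite K s 1
  have := Fintype.ofFinite (EFType K s 1)
  refine ⟨Fintype.card (EFType K s 1) + 1, ?_⟩
  rintro V G H c ⟨P, F, hF, hflip⟩ A hA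
  obtain ⟨l, hl1, hl2, hl3, hl4⟩ := exists_layer H (A : Set V) (2 ^ s)
  let col : V → K := fun v => (c v, P v, ⟨l v, by have := hl1 v; omega⟩)
  obtain ⟨a, ha, a', ha', hne, heq⟩ := Finset.exists_ne_map_eq_of_card_lt_of_maps_to
    (s := A) (t := (Finset.univ : Finset (EFType K s 1)))
    (f := fun a => efType H col s 1 (fun _ => a))
    (by rw [Finset.card_univ]; omega) (fun _ _ => Finset.mem_coe.2 (Finset.mem_univ _))
  refine ⟨a, ha, a', ha', hne, fun v hv => ?_⟩
  have hne : Nonempty V := ⟨a⟩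
  have hcol : ∀ u w, col u = col w → c u = c w ∧ P u = P w ∧ l u = l w := by
    intro u w h
    have h1 : c u = c w := congrArg Prod.fst h
    have h2 : P u = P w := congrArg (fun z => z.2.1) h
    have h3 : l u = l w := congrArg (fun z => (z.2.2 : ℕ)) h
    exact ⟨h1, h2, h3⟩
  have E1 := efType_equiv H col s 1 _ _ heq
  have E2 : EFEquiv H col s {(v, v)} := EFEquiv.diag H col s (by rintro x rfl; rfl)
  have hlv : 2 ^ s < l v := by
    by_contra hcon
    obtain ⟨b, hb, p, hp⟩ := hl4 v (not_lt.1 hcon)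
    have := hv b hb p
    omega
  have E := EFEquiv.union l hl3 (fun u w h => (hcol u w h).2.2) s _ _ 0 (l v) (by omega)
    (by rintro _ ⟨i, rfl⟩; exact (hl2 a ha).le) (by rintro _ rfl; exact le_rfl) E1 E2
  have main := hs V K hne G H c col (fun u w h => (hcol u w h).1) (by
    intro u u' w w' h1 h2 h3 h4
    by_cases huw : u = w
    · have := h1.1 huw
      subst huw; subst this; simp
    · have huw' : ¬ u' = w' := fun h => huw (h1.2 h)
      have f1 := hflip u w huw
      have f2 := hflip u' w' huw'
      rw [(hcol _ _ h3).2.1, (hcol _ _ h4).2.1] at f1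
      simp only [Xor', Xor] at f1 f2
      tauto) _ E
  have ma : (a, a') ∈ ((Set.range fun _ : Fin 1 => (a, a')) ∪ {(v, v)} : Set (V × V)) :=
    Or.inl ⟨0, rfl⟩
  have mv : (v, v) ∈ ((Set.range fun _ : Fin 1 => (a, a')) ∪ {(v, v)} : Set (V × V)) :=
    Or.inr rfl
  constructor
  · exact main ![a, v] ![a', v] _ _ (by intro i; fin_cases i; exacts [ma, mv]) (fun i => i.elim0)
  · exact main ![v, a] ![v, a'] _ _ (by intro i; fin_cases i; exacts [mv, ma]) (fun i => i.elim0)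

/-- The 1-subdivided complete graph. -/
def subdiv (n : ℕ) : SimpleGraph (Fin n ⊕ (Fin n × Fin n)) where
  Adj x y := match x, y with
    | .inl a, .inr b => a = b.1 ∨ a = b.2
    | .inr b, .inl a => a = b.1 ∨ a = b.2
    | _, _ => False
  symm := ⟨by rintro (a | a) (b | b) h <;> exact h⟩
  loopless := ⟨by rintro (a | a) h <;> exact h⟩

/-- Every flip-breakable class of finite graphs is monadically dependent. -/
theorem flipBreakable_monadicallyDependent (C : GraphClass) (h : FlipBreakable C) :
    MonadicallyDependent C := by
  classical
  rintro ⟨k, φ, hφ⟩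
  obtain ⟨R, hR⟩ := indist φ
  obtain ⟨N, kr, hN⟩ := h (2 * R)
  obtain ⟨m, hm⟩ := hR kr
  let X := Fin (N m) ⊕ (Fin (N m) × Fin (N m))
  let ε : X ≃ Fin (Fintype.card X) := Fintype.equivFin X
  obtain ⟨M, G, hG, c, e, he, hadj⟩ := hφ _ ((subdiv (N m)).comap ε.symm)
  let g : X → Fin M := fun x => e (ε x)
  have hg : Function.Injective g := he.comp ε.injective
  have hgadj : ∀ x y, (subdiv (N m)).Adj x y ↔
      (g x ≠ g y ∧ (colSat G c φ (g x) (g y) ∨ colSat G c φ (g y) (g x))) := by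
    intro x y
    have := hadj (ε x) (ε y)
    simpa using this
  let W : Finset (Fin M) := Finset.univ.image fun i : Fin (N m) => g (.inl i)
  have hW : N m ≤ W.card := by
    have := Finset.card_image_of_injective (Finset.univ : Finset (Fin (N m)))
      (hg.comp Sum.inl_injective)
    rw [Finset.card_univ, Fintype.card_fin] at this
    exact this.ge
  obtain ⟨A, B, hA, hB, hAm, hBm, H, hH, hw⟩ := hN m M G hG W hW
  obtain ⟨a, ha, a', ha', hna, hia⟩ := hm _ G H c hH A hAm
  obtain ⟨b, hb, b', hb', hnb, hib⟩ := hm _ G H c hH B hBm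
  have hdisj : ∀ x ∈ A, ∀ y ∈ B, x ≠ y := by
    rintro x hx y hy rfl
    have := hw x hx x hy SimpleGraph.Walk.nil
    simp at this
  have hWm : ∀ x ∈ W, ∃ i, g (.inl i) = x := by
    intro x hx
    obtain ⟨i, _, hi⟩ := Finset.mem_image.1 hx
    exact ⟨i, hi⟩
  obtain ⟨i, rfl⟩ := hWm a (hA ha)
  obtain ⟨i', rfl⟩ := hWm a' (hA ha')
  obtain ⟨j, rfl⟩ := hWm b (hB hb)
  obtain ⟨j', rfl⟩ := hWm b' (hB hb')
  have n1 : i' ≠ i := by rintro rfl; exact hna rfl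
  have n2 : i' ≠ j := by rintro rfl; exact hdisj _ ha' _ hb rfl
  have n3 : j' ≠ j := by rintro rfl; exact hnb rfl
  have n4 : j' ≠ i := by rintro rfl; exact hdisj _ ha _ hb' rfl
  have ad : ∀ t : Fin (N m), (t = i ∨ t = j) ↔
      (colSat G c φ (g (.inl t)) (g (.inr (i, j))) ∨
        colSat G c φ (g (.inr (i, j))) (g (.inl t))) := by
    intro t
    have h1 := hgadj (.inl t) (.inr (i, j))
    have h2 : g (.inl t) ≠ g (.inr (i, j)) := fun h => by simpa using hg h
    exact h1.trans (and_iff_right h2)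
  by_cases hfa : ∀ b ∈ A, ∀ p : H.Walk b (g (.inr (i, j))), R < p.length
  · obtain ⟨q1, q2⟩ := hia _ hfa
    have r1 := (ad i).1 (Or.inl rfl)
    rw [q1, q2] at r1
    rcases (ad i').2 r1 with h | h
    exacts [n1 h, n2 h]
  · by_cases hfb : ∀ b ∈ B, ∀ p : H.Walk b (g (.inr (i, j))), R < p.length
    · obtain ⟨q1, q2⟩ := hib _ hfb
      have r1 := (ad j).1 (Or.inr rfl)
      rw [q1, q2] at r1
      rcases (ad j').2 r1 with h | h
      exacts [n4 h, n3 h]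
    · push Not at hfa hfb
      obtain ⟨x, hx, p, hp⟩ := hfa
      obtain ⟨y, hy, q, hq⟩ := hfb
      have := hw x hx y hy (p.append q.reverse)
      rw [SimpleGraph.Walk.length_append, SimpleGraph.Walk.length_reverse] at this
      omega
end
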